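/- Let g be a Riemannian metric on T². If there exists an oscillating geodesic ray c: [0,∞) → ℝ² on the universal covering, then the geodesic flow of g has positive topological entropy. -/

import Mathlib

open Filter Topology Set
open scoped ENNReal

noncomputable section

/-- The Euclidean norm of a point of `ℝ × ℝ` (the universal covering of `T²`). -/
def norm2 (p : ℝ × ℝ) : ℝ := Real.sqrt (p.1 ^ 2 + p.2 ^ 2)

/-- The translation vector of the covering transformation `τ_{(m,n)}` of `T² = ℝ²/ℤ²`. -/
def lat (k : ℤ × ℤ) : ℝ × ℝ := ((k.1 : ℝ), (k.2 : ℝ))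

/-- The transl of a curve in `ℝ²` by the covering transformation `τ_k`. -/
def transl (k : ℤ × ℤ) (c : ℝ → ℝ × ℝ) : ℝ → ℝ × ℝ := fun t => c t + lat k

/-- The asymptotic direction `δ(τ_k)` of the axes of the translation element `τ_k`. -/
def latDir (k : ℤ × ℤ) : ℝ × ℝ := (norm2 (lat k))⁻¹ • lat k

/-- A smooth Riemannian metric on the torus `T² = ℝ²/ℤ²`, described through its lift to the
universal covering `ℝ²`: a smooth family of positive definite symmetric bilinear forms on the
tangent spaces of `ℝ²`, invariant under the deck transformation group `ℤ²`. -/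
structure TorusMetric where
  g : (ℝ × ℝ) → (ℝ × ℝ) → (ℝ × ℝ) → ℝ
  smooth : ContDiff ℝ (⊤ : ℕ∞) fun p : (ℝ × ℝ) × (ℝ × ℝ) × (ℝ × ℝ) => g p.1 p.2.1 p.2.2
  symm : ∀ x v w, g x v w = g x w v
  linear : ∀ x w, IsLinearMap ℝ fun v => g x v w
  posdef : ∀ x v, v ≠ 0 → 0 < g x v v
  periodic : ∀ (k : ℤ × ℤ) (x v w : ℝ × ℝ), g (x + lat k) v w = g x v w

namespace TorusMetric

/-- The Riemannian length of the curve `c` between the parameters `a` and `b`. -/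
def length (M : TorusMetric) (c : ℝ → ℝ × ℝ) (a b : ℝ) : ℝ :=
  ∫ t in a..b, Real.sqrt (M.g (c t) (deriv c t) (deriv c t))

/-- The Riemannian distance on the universal covering `ℝ²` (hence also on `T²`). -/
def dist (M : TorusMetric) (x y : ℝ × ℝ) : ℝ :=
  sInf {L | ∃ c : ℝ → ℝ × ℝ, ContDiff ℝ 1 c ∧ c 0 = x ∧ c 1 = y ∧ L = M.length c 0 1}

/-- A (complete, unit speed) geodesic of the lifted metric on the universal covering `ℝ²`:
a smooth curve with constant unit speed which is locally length minimizing. -/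
def IsGeodesic (M : TorusMetric) (c : ℝ → ℝ × ℝ) : Prop :=
  ContDiff ℝ (⊤ : ℕ∞) c ∧ (∀ t, M.g (c t) (deriv c t) (deriv c t) = 1) ∧
    ∀ t : ℝ, ∃ ε > 0, ∀ s₁ s₂, t - ε ≤ s₁ → s₁ ≤ s₂ → s₂ ≤ t + ε →
      M.dist (c s₁) (c s₂) = M.length c s₁ s₂

end TorusMetric

/-- The distance between two points of the unit tangent bundle `ST²` of the torus; points of
`ST²` are represented by points of the tangent bundle `ℝ² × ℝ²` of the universal covering
(the deck transformations act trivially on the vector component). -/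
def phaseDist (p q : (ℝ × ℝ) × (ℝ × ℝ)) : ℝ :=
  sInf {r : ℝ | ∃ k : ℤ × ℤ, r = norm2 (p.1 - (q.1 + lat k)) + norm2 (p.2 - q.2)}

/-- A `(φ,ε)`-separated set with respect to time `T` for the geodesic flow `φ` of `M` on
`ST²`: a finite family of geodesics (each geodesic `c` representing the phase point
`(c 0, ċ 0) ∈ ST²`, of which `t ↦ (c t, ċ t)` is the flow orbit) such that any two distinct
members satisfy `max_{0 ≤ t ≤ T} d(φᵗ v, φᵗ w) > ε`. -/
def IsSeparated (M : TorusMetric) (ε T : ℝ) (F : Finset (ℝ → ℝ × ℝ)) : Prop :=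
  (∀ c ∈ F, M.IsGeodesic c) ∧
    ∀ c₁ ∈ F, ∀ c₂ ∈ F, c₁ ≠ c₂ →
      ∃ t ∈ Set.Icc (0 : ℝ) T, ε < phaseDist (c₁ t, deriv c₁ t) (c₂ t, deriv c₂ t)

/-- `r_T(φ, ε)`: the maximal cardinality of `(φ,ε)`-separated sets with respect to `T`. -/
def sepCount (M : TorusMetric) (ε T : ℝ) : ℝ≥0∞ :=
  ⨆ (F : Finset (ℝ → ℝ × ℝ)) (_ : IsSeparated M ε T F), (F.card : ℝ≥0∞)

/-- Extended real logarithm of an extended nonnegative real. -/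
def elog (x : ℝ≥0∞) : EReal :=
  if x = 0 then ⊥ else if x = ⊤ then ⊤ else ((Real.log x.toReal : ℝ) : EReal)

/-- Bowen's topological entropy `h_top(g)` of the geodesic flow of `g` on `ST²`:
`lim_{ε → 0} limsup_{T → ∞} (1/T) log r_T(φ,ε)`; since `r_T(φ,ε)` is monotone in `ε`,
the limit `ε → 0` is realized as the supremum over `ε > 0`. -/
def topEnt (M : TorusMetric) : EReal :=
  ⨆ (ε : ℝ) (_ : 0 < ε),
    Filter.limsup (fun T : ℝ => ((T⁻¹ : ℝ) : EReal) * elog (sepCount M ε T)) Filter.atTop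

/-- The forward ray `c⁺` of `c` is escaping: `‖c(t)‖ → ∞` as `t → ∞`. -/
def EscapesForward (c : ℝ → ℝ × ℝ) : Prop :=
  Filter.Tendsto (fun t => norm2 (c t)) Filter.atTop Filter.atTop

/-- The backward ray `c⁻` of `c` is escaping: `‖c(-t)‖ → ∞` as `t → ∞`. -/
def EscapesBackward (c : ℝ → ℝ × ℝ) : Prop :=
  Filter.Tendsto (fun t => norm2 (c (-t))) Filter.atTop Filter.atTop

/-- `z ∈ S¹` is the asymptotic direction `δ(c⁺) = lim_{t → ∞} c(t)/‖c(t)‖` of the forward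
ray of `c`. -/
def HasDirection (c : ℝ → ℝ × ℝ) (z : ℝ × ℝ) : Prop :=
  norm2 z = 1 ∧ Filter.Tendsto (fun t => (norm2 (c t))⁻¹ • c t) Filter.atTop (nhds z)

/-- The canonical projection `π : S¹ → P¹(ℝ) ≅ ℝ ∪ {∞}`, sending `(x, y)` to `y/x` if
`x ≠ 0` and to `∞` otherwise; `ℝ ∪ {∞}` is the one-point compactification of `ℝ`. -/
def projPt (z : ℝ × ℝ) : OnePoint ℝ :=
  if z.1 = 0 then OnePoint.infty else ((z.2 / z.1 : ℝ) : OnePoint ℝ)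

/-- `crossDet v w ≠ 0` expresses transversality of two directions in `ℝ²`. -/
def crossDet (v w : ℝ × ℝ) : ℝ := v.1 * w.2 - v.2 * w.1

/-- The set of points at which the curve `c₁` (restricted to parameters in `D₁`) and the
curve `c₂` (restricted to parameters in `D₂`) intersect transversally. -/
def transInter (c₁ c₂ : ℝ → ℝ × ℝ) (D₁ D₂ : Set ℝ) : Set (ℝ × ℝ) :=
  {x | ∃ s ∈ D₁, ∃ t ∈ D₂, c₁ s = x ∧ c₂ t = x ∧ crossDet (deriv c₁ s) (deriv c₂ t) ≠ 0}

/-- The geodesic `c` is an axis of the (nontrivial) translation element `τ_k`: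
`τ_k c(t) = c(t + ℓ)` for some `ℓ` and all `t`. -/
def IsAxisOf (M : TorusMetric) (c : ℝ → ℝ × ℝ) (k : ℤ × ℤ) : Prop :=
  M.IsGeodesic c ∧ k ≠ 0 ∧ ∃ ℓ : ℝ, ∀ t, c (t + ℓ) = c t + lat k

/-- The geodesic `c` is an axis of some nontrivial translation element. -/
def IsAxis (M : TorusMetric) (c : ℝ → ℝ × ℝ) : Prop := ∃ k : ℤ × ℤ, IsAxisOf M c k

/-- The curve `c` is minimal: each of its segments minimizes the Riemannian length between
its endpoints. -/
def IsMinimal (M : TorusMetric) (c : ℝ → ℝ × ℝ) : Prop :=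
  ∀ s t : ℝ, s ≤ t → M.dist (c s) (c t) = M.length c s t

/-- Equivalence of translation elements: `τ₁^a = τ₂^b` for some nonzero integers `a, b`. -/
def TransEquiv (k₁ k₂ : ℤ × ℤ) : Prop := ∃ a b : ℤ, a ≠ 0 ∧ b ≠ 0 ∧ a • k₁ = b • k₂

/-- A translation element is primitive if it is not a nontrivial power of another
translation element. -/
def IsPrimitive (k : ℤ × ℤ) : Prop := k ≠ 0 ∧ ∀ (j : ℤ × ℤ) (n : ℤ), k = n • j → IsUnit n

/-- The metric `g` on `T²` is flat, i.e. its Gaussian curvature vanishes identically;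
equivalently (by the theorems of Myers–Steenrod and Cartan–Hadamard), the universal covering
`ℝ²` with the induced Riemannian distance is isometric to the Euclidean plane. -/
def IsFlat (M : TorusMetric) : Prop :=
  ∃ F : (ℝ × ℝ) ≃ (ℝ × ℝ), ∀ x y, M.dist x y = norm2 (F x - F y)

/-- A continuous `ℤ²`-periodic function on the plane is bounded. -/
lemma exists_bound_of_periodic {F : Type*} [NormedAddCommGroup F] {f : ℝ × ℝ → F}
    (hf : Continuous f) (hp : ∀ k x, f (x + lat k) = f x) : ∃ C, ∀ x, ‖f x‖ ≤ C := by
  obtain ⟨C, hC⟩ := (isCompact_Icc (a := ((0 : ℝ), (0 : ℝ))) (b := ((1 : ℝ), (1 : ℝ)))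
    ).exists_bound_of_continuousOn hf.continuousOn
  refine ⟨C, fun x => ?_⟩
  have h := hp (⌊x.1⌋, ⌊x.2⌋) (Int.fract x.1, Int.fract x.2)
  have hx : ((Int.fract x.1, Int.fract x.2) : ℝ × ℝ) + lat (⌊x.1⌋, ⌊x.2⌋) = x := by
    ext <;> simp [lat]
  rw [hx] at h
  rw [h]
  apply hC
  exact ⟨⟨Int.fract_nonneg _, Int.fract_nonneg _⟩,
    ⟨(Int.fract_lt_one _).le, (Int.fract_lt_one _).le⟩⟩

/-- A `C¹` periodic function on the plane is Lipschitz. -/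
lemma exists_lipschitz_of_periodic {f : ℝ × ℝ → ℝ}
    (hf : ContDiff ℝ (⊤ : ℕ∞) f) (hp : ∀ k x, f (x + lat k) = f x) :
    ∃ C, ∀ x y, |f x - f y| ≤ C * ‖x - y‖ := by
  obtain ⟨C, hC⟩ := exists_bound_of_periodic (f := fderiv ℝ f)
    (hf.continuous_fderiv (by simp)) (by
      intro k x
      have : f = fun y => f (y + lat k) := by ext y; exact (hp k y).symm
      conv_rhs => rw [this]
      rw [fderiv_comp_add_right])
  refine ⟨C, fun x y => ?_⟩
  rw [← Real.norm_eq_abs]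
  exact Convex.norm_image_sub_le_of_norm_fderiv_le (s := univ) (𝕜 := ℝ)
    (fun z _ => (hf.differentiable (by simp)) z) (fun z _ => hC z) convex_univ
    (mem_univ _) (mem_univ _)

namespace TorusMetric

/-- The coefficient `g₁₁`. -/
def cE (M : TorusMetric) (x : ℝ × ℝ) : ℝ := M.g x (1, 0) (1, 0)

/-- The coefficient `g₁₂`. -/
def cF (M : TorusMetric) (x : ℝ × ℝ) : ℝ := M.g x (1, 0) (0, 1)

/-- The coefficient `g₂₂`. -/
def cG (M : TorusMetric) (x : ℝ × ℝ) : ℝ := M.g x (0, 1) (0, 1)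

lemma g_eq (M : TorusMetric) (x v w : ℝ × ℝ) :
    M.g x v w = M.cE x * (v.1 * w.1) + M.cF x * (v.1 * w.2 + v.2 * w.1)
      + M.cG x * (v.2 * w.2) := by
  have key : ∀ a w, M.g x a w = a.1 * M.g x (1, 0) w + a.2 * M.g x (0, 1) w := by
    intro a w
    have hl := M.linear x w
    have ha : a = a.1 • ((1 : ℝ), (0 : ℝ)) + a.2 • ((0 : ℝ), (1 : ℝ)) := by
      ext <;> simp
    conv_lhs => rw [ha]
    rw [hl.map_add, hl.map_smul, hl.map_smul]
    simp
  rw [key v w, M.symm x (1, 0) w, M.symm x (0, 1) w, key w, key w,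
    M.symm x (0, 1) (1, 0)]
  simp only [cE, cF, cG]
  ring

lemma contDiff_cE (M : TorusMetric) : ContDiff ℝ (⊤ : ℕ∞) M.cE :=
  M.smooth.comp (f := fun x : ℝ × ℝ => (x, ((1 : ℝ), (0 : ℝ)), ((1 : ℝ), (0 : ℝ))))
    (contDiff_id.prodMk contDiff_const)

lemma contDiff_cF (M : TorusMetric) : ContDiff ℝ (⊤ : ℕ∞) M.cF :=
  M.smooth.comp (f := fun x : ℝ × ℝ => (x, ((1 : ℝ), (0 : ℝ)), ((0 : ℝ), (1 : ℝ))))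
    (contDiff_id.prodMk contDiff_const)

lemma contDiff_cG (M : TorusMetric) : ContDiff ℝ (⊤ : ℕ∞) M.cG :=
  M.smooth.comp (f := fun x : ℝ × ℝ => (x, ((0 : ℝ), (1 : ℝ)), ((0 : ℝ), (1 : ℝ))))
    (contDiff_id.prodMk contDiff_const)

lemma exists_bounds (M : TorusMetric) : ∃ C : ℝ, 1 ≤ C ∧
    (∀ x v, M.g x v v ≤ C ^ 2 * ‖v‖ ^ 2) ∧ (∀ x v, ‖v‖ ^ 2 ≤ C ^ 2 * M.g x v v) ∧
    (∀ x y v, |M.g x v v - M.g y v v| ≤ C * ‖x - y‖ * ‖v‖ ^ 2) := by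
  have pE : ∀ k x, M.cE (x + lat k) = M.cE x := fun k x => M.periodic k x _ _
  have pF : ∀ k x, M.cF (x + lat k) = M.cF x := fun k x => M.periodic k x _ _
  have pG : ∀ k x, M.cG (x + lat k) = M.cG x := fun k x => M.periodic k x _ _
  have pos1 : ∀ x, 0 < M.cE x := fun x => M.posdef x _ (by simp)
  have pos2 : ∀ x, 0 < M.cG x := fun x => M.posdef x _ (by simp)
  have posd : ∀ x, 0 < M.cE x * M.cG x - M.cF x ^ 2 := by
    intro x
    have h := M.posdef x (-M.cF x, M.cE x) (by
      intro h; have := congrArg Prod.snd h; simp at this; exact (pos1 x).ne' this)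
    rw [g_eq] at h
    simp only at h
    have h1 := pos1 x
    have : 0 < M.cE x * (M.cE x * M.cG x - M.cF x ^ 2) := by nlinarith
    exact (pos_iff_pos_of_mul_pos this).1 h1
  obtain ⟨C1, hC1⟩ := exists_bound_of_periodic M.contDiff_cE.continuous pE
  obtain ⟨C2, hC2⟩ := exists_bound_of_periodic M.contDiff_cF.continuous pF
  obtain ⟨C3, hC3⟩ := exists_bound_of_periodic M.contDiff_cG.continuous pG
  obtain ⟨C4, hC4⟩ := exists_bound_of_periodic
    (f := fun x => (M.cE x + M.cG x) / (M.cE x * M.cG x - M.cF x ^ 2))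
    (by
      refine (M.contDiff_cE.continuous.add M.contDiff_cG.continuous).div
        ((M.contDiff_cE.continuous.mul M.contDiff_cG.continuous).sub
          (M.contDiff_cF.continuous.pow 2)) (fun x => (posd x).ne'))
    (by intro k x; simp only [pE, pF, pG])
  obtain ⟨L1, hL1⟩ := exists_lipschitz_of_periodic M.contDiff_cE pE
  obtain ⟨L2, hL2⟩ := exists_lipschitz_of_periodic M.contDiff_cF pF
  obtain ⟨L3, hL3⟩ := exists_lipschitz_of_periodic M.contDiff_cG pG
  have bnd : ∀ (a b c : ℝ) (v : ℝ × ℝ) (A B C : ℝ), |a| ≤ A → |b| ≤ B → |c| ≤ C →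
      |a * (v.1 * v.1) + b * (v.1 * v.2 + v.2 * v.1) + c * (v.2 * v.2)| ≤
        (A + 2 * B + C) * ‖v‖ ^ 2 := by
    intro a b c v A B C ha hb hc
    have h1 : |v.1| ≤ ‖v‖ := norm_fst_le v
    have h2 : |v.2| ≤ ‖v‖ := norm_snd_le v
    have e1 : |a * (v.1 * v.1)| ≤ A * ‖v‖ ^ 2 := by
      rw [abs_mul, abs_mul, sq]; gcongr; exact (abs_nonneg _).trans ha
    have e2 : |b * (v.1 * v.2 + v.2 * v.1)| ≤ 2 * B * ‖v‖ ^ 2 := by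
      have : |v.1 * v.2 + v.2 * v.1| ≤ 2 * ‖v‖ ^ 2 := by
        rw [show v.1 * v.2 + v.2 * v.1 = 2 * (v.1 * v.2) by ring, abs_mul, abs_mul, sq]
        simp only [Nat.abs_ofNat]; gcongr
      rw [abs_mul]
      calc _ ≤ B * (2 * ‖v‖ ^ 2) := by gcongr; exact (abs_nonneg _).trans hb
        _ = _ := by ring
    have e3 : |c * (v.2 * v.2)| ≤ C * ‖v‖ ^ 2 := by
      rw [abs_mul, abs_mul, sq]; gcongr; exact (abs_nonneg _).trans hc
    calc _ ≤ _ := abs_add_three _ _ _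
      _ ≤ _ := add_le_add (add_le_add e1 e2) e3
      _ = _ := by ring
  set C : ℝ := 1 + |C1 + 2 * C2 + C3| + |C4| + |L1 + 2 * L2 + L3| with hC
  have hC1' : 1 ≤ C := by
    have := abs_nonneg (C1 + 2 * C2 + C3); have := abs_nonneg C4
    have := abs_nonneg (L1 + 2 * L2 + L3); linarith
  have hCsq : C ≤ C ^ 2 := by nlinarith
  refine ⟨C, hC1', fun x v => ?_, fun x v => ?_, fun x y v => ?_⟩
  · rw [g_eq]
    refine (le_abs_self _).trans ((bnd _ _ _ v _ _ _ (hC1 x) (hC2 x) (hC3 x)).trans ?_)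
    gcongr
    have := le_abs_self (C1 + 2 * C2 + C3); have := abs_nonneg C4
    have := abs_nonneg (L1 + 2 * L2 + L3); linarith
  · have h4 : (M.cE x + M.cG x) / (M.cE x * M.cG x - M.cF x ^ 2) ≤ C := by
      have h := (le_abs_self _).trans (hC4 x)
      have := abs_nonneg (C1 + 2 * C2 + C3); have := le_abs_self C4
      have := abs_nonneg (L1 + 2 * L2 + L3); linarith
    rw [div_le_iff₀ (posd x)] at h4
    have hg : 0 ≤ M.g x v v := by
      rcases eq_or_ne v 0 with rfl | hv
      · rw [g_eq]; simp
      · exact (M.posdef x v hv).le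
    refine le_trans ?_ (mul_le_mul_of_nonneg_right hCsq hg)
    have hd := posd x
    have h1 := pos1 x
    have h2 := pos2 x
    have k1 : (M.cE x * M.cG x - M.cF x ^ 2) * v.1 ^ 2 ≤ M.cG x * M.g x v v := by
      rw [g_eq]; nlinarith [sq_nonneg (M.cF x * v.1 + M.cG x * v.2)]
    have k2 : (M.cE x * M.cG x - M.cF x ^ 2) * v.2 ^ 2 ≤ M.cE x * M.g x v v := by
      rw [g_eq]; nlinarith [sq_nonneg (M.cE x * v.1 + M.cF x * v.2)]
    have k3 : ‖v‖ ^ 2 ≤ v.1 ^ 2 + v.2 ^ 2 := by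
      rw [Prod.norm_def]
      rcases max_cases ‖v.1‖ ‖v.2‖ with ⟨h, -⟩ | ⟨h, -⟩ <;> rw [h] <;> simp <;> positivity
    have k4 : (M.cE x * M.cG x - M.cF x ^ 2) * (v.1 ^ 2 + v.2 ^ 2)
        ≤ (M.cE x * M.cG x - M.cF x ^ 2) * (C * M.g x v v) := by
      calc _ ≤ (M.cE x + M.cG x) * M.g x v v := by linarith
        _ ≤ C * (M.cE x * M.cG x - M.cF x ^ 2) * M.g x v v := by gcongr
        _ = _ := by ring
    exact k3.trans (le_of_mul_le_mul_left k4 hd)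
  · rw [g_eq, g_eq]
    have := bnd (M.cE x - M.cE y) (M.cF x - M.cF y) (M.cG x - M.cG y) v _ _ _
      (hL1 x y) (hL2 x y) (hL3 x y)
    refine le_trans (le_of_eq ?_) (this.trans ?_)
    · congr 1; ring
    · rw [show L1 * ‖x - y‖ + 2 * (L2 * ‖x - y‖) + L3 * ‖x - y‖
        = (L1 + 2 * L2 + L3) * ‖x - y‖ by ring]
      gcongr
      have := abs_nonneg (C1 + 2 * C2 + C3); have := abs_nonneg C4
      have := le_abs_self (L1 + 2 * L2 + L3); linarith

/-- A constant controlling the metric and its first derivatives uniformly. -/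
def bd (M : TorusMetric) : ℝ := Classical.choose M.exists_bounds

lemma one_le_bd (M : TorusMetric) : 1 ≤ M.bd := (Classical.choose_spec M.exists_bounds).1

lemma bd_pos (M : TorusMetric) : 0 < M.bd := zero_lt_one.trans_le M.one_le_bd

lemma g_le (M : TorusMetric) (x v : ℝ × ℝ) : M.g x v v ≤ M.bd ^ 2 * ‖v‖ ^ 2 :=
  (Classical.choose_spec M.exists_bounds).2.1 x v

lemma norm_sq_le (M : TorusMetric) (x v : ℝ × ℝ) : ‖v‖ ^ 2 ≤ M.bd ^ 2 * M.g x v v :=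
  (Classical.choose_spec M.exists_bounds).2.2.1 x v

lemma abs_g_sub_le (M : TorusMetric) (x y v : ℝ × ℝ) :
    |M.g x v v - M.g y v v| ≤ M.bd * ‖x - y‖ * ‖v‖ ^ 2 :=
  (Classical.choose_spec M.exists_bounds).2.2.2 x y v

lemma g_nonneg (M : TorusMetric) (x v : ℝ × ℝ) : 0 ≤ M.g x v v := by
  rcases eq_or_ne v 0 with rfl | hv
  · rw [g_eq]; simp
  · exact (M.posdef x v hv).le

end TorusMetric

lemma hasDerivAt_fst_comp {c : ℝ → ℝ × ℝ} {c' : ℝ × ℝ} {t : ℝ} (h : HasDerivAt c c' t) :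
    HasDerivAt (fun t => (c t).1) c'.1 t :=
  (ContinuousLinearMap.fst ℝ ℝ ℝ).hasFDerivAt.comp_hasDerivAt t h

lemma hasDerivAt_snd_comp {c : ℝ → ℝ × ℝ} {c' : ℝ × ℝ} {t : ℝ} (h : HasDerivAt c c' t) :
    HasDerivAt (fun t => (c t).2) c'.2 t :=
  (ContinuousLinearMap.snd ℝ ℝ ℝ).hasFDerivAt.comp_hasDerivAt t h

namespace TorusMetric

lemma g_smul (M : TorusMetric) (x v : ℝ × ℝ) (r : ℝ) : M.g x (r • v) (r • v) = r ^ 2 * M.g x v v := by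
  simp only [g_eq, Prod.smul_fst, Prod.smul_snd, smul_eq_mul]; ring

lemma continuous_g (M : TorusMetric) {u v w : ℝ → ℝ × ℝ} (hu : Continuous u) (hv : Continuous v)
    (hw : Continuous w) : Continuous fun t => M.g (u t) (v t) (w t) :=
  M.smooth.continuous.comp (hu.prodMk (hv.prodMk hw))

lemma continuous_speed (M : TorusMetric) {c : ℝ → ℝ × ℝ} (hc : ContDiff ℝ 1 c) :
    Continuous fun t => Real.sqrt (M.g (c t) (deriv c t) (deriv c t)) :=
  Real.continuous_sqrt.comp
    (M.continuous_g hc.continuous (hc.continuous_deriv le_rfl) (hc.continuous_deriv le_rfl))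

lemma length_nonneg (M : TorusMetric) (c : ℝ → ℝ × ℝ) {a b : ℝ} (hab : a ≤ b) :
    0 ≤ M.length c a b :=
  intervalIntegral.integral_nonneg hab fun _ _ => Real.sqrt_nonneg _

lemma length_congr (M : TorusMetric) {c c' : ℝ → ℝ × ℝ} {a b : ℝ} (hab : a ≤ b)
    (h : ∀ t ∈ Ioo a b, c t = c' t) : M.length c a b = M.length c' a b := by
  refine intervalIntegral.integral_congr_Ioo_of_le hab fun t ht => ?_
  have he : c =ᶠ[𝓝 t] c' := by
    filter_upwards [isOpen_Ioo.mem_nhds ht] with s hs using h s hs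
  simp only [he.eq_of_nhds, he.deriv_eq]

lemma length_comp (M : TorusMetric) {c : ℝ → ℝ × ℝ} (hc : ContDiff ℝ 1 c) {φ : ℝ → ℝ}
    (hφ : ContDiff ℝ 1 φ) (hφ' : ∀ t, 0 ≤ deriv φ t) (a b : ℝ) :
    M.length (fun t => c (φ t)) a b = M.length c (φ a) (φ b) := by
  have hd : ∀ t, HasDerivAt φ (deriv φ t) t :=
    fun t => ((hφ.differentiable (by simp)) t).hasDerivAt
  unfold length
  rw [← intervalIntegral.integral_comp_mul_deriv (fun t _ => hd t)
    (hφ.continuous_deriv le_rfl).continuousOn (M.continuous_speed hc)]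
  congr 1; ext t
  have h1 : deriv (fun t => c (φ t)) t = deriv φ t • deriv c (φ t) :=
    (((hc.differentiable (by simp)) (φ t)).hasDerivAt.scomp t (hd t)).deriv
  rw [h1, g_smul, Real.sqrt_mul (sq_nonneg _), Real.sqrt_sq (hφ' t), mul_comm]
  rfl

/-- The set of lengths of `C¹` curves joining two points. -/
def lengths (M : TorusMetric) (x y : ℝ × ℝ) : Set ℝ :=
  {L | ∃ c : ℝ → ℝ × ℝ, ContDiff ℝ 1 c ∧ c 0 = x ∧ c 1 = y ∧ L = M.length c 0 1}

lemma bddBelow_lengths (M : TorusMetric) (x y : ℝ × ℝ) : BddBelow (M.lengths x y) :=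
  ⟨0, by rintro _ ⟨c, _, _, _, rfl⟩; exact M.length_nonneg c zero_le_one⟩

lemma contDiff_segment (x v : ℝ × ℝ) : ContDiff ℝ 1 fun t : ℝ => x + t • v :=
  contDiff_const.add (contDiff_id.smul contDiff_const)

lemma lengths_nonempty (M : TorusMetric) (x y : ℝ × ℝ) : (M.lengths x y).Nonempty :=
  ⟨_, fun t => x + t • (y - x), contDiff_segment _ _, by simp, by simp, rfl⟩

lemma dist_le_length (M : TorusMetric) {c : ℝ → ℝ × ℝ} (hc : ContDiff ℝ 1 c) {a b : ℝ}
    (hab : a ≤ b) : M.dist (c a) (c b) ≤ M.length c a b := by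
  have hφ : ContDiff ℝ 1 fun t : ℝ => a + t * (b - a) :=
    contDiff_const.add (contDiff_id.mul contDiff_const)
  have hd : ∀ t, deriv (fun t : ℝ => a + t * (b - a)) t = b - a := by
    intro t; simp
  have := M.length_comp hc hφ (fun t => by rw [hd]; linarith) 0 1
  have h2 : M.length (fun t => c (a + t * (b - a))) 0 1 ∈ M.lengths (c a) (c b) :=
    ⟨_, hc.comp hφ, by simp, by simp, rfl⟩
  refine (csInf_le (M.bddBelow_lengths _ _) h2).trans_eq ?_
  rw [this]; simp

lemma dist_nonneg (M : TorusMetric) (x y : ℝ × ℝ) : 0 ≤ M.dist x y :=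
  le_csInf (M.lengths_nonempty x y) (by
    rintro _ ⟨c, _, _, _, rfl⟩; exact M.length_nonneg c zero_le_one)

lemma le_dist_of_forall (M : TorusMetric) {x y : ℝ × ℝ} {G : ℝ} {f : ℝ → ℝ} (hf : Continuous f)
    (h : ∀ c : ℝ → ℝ × ℝ, ContDiff ℝ 1 c → c 0 = x → c 1 = y → G ≤ f (M.length c 0 1)) :
    G ≤ f (M.dist x y) := by
  obtain ⟨u, -, hu, hm⟩ := exists_seq_tendsto_sInf (M.lengths_nonempty x y)
    (M.bddBelow_lengths x y)
  refine ge_of_tendsto' ((hf.tendsto _).comp hu) fun n => ?_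
  obtain ⟨c, hc, h0, h1, hL⟩ := hm n
  simp only [Function.comp, hL]
  exact h c hc h0 h1

lemma norm_le_speed (M : TorusMetric) (x v : ℝ × ℝ) : ‖v‖ ≤ M.bd * Real.sqrt (M.g x v v) := by
  have := M.norm_sq_le x v
  rw [← Real.sqrt_sq (M.bd_pos.le), ← Real.sqrt_mul (sq_nonneg _)]
  exact Real.le_sqrt_of_sq_le this

lemma speed_le_norm (M : TorusMetric) (x v : ℝ × ℝ) : Real.sqrt (M.g x v v) ≤ M.bd * ‖v‖ := by
  apply Real.sqrt_le_iff.2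
  exact ⟨by have := M.bd_pos; positivity, by rw [mul_pow]; exact M.g_le x v⟩

lemma norm_sub_le_length (M : TorusMetric) {c : ℝ → ℝ × ℝ} (hc : ContDiff ℝ 1 c) {a b : ℝ}
    (hab : a ≤ b) : ‖c b - c a‖ ≤ M.bd * M.length c a b := by
  have hd := hc.continuous_deriv le_rfl
  rw [← intervalIntegral.integral_eq_sub_of_hasDerivAt (f := c) (f' := deriv c)
    (fun t _ => ((hc.differentiable (by simp)) t).hasDerivAt) (hd.intervalIntegrable _ _)]
  refine (intervalIntegral.norm_integral_le_integral_norm hab).trans ?_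
  unfold length
  rw [← intervalIntegral.integral_const_mul]
  exact intervalIntegral.integral_mono_on hab (hd.norm.intervalIntegrable _ _)
    ((continuous_const.mul (M.continuous_speed hc)).intervalIntegrable _ _)
    fun t _ => M.norm_le_speed _ _

lemma length_add (M : TorusMetric) {c : ℝ → ℝ × ℝ} (hc : ContDiff ℝ 1 c) (a b e : ℝ) :
    M.length c a b + M.length c b e = M.length c a e :=
  intervalIntegral.integral_add_adjacent_intervals
    ((M.continuous_speed hc).intervalIntegrable _ _)
    ((M.continuous_speed hc).intervalIntegrable _ _)

lemma norm_sub_le (M : TorusMetric) (x y : ℝ × ℝ) : ‖x - y‖ ≤ M.bd * M.dist x y := by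
  refine M.le_dist_of_forall (f := fun L => M.bd * L) (by fun_prop) fun c hc h0 h1 => ?_
  rw [← h0, ← h1, norm_sub_rev]
  exact M.norm_sub_le_length hc zero_le_one

/-- Comparison of the distance with the straight segment, to second order. -/
lemma dist_sq_le (M : TorusMetric) (x y : ℝ × ℝ) :
    M.dist x y ^ 2 ≤ M.g x (y - x) (y - x) + M.bd * ‖y - x‖ ^ 3 := by
  set v := y - x with hv
  set R := M.g x v v + M.bd * ‖v‖ ^ 3 with hR
  have hR0 : 0 ≤ R := by have := M.g_nonneg x v; have := M.bd_pos; positivity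
  have h1 : M.dist x y ≤ Real.sqrt R := by
    have := M.dist_le_length (contDiff_segment x v) zero_le_one
    simp only [zero_smul, add_zero, one_smul, hv, add_sub_cancel] at this
    rw [← hv] at this
    refine this.trans ?_
    have hd : ∀ t : ℝ, deriv (fun t : ℝ => x + t • v) t = v := by
      intro t
      have : HasDerivAt (fun t : ℝ => x + t • v) ((1 : ℝ) • v) t :=
        ((hasDerivAt_id t).smul_const v).const_add x
      simpa using this.deriv
    have : M.length (fun t : ℝ => x + t • v) 0 1 ≤ ∫ _t in (0 : ℝ)..1, Real.sqrt R := by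
      refine intervalIntegral.integral_mono_on zero_le_one
        ((M.continuous_speed (contDiff_segment x v)).intervalIntegrable _ _)
        (by simp) fun t ht => ?_
      apply Real.sqrt_le_sqrt
      rw [hd]
      have h := (abs_le.1 (M.abs_g_sub_le (x + t • v) x v)).2
      have h2 : ‖x + t • v - x‖ ≤ ‖v‖ := by
        rw [add_sub_cancel_left, norm_smul, Real.norm_eq_abs, abs_of_nonneg ht.1]
        exact mul_le_of_le_one_left (norm_nonneg _) ht.2
      have h3 : M.bd * ‖x + t • v - x‖ * ‖v‖ ^ 2 ≤ M.bd * ‖v‖ * ‖v‖ ^ 2 := by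
        have := M.bd_pos; gcongr
      simp only [hR]; nlinarith
    simpa using this
  calc M.dist x y ^ 2 ≤ Real.sqrt R ^ 2 := by
        have := M.dist_nonneg x y; gcongr
    _ = R := Real.sq_sqrt hR0

lemma dist_le (M : TorusMetric) (x y : ℝ × ℝ) : M.dist x y ≤ M.bd * ‖x - y‖ := by
  have := M.dist_le_length (contDiff_segment x (y - x)) zero_le_one
  simp only [zero_smul, add_zero, one_smul, add_sub_cancel] at this
  refine this.trans ?_
  have hd : ∀ t : ℝ, deriv (fun t : ℝ => x + t • (y - x)) t = y - x := by
    intro t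
    have : HasDerivAt (fun t : ℝ => x + t • (y - x)) ((1 : ℝ) • (y - x)) t :=
      ((hasDerivAt_id t).smul_const _).const_add x
    simpa using this.deriv
  have h : M.length (fun t : ℝ => x + t • (y - x)) 0 1 ≤ ∫ _t in (0 : ℝ)..1, M.bd * ‖y - x‖ := by
    refine intervalIntegral.integral_mono_on zero_le_one
        ((M.continuous_speed (contDiff_segment x _)).intervalIntegrable _ _)
        (by simp) fun t ht => ?_
    rw [hd]; exact M.speed_le_norm _ _
  rw [norm_sub_rev]
  simpa using h

lemma g_inner_le (M : TorusMetric) (x v w : ℝ × ℝ) :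
    M.g x v w ≤ Real.sqrt (M.g x v v) * Real.sqrt (M.g x w w) := by
  rw [← Real.sqrt_mul (M.g_nonneg x v)]
  refine Real.le_sqrt_of_sq_le ?_
  have key : ∀ a b : ℝ, 0 ≤ a ^ 2 * M.g x v v + 2 * a * b * M.g x v w + b ^ 2 * M.g x w w := by
    intro a b
    have := M.g_nonneg x (a • v + b • w)
    simp only [g_eq, Prod.fst_add, Prod.snd_add, Prod.smul_fst, Prod.smul_snd, smul_eq_mul]
      at this ⊢
    nlinarith
  rcases (M.g_nonneg x w).eq_or_lt with h | h
  · have h0 : w = 0 := by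
      by_contra hw; exact absurd (M.posdef x w hw) (by rw [← h]; exact lt_irrefl _)
    subst h0; simp [g_eq]
  · have := key (M.g x w w) (-M.g x v w)
    have h2 : 0 ≤ M.g x w w * (M.g x v v * M.g x w w - M.g x v w ^ 2) := by nlinarith
    have := nonneg_of_mul_nonneg_right h2 h
    linarith

/-- Comparison of the distance with the infinitesimal metric, to second order. -/
lemma g_le_dist_sq (M : TorusMetric) (x y : ℝ × ℝ) :
    M.g x (y - x) (y - x) ≤ (1 + M.bd ^ 4 * M.dist x y) * M.dist x y ^ 2 := by
  refine M.le_dist_of_forall (f := fun L => (1 + M.bd ^ 4 * L) * L ^ 2) (by fun_prop)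
    fun c hc h0 h1 => ?_
  set L := M.length c 0 1 with hL
  have hL0 : 0 ≤ L := M.length_nonneg c zero_le_one
  have hB := M.bd_pos
  set v := y - x with hv
  have hd := hc.continuous_deriv le_rfl
  have hcd : ∀ t, HasDerivAt c (deriv c t) t :=
    fun t => ((hc.differentiable (by simp)) t).hasDerivAt
  have e1 : ∫ t in (0 : ℝ)..1, M.g x (deriv c t) v = M.g x v v := by
    have hder : ∀ t, HasDerivAt (fun t => M.g x (c t) v) (M.g x (deriv c t) v) t := by
      intro t
      have a1 : HasDerivAt (fun t => (c t).1) (deriv c t).1 t := hasDerivAt_fst_comp (hcd t)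
      have a2 : HasDerivAt (fun t => (c t).2) (deriv c t).2 t := hasDerivAt_snd_comp (hcd t)
      simp only [g_eq]
      exact (((a1.mul_const _).const_mul _).add
        (((a1.mul_const _).add (a2.mul_const _)).const_mul _)).add
        ((a2.mul_const _).const_mul _)
    rw [intervalIntegral.integral_eq_sub_of_hasDerivAt (fun t _ => hder t)
      ((M.continuous_g continuous_const hd continuous_const).intervalIntegrable _ _), h0, h1]
    simp only [g_eq, hv, Prod.fst_sub, Prod.snd_sub]; ring
  set S := Real.sqrt (M.g x v v) with hS
  have hS2 : S ^ 2 = M.g x v v := Real.sq_sqrt (M.g_nonneg x v)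
  have hS0 : 0 ≤ S := Real.sqrt_nonneg _
  set q := Real.sqrt (1 + M.bd ^ 4 * L) with hq
  have hq2 : q ^ 2 = 1 + M.bd ^ 4 * L := Real.sq_sqrt (by positivity)
  have e2 : M.g x v v ≤ q * S * L := by
    rw [← e1, hL]
    unfold length
    rw [← intervalIntegral.integral_const_mul]
    refine intervalIntegral.integral_mono_on zero_le_one
      ((M.continuous_g continuous_const hd continuous_const).intervalIntegrable _ _)
      ((continuous_const.mul (M.continuous_speed hc)).intervalIntegrable _ _) fun t ht => ?_
    refine (M.g_inner_le x _ v).trans ?_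
    rw [mul_comm q, mul_assoc, mul_comm]
    refine mul_le_mul_of_nonneg_left ?_ hS0
    rw [hq, ← Real.sqrt_mul (by positivity)]
    apply Real.sqrt_le_sqrt
    set w := deriv c t with hw
    have h := (abs_le.1 (M.abs_g_sub_le x (c t) w)).2
    have h2 : ‖x - c t‖ ≤ M.bd * L := by
      rw [norm_sub_rev, ← h0]
      refine (M.norm_sub_le_length hc ht.1).trans ?_
      have := M.length_add hc 0 t 1
      have := M.length_nonneg c ht.2
      gcongr; linarith
    have h3 := M.norm_sq_le (c t) w
    have h4 : M.bd * ‖x - c t‖ * ‖w‖ ^ 2 ≤ M.bd * (M.bd * L) * (M.bd ^ 2 * M.g (c t) w w) := by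
      gcongr
    nlinarith
  rw [← hS2, ← hq2] at *
  rcases hS0.eq_or_lt with h | h
  · rw [← h]; simpa using by positivity
  · have : S ≤ q * L := by nlinarith
    calc S ^ 2 ≤ (q * L) ^ 2 := by gcongr
      _ = _ := by ring

lemma abs_g_sub_dist_sq_le (M : TorusMetric) (x y : ℝ × ℝ) :
    |M.g x (y - x) (y - x) - M.dist x y ^ 2| ≤ M.bd ^ 4 * M.dist x y ^ 3 := by
  have h1 := M.g_le_dist_sq x y
  have h2 := M.dist_sq_le x y
  have h3 : M.bd * ‖y - x‖ ^ 3 ≤ M.bd * (M.bd * M.dist x y) ^ 3 := by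
    have := M.norm_sub_le x y
    rw [norm_sub_rev] at this
    have := M.bd_pos
    gcongr
  rw [abs_le]; constructor <;> nlinarith

end TorusMetric

namespace TorusMetric

lemma dist_self (M : TorusMetric) (x : ℝ × ℝ) : M.dist x x = 0 :=
  le_antisymm (by simpa using M.dist_le x x) (M.dist_nonneg x x)

lemma eq_of_dist_eq_zero (M : TorusMetric) {x y : ℝ × ℝ} (h : M.dist x y = 0) : x = y := by
  have := M.norm_sub_le x y
  rw [h, mul_zero] at this
  exact sub_eq_zero.1 (norm_le_zero_iff.1 this)

lemma dist_comm (M : TorusMetric) (x y : ℝ × ℝ) : M.dist x y = M.dist y x := by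
  have key : ∀ x y, M.dist x y ≤ M.dist y x := by
    intro x y
    refine M.le_dist_of_forall (f := fun L => L) continuous_id fun c hc h0 h1 => ?_
    have hc' : ContDiff ℝ 1 fun t => c (1 - t) := hc.comp (contDiff_const.sub contDiff_id)
    have := M.dist_le_length hc' zero_le_one
    simp only [sub_zero, sub_self, h0, h1] at this
    refine this.trans_eq ?_
    unfold length
    have hd : ∀ t, deriv (fun t => c (1 - t)) t = -deriv c (1 - t) := by
      intro t; rw [deriv_comp_const_sub]
    have hg : ∀ x v, M.g x (-v) (-v) = M.g x v v := by intro x v; simp [g_eq]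
    simp only [hd, hg]
    rw [intervalIntegral.integral_comp_sub_left
      (fun t => Real.sqrt (M.g (c t) (deriv c t) (deriv c t)))]
    simp
  exact le_antisymm (key x y) (key y x)

lemma exists_concat (M : TorusMetric) {c₁ c₂ : ℝ → ℝ × ℝ} (h1 : ContDiff ℝ 1 c₁)
    (h2 : ContDiff ℝ 1 c₂) (h : c₁ 1 = c₂ 0) :
    ∃ c : ℝ → ℝ × ℝ, ContDiff ℝ 1 c ∧ c 0 = c₁ 0 ∧ c 1 = c₂ 1 ∧
      M.length c 0 1 = M.length c₁ 0 1 + M.length c₂ 0 1 := by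
  set φ := Real.smoothTransition with hφdef
  have hφ : ContDiff ℝ 1 φ := Real.smoothTransition.contDiff
  have hφm : Monotone φ := Real.smoothTransition.monotone
  have hφ1 : ContDiff ℝ 1 fun t : ℝ => φ (2 * t) := hφ.comp (contDiff_const.mul contDiff_id)
  have hφ2 : ContDiff ℝ 1 fun t : ℝ => φ (2 * t - 1) :=
    hφ.comp ((contDiff_const.mul contDiff_id).sub contDiff_const)
  have p1 : ∀ t, 0 ≤ deriv (fun t : ℝ => φ (2 * t)) t := fun t =>
    (hφm.comp (fun a b hab => by linarith : Monotone fun t : ℝ => 2 * t)).deriv_nonneg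
  have p2 : ∀ t, 0 ≤ deriv (fun t : ℝ => φ (2 * t - 1)) t := fun t =>
    (hφm.comp (fun a b hab => by linarith : Monotone fun t : ℝ => 2 * t - 1)).deriv_nonneg
  have z : ∀ t, t ≤ 0 → φ t = 0 := fun t ht => Real.smoothTransition.zero_of_nonpos ht
  have o : ∀ t, 1 ≤ t → φ t = 1 := fun t ht => Real.smoothTransition.one_of_one_le ht
  have hc : ContDiff ℝ 1 fun t : ℝ => c₁ (φ (2 * t)) + c₂ (φ (2 * t - 1)) - c₂ 0 :=
    ((h1.comp hφ1).add (h2.comp hφ2)).sub contDiff_const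
  refine ⟨fun t => c₁ (φ (2 * t)) + c₂ (φ (2 * t - 1)) - c₂ 0, hc, ?_, ?_, ?_⟩
  · simp [z 0 le_rfl, z (-1) (by norm_num)]
  · simp only [mul_one]
    rw [o 2 (by norm_num), o (2 - 1) (by norm_num), h]; abel
  · rw [← M.length_add hc 0 (1 / 2) 1]
    congr 1
    · rw [M.length_congr (c' := fun t => c₁ (φ (2 * t))) (by norm_num),
        M.length_comp h1 hφ1 p1]
      · norm_num [z 0 le_rfl, o 1 le_rfl]
      · intro t ht
        simp only [z (2 * t - 1) (by linarith [ht.2])]; abel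
    · rw [M.length_congr (c' := fun t => c₂ (φ (2 * t - 1))) (by norm_num),
        M.length_comp h2 hφ2 p2]
      · norm_num [z 0 le_rfl, o 1 le_rfl]
      · intro t ht
        simp only [o (2 * t) (by linarith [ht.1]), h]; abel

lemma dist_triangle (M : TorusMetric) (x y z : ℝ × ℝ) :
    M.dist x z ≤ M.dist x y + M.dist y z := by
  refine M.le_dist_of_forall (f := fun L => L + M.dist y z) (by fun_prop) fun c₁ hc₁ h0 h1 => ?_
  refine M.le_dist_of_forall (f := fun L => M.length c₁ 0 1 + L) (by fun_prop)
    fun c₂ hc₂ k0 k1 => ?_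
  obtain ⟨c, hc, e0, e1, e⟩ := M.exists_concat hc₁ hc₂ (by rw [h1, k0])
  rw [← e, ← h0, ← k1, ← e0, ← e1]
  exact M.dist_le_length hc zero_le_one

lemma length_add_lat (M : TorusMetric) (c : ℝ → ℝ × ℝ) (k : ℤ × ℤ) (a b : ℝ) :
    M.length (fun t => c t + lat k) a b = M.length c a b := by
  unfold length
  simp only [deriv_add_const', M.periodic]

lemma dist_add_lat (M : TorusMetric) (x y : ℝ × ℝ) (k : ℤ × ℤ) :
    M.dist (x + lat k) (y + lat k) = M.dist x y := by
  have key : ∀ x y k, M.dist (x + lat k) (y + lat k) ≤ M.dist x y := by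
    intro x y k
    refine M.le_dist_of_forall (f := fun L => L) continuous_id fun c hc h0 h1 => ?_
    have := M.dist_le_length (c := fun t => c t + lat k) (hc.add contDiff_const) zero_le_one
    rwa [length_add_lat, h0, h1] at this
  refine le_antisymm (key x y k) ?_
  have := key (x + lat k) (y + lat k) (-k)
  have e : lat k + lat (-k) = 0 := by ext <;> simp [lat]
  simpa [add_assoc, e] using this

lemma abs_dist_sub_dist_le (M : TorusMetric) (x y x' y' : ℝ × ℝ) :
    |M.dist x y - M.dist x' y'| ≤ M.bd * ‖x - x'‖ + M.bd * ‖y - y'‖ := by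
  have h1 := M.dist_triangle x x' y
  have h2 := M.dist_triangle x' y' y
  have h3 := M.dist_triangle x' x y'
  have h4 := M.dist_triangle x y y'
  have h5 := M.dist_le x x'
  have h6 := M.dist_le y y'
  have h7 := M.dist_comm x x'
  have h8 := M.dist_comm y y'
  rw [abs_le]; constructor <;> linarith

lemma continuous_dist (M : TorusMetric) : Continuous fun p : (ℝ × ℝ) × (ℝ × ℝ) => M.dist p.1 p.2 := by
  rw [continuous_iff_continuousAt]
  intro p
  have h : Continuous fun q : (ℝ × ℝ) × (ℝ × ℝ) => M.bd * ‖q.1 - p.1‖ + M.bd * ‖q.2 - p.2‖ := by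
    fun_prop
  have h0 := h.tendsto p
  simp only [sub_self, norm_zero, mul_zero, add_zero] at h0
  have h1 := squeeze_zero (fun q : (ℝ × ℝ) × (ℝ × ℝ) => abs_nonneg (M.dist q.1 q.2 - M.dist p.1 p.2))
    (fun q => M.abs_dist_sub_dist_le q.1 q.2 p.1 p.2) h0
  exact tendsto_sub_nhds_zero_iff.1 ((tendsto_zero_iff_abs_tendsto_zero _).2 h1)

/-- A curve is a metric geodesic on `[a, b]` if it realizes distances there. -/
def IsMetGeod (M : TorusMetric) (γ : ℝ → ℝ × ℝ) (a b : ℝ) : Prop :=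
  ∀ s ∈ Icc a b, ∀ t ∈ Icc a b, M.dist (γ s) (γ t) = |s - t|

/-- A curve is `1`-Lipschitz for the Riemannian distance. -/
def Lip (M : TorusMetric) (γ : ℝ → ℝ × ℝ) (a b : ℝ) : Prop :=
  ∀ s ∈ Icc a b, ∀ t ∈ Icc a b, M.dist (γ s) (γ t) ≤ |s - t|

end TorusMetric

lemma exists_ultralimit {γ : ℕ → ℝ → ℝ × ℝ} {S : Set ℝ}
    (h : ∀ t ∈ S, ∃ C, ∀ᶠ n in atTop, ‖γ n t‖ ≤ C) :
    ∃ γ' : ℝ → ℝ × ℝ, ∀ t ∈ S, Tendsto (fun n => γ n t) (hyperfilter ℕ) (𝓝 (γ' t)) := by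
  have : ∀ t, ∃ z, t ∈ S → Tendsto (fun n => γ n t) (hyperfilter ℕ) (𝓝 z) := by
    intro t
    by_cases ht : t ∈ S
    · obtain ⟨C, hC⟩ := h t ht
      have hC' : ∀ᶠ n in (hyperfilter ℕ : Filter ℕ), γ n t ∈ Metric.closedBall (0 : ℝ × ℝ) C := by
        have := hC.filter_mono (Nat.hyperfilter_le_atTop)
        filter_upwards [this] with n hn
        simpa using hn
      obtain ⟨z, -, hz⟩ := (isCompact_closedBall (0 : ℝ × ℝ) C).ultrafilter_le_nhds
        ((hyperfilter ℕ).map fun n => γ n t) (le_principal_iff.2 hC')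
      exact ⟨z, fun _ => hz⟩
    · exact ⟨0, fun h => absurd h ht⟩
  choose γ' hγ' using this
  exact ⟨γ', hγ'⟩

namespace TorusMetric

lemma tendsto_dist (M : TorusMetric) {ι : Type*} {l : Filter ι} {u v : ι → ℝ × ℝ} {x y : ℝ × ℝ}
    (hu : Tendsto u l (𝓝 x)) (hv : Tendsto v l (𝓝 y)) :
    Tendsto (fun i => M.dist (u i) (v i)) l (𝓝 (M.dist x y)) := by
  have h := M.continuous_dist.tendsto (x, y)
  have h2 : Tendsto (fun i => (u i, v i)) l (𝓝 (x, y)) := by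
    rw [nhds_prod_eq]; exact hu.prodMk hv
  have h3 := h.comp h2
  exact h3

lemma Lip.mono {M : TorusMetric} {γ : ℝ → ℝ × ℝ} {a b a' b' : ℝ} (h : M.Lip γ a b)
    (ha : a ≤ a') (hb : b' ≤ b) : M.Lip γ a' b' :=
  fun s hs t ht => h s ⟨ha.trans hs.1, hs.2.trans hb⟩ t ⟨ha.trans ht.1, ht.2.trans hb⟩

lemma IsMetGeod.mono {M : TorusMetric} {γ : ℝ → ℝ × ℝ} {a b a' b' : ℝ} (h : M.IsMetGeod γ a b)
    (ha : a ≤ a') (hb : b' ≤ b) : M.IsMetGeod γ a' b' :=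
  fun s hs t ht => h s ⟨ha.trans hs.1, hs.2.trans hb⟩ t ⟨ha.trans ht.1, ht.2.trans hb⟩

lemma IsMetGeod.lip {M : TorusMetric} {γ : ℝ → ℝ × ℝ} {a b : ℝ} (h : M.IsMetGeod γ a b) :
    M.Lip γ a b := fun s hs t ht => (h s hs t ht).le

lemma Lip.isMetGeod {M : TorusMetric} {γ : ℝ → ℝ × ℝ} {a b : ℝ} (h : M.Lip γ a b)
    (hd : b - a ≤ M.dist (γ a) (γ b)) : M.IsMetGeod γ a b := by
  have key : ∀ s ∈ Icc a b, ∀ t ∈ Icc a b, s ≤ t → M.dist (γ s) (γ t) = t - s := by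
    intro s hs t ht hst
    have hab : a ≤ b := hs.1.trans hs.2
    have h1 := h a ⟨le_rfl, hab⟩ s hs
    have h2 := h s hs t ht
    have h3 := h t ht b ⟨hab, le_rfl⟩
    rw [abs_of_nonpos (by linarith [hs.1])] at h1
    rw [abs_of_nonpos (by linarith)] at h2
    rw [abs_of_nonpos (by linarith [ht.2])] at h3
    have h4 := M.dist_triangle (γ a) (γ s) (γ b)
    have h5 := M.dist_triangle (γ s) (γ t) (γ b)
    linarith
  intro s hs t ht
  rcases le_total s t with hst | hst
  · rw [key s hs t ht hst, abs_of_nonpos (by linarith)]; ring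
  · rw [M.dist_comm, key t ht s hs hst, abs_of_nonneg (by linarith)]

lemma Lip.continuousOn {M : TorusMetric} {γ : ℝ → ℝ × ℝ} {a b : ℝ} (h : M.Lip γ a b) :
    ContinuousOn γ (Icc a b) := by
  have : LipschitzOnWith (Real.toNNReal M.bd) γ (Icc a b) := by
    refine LipschitzOnWith.of_dist_le_mul fun s hs t ht => ?_
    rw [dist_eq_norm, Real.dist_eq, Real.coe_toNNReal _ M.bd_pos.le]
    exact (M.norm_sub_le _ _).trans (mul_le_mul_of_nonneg_left (h s hs t ht) M.bd_pos.le)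
  exact this.continuousOn

/-- Hopf–Rinow: any two points are joined by a distance realizing curve. -/
lemma exists_isMetGeod (M : TorusMetric) (x y : ℝ × ℝ) :
    ∃ γ : ℝ → ℝ × ℝ, M.IsMetGeod γ 0 (M.dist x y) ∧ γ 0 = x ∧ γ (M.dist x y) = y := by
  set D := M.dist x y with hD
  have hD0 : 0 ≤ D := M.dist_nonneg x y
  have step : ∀ n : ℕ, ∃ γ : ℝ → ℝ × ℝ, M.Lip γ 0 D ∧ γ 0 = x ∧
      M.dist (γ D) y ≤ 1 / ((n : ℝ) + 1) := by
    intro n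
    have hpos : (0 : ℝ) < 1 / ((n : ℝ) + 1) := by positivity
    obtain ⟨L, ⟨c, hc, h0, h1, rfl⟩, hL⟩ := exists_lt_of_csInf_lt (M.lengths_nonempty x y)
      (show sInf (M.lengths x y) < D + 1 / ((n : ℝ) + 1) by
        change M.dist x y < _; linarith)
    have hDL : D ≤ M.length c 0 1 := by
      have := M.dist_le_length hc zero_le_one; rwa [h0, h1] at this
    have hcont : Continuous fun u => M.length c 0 u :=
      intervalIntegral.continuous_primitive
        (fun a b => (M.continuous_speed hc).intervalIntegrable a b) 0
    have hl0 : M.length c 0 0 = 0 := intervalIntegral.integral_same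
    have hu : ∀ s, ∃ u, s ∈ Icc 0 D → u ∈ Icc (0 : ℝ) 1 ∧ M.length c 0 u = s := by
      intro s
      by_cases hs : s ∈ Icc 0 D
      · obtain ⟨u, hu, hus⟩ := intermediate_value_Icc zero_le_one hcont.continuousOn
          (show s ∈ Icc (M.length c 0 0) (M.length c 0 1) by
            rw [hl0]; exact ⟨hs.1, hs.2.trans hDL⟩)
        exact ⟨u, fun _ => ⟨hu, hus⟩⟩
      · exact ⟨0, fun h => absurd h hs⟩
    choose u hu using hu
    have key : ∀ p q, M.dist (c p) (c q) ≤ |M.length c 0 p - M.length c 0 q| := by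
      have : ∀ p q, p ≤ q → M.dist (c p) (c q) ≤ |M.length c 0 p - M.length c 0 q| := by
        intro p q hpq
        have h := M.length_add hc 0 p q
        have h2 := M.length_nonneg c hpq
        rw [abs_of_nonpos (by linarith)]
        linarith [M.dist_le_length hc hpq]
      intro p q
      rcases le_total p q with h | h
      · exact this p q h
      · rw [M.dist_comm, abs_sub_comm]; exact this q p h
    refine ⟨fun s => c (u s), fun s hs t ht => ?_, ?_, ?_⟩
    · have := key (u s) (u t)
      rwa [(hu s hs).2, (hu t ht).2] at this
    · have h := key 0 (u 0)
      rw [(hu 0 ⟨le_rfl, hD0⟩).2, hl0] at h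
      rw [← h0]
      exact (M.eq_of_dist_eq_zero (le_antisymm (by simpa using h) (M.dist_nonneg _ _))).symm
    · have h := key (u D) 1
      rw [(hu D ⟨hD0, le_rfl⟩).2, h1] at h
      refine h.trans ?_
      rw [abs_of_nonpos (by linarith)]; linarith
  choose γ hγ hγ0 hγD using step
  obtain ⟨γ', hγ'⟩ := exists_ultralimit (γ := γ) (S := Icc 0 D) (fun t ht => by
    refine ⟨‖x‖ + M.bd * D, Eventually.of_forall fun n => ?_⟩
    have h := M.norm_sub_le (γ n t) (γ n 0)
    have h2 := hγ n t ht 0 ⟨le_rfl, hD0⟩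
    rw [sub_zero, abs_of_nonneg ht.1] at h2
    rw [hγ0] at h h2
    have h3 : M.bd * M.dist (γ n t) x ≤ M.bd * D :=
      mul_le_mul_of_nonneg_left (h2.trans ht.2) M.bd_pos.le
    have h4 := norm_sub_norm_le (γ n t) x
    linarith)
  have hlip : M.Lip γ' 0 D := fun s hs t ht =>
    le_of_tendsto' (M.tendsto_dist (hγ' s hs) (hγ' t ht)) fun n => hγ n s hs t ht
  have e0 : γ' 0 = x := by
    refine tendsto_nhds_unique (hγ' 0 ⟨le_rfl, hD0⟩) ?_
    simp only [hγ0]; exact tendsto_const_nhds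
  have eD : γ' D = y := by
    apply M.eq_of_dist_eq_zero
    refine le_antisymm ?_ (M.dist_nonneg _ _)
    refine le_of_tendsto_of_tendsto' (M.tendsto_dist (hγ' D ⟨hD0, le_rfl⟩) tendsto_const_nhds)
      ((tendsto_one_div_add_atTop_nhds_zero_nat (𝕜 := ℝ)).mono_left Nat.hyperfilter_le_atTop)
      fun n => hγD n
  exact ⟨γ', hlip.isMetGeod (by rw [e0, eD, sub_zero]), e0, eD⟩

end TorusMetric

section SecondDifference

variable {E : Type*} [NormedAddCommGroup E] [NormedSpace ℝ E]

/-- The dyadic difference quotients of a function with small second differences. -/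
lemma dyadic_quotient_step {f : ℝ → E} {a b C : ℝ} (hC : 0 ≤ C)
    (hf : ∀ t h, a ≤ t → 0 < h → t + 2 * h ≤ b →
      ‖f (t + 2 * h) - (2 : ℝ) • f (t + h) + f t‖ ≤ C * (h * Real.sqrt h))
    {t δ : ℝ} (ha : a ≤ t) (hδ : 0 < δ) (hb : t + δ ≤ b) (n : ℕ) :
    dist ((δ / 2 ^ n)⁻¹ • (f (t + δ / 2 ^ n) - f t))
      ((δ / 2 ^ (n + 1))⁻¹ • (f (t + δ / 2 ^ (n + 1)) - f t)) ≤
      C / 2 * Real.sqrt δ * (3 / 4) ^ n := by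
  set h := δ / 2 ^ (n + 1) with hh
  have hpos : 0 < h := by positivity
  have e : δ / 2 ^ n = 2 * h := by rw [hh, pow_succ]; field_simp
  have hle : 2 * h ≤ δ := by
    rw [← e]; exact div_le_self hδ.le (one_le_pow₀ (by norm_num))
  rw [e, dist_eq_norm]
  have : (2 * h)⁻¹ • (f (t + 2 * h) - f t) - h⁻¹ • (f (t + h) - f t)
      = (2 * h)⁻¹ • (f (t + 2 * h) - (2 : ℝ) • f (t + h) + f t) := by
    have h1 : h⁻¹ = (2 * h)⁻¹ * 2 := by field_simp
    rw [h1, mul_smul]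
    rw [← smul_sub]
    congr 1
    rw [smul_sub, two_smul, two_smul]; abel
  rw [this, norm_smul, Real.norm_eq_abs, abs_of_pos (by positivity)]
  have h2 := hf t h ha hpos (by linarith)
  have h3 : Real.sqrt h ≤ Real.sqrt δ * (3 / 4) ^ n := by
    apply Real.sqrt_le_iff.2
    refine ⟨by positivity, ?_⟩
    rw [mul_pow, Real.sq_sqrt hδ.le, ← pow_mul, mul_comm n 2, pow_mul, hh, div_eq_mul_inv]
    gcongr
    rw [← inv_pow, pow_succ]
    calc ((2 : ℝ)⁻¹) ^ n * 2⁻¹ ≤ ((2 : ℝ)⁻¹) ^ n * 1 := by gcongr; norm_num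
      _ ≤ _ := by rw [mul_one]; gcongr; norm_num
  calc (2 * h)⁻¹ * ‖f (t + 2 * h) - (2 : ℝ) • f (t + h) + f t‖
      ≤ (2 * h)⁻¹ * (C * (h * Real.sqrt h)) := by gcongr
    _ = C / 2 * Real.sqrt h := by field_simp
    _ ≤ C / 2 * (Real.sqrt δ * (3 / 4) ^ n) := by gcongr
    _ = _ := by ring

lemma differentiableAt_of_second_difference [CompleteSpace E] {f : ℝ → E} (hcont : Continuous f) {a b C : ℝ} (hC : 0 ≤ C)
    (hf : ∀ t h, a ≤ t → 0 < h → t + 2 * h ≤ b →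
      ‖f (t + 2 * h) - (2 : ℝ) • f (t + h) + f t‖ ≤ C * (h * Real.sqrt h))
    {t : ℝ} (ht : t ∈ Ioo a b) : DifferentiableAt ℝ f t := by
  obtain ⟨b', hb1, hb2⟩ := exists_between ht.2
  set δ := b - b' with hδ
  have hδ0 : 0 < δ := by linarith
  set q : ℕ → ℝ → E := fun n t => (δ / 2 ^ n)⁻¹ • (f (t + δ / 2 ^ n) - f t) with hq
  have hq' : ∀ s ∈ Ioo a b', ∀ n, dist (q n s) (q (n + 1) s) ≤ C / 2 * Real.sqrt δ * (3 / 4) ^ n :=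
    fun s hs n => dyadic_quotient_step hC hf hs.1.le hδ0 (by linarith [hs.2]) n
  have hlim : ∀ s, ∃ v, s ∈ Ioo a b' → Tendsto (fun n => q n s) atTop (𝓝 v) := by
    intro s
    by_cases hs : s ∈ Ioo a b'
    · obtain ⟨v, hv⟩ := cauchySeq_tendsto_of_complete
        (cauchySeq_of_le_geometric (3 / 4) _ (by norm_num) (hq' s hs))
      exact ⟨v, fun _ => hv⟩
    · exact ⟨0, fun h => absurd h hs⟩
  choose v hv using hlim
  have hunif : TendstoUniformlyOn q v atTop (Ioo a b') := by
    rw [Metric.tendstoUniformlyOn_iff]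
    intro ε hε
    have : Tendsto (fun n : ℕ => C / 2 * Real.sqrt δ * (3 / 4 : ℝ) ^ n / (1 - 3 / 4)) atTop
        (𝓝 (C / 2 * Real.sqrt δ * 0 / (1 - 3 / 4))) :=
      ((tendsto_pow_atTop_nhds_zero_of_lt_one (by norm_num) (by norm_num)).const_mul _).div_const _
    rw [mul_zero, zero_div] at this
    filter_upwards [this.eventually_lt_const hε] with n hn s hs
    rw [_root_.dist_comm]
    exact (dist_le_of_le_geometric_of_tendsto _ _ (by norm_num) (hq' s hs) (hv s hs) n).trans_lt hn
  have hF : ∀ x, HasDerivAt (fun x => ∫ u in (0 : ℝ)..x, f u) (f x) x :=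
    fun x => intervalIntegral.integral_hasDerivAt_right (hcont.intervalIntegrable _ _)
      (hcont.stronglyMeasurableAtFilter _ _) hcont.continuousAt
  set F : ℝ → E := fun x => ∫ u in (0 : ℝ)..x, f u
  have htend : Tendsto (fun n : ℕ => δ / (2 : ℝ) ^ n) atTop (𝓝[≠] 0) := by
    refine tendsto_nhdsWithin_iff.2 ⟨?_, Eventually.of_forall fun n => ?_⟩
    · have : Tendsto (fun n : ℕ => δ * (1 / 2 : ℝ) ^ n) atTop (𝓝 (δ * 0)) :=
        (tendsto_pow_atTop_nhds_zero_of_lt_one (by norm_num) (by norm_num)).const_mul _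
      rw [mul_zero] at this
      refine this.congr fun n => ?_
      rw [div_pow, one_pow]; ring
    · have : 0 < δ / (2 : ℝ) ^ n := by positivity
      exact this.ne'
  refine (hasDerivAt_of_tendstoUniformlyOn (f := fun n x => (δ / 2 ^ n)⁻¹ • (F (x + δ / 2 ^ n) - F x))
    isOpen_Ioo hunif (Eventually.of_forall fun n x _ => ?_) (fun x _ => ?_)
    (show t ∈ Ioo a b' from ⟨ht.1, hb1⟩)).differentiableAt
  · have h1 : HasDerivAt (fun x => F (x + δ / 2 ^ n)) (f (x + δ / 2 ^ n)) x :=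
      (hF (x + δ / 2 ^ n)).comp_add_const x (δ / 2 ^ n)
    exact (h1.sub (hF x)).const_smul _
  · exact (hasDerivAt_iff_tendsto_slope_zero.1 (hF x)).comp htend

lemma norm_quotient_sub_deriv_le {f : ℝ → E} {a b C : ℝ} (hC : 0 ≤ C)
    (hf : ∀ t h, a ≤ t → 0 < h → t + 2 * h ≤ b →
      ‖f (t + 2 * h) - (2 : ℝ) • f (t + h) + f t‖ ≤ C * (h * Real.sqrt h))
    {t δ : ℝ} (hd : DifferentiableAt ℝ f t) (ha : a ≤ t) (hδ : 0 < δ) (hb : t + δ ≤ b) :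
    ‖δ⁻¹ • (f (t + δ) - f t) - deriv f t‖ ≤ 2 * C * Real.sqrt δ := by
  have htend : Tendsto (fun n : ℕ => δ / (2 : ℝ) ^ n) atTop (𝓝[≠] 0) := by
    refine tendsto_nhdsWithin_iff.2 ⟨?_, Eventually.of_forall fun n => ?_⟩
    · have : Tendsto (fun n : ℕ => δ * (1 / 2 : ℝ) ^ n) atTop (𝓝 (δ * 0)) :=
        (tendsto_pow_atTop_nhds_zero_of_lt_one (by norm_num) (by norm_num)).const_mul _
      rw [mul_zero] at this
      refine this.congr fun n => ?_
      rw [div_pow, one_pow]; ring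
    · have : 0 < δ / (2 : ℝ) ^ n := by positivity
      exact this.ne'
  have h := (hasDerivAt_iff_tendsto_slope_zero.1 hd.hasDerivAt).comp htend
  have h2 := dist_le_of_le_geometric_of_tendsto₀ _ _ (by norm_num)
    (dyadic_quotient_step hC hf ha hδ hb) h
  rw [pow_zero, div_one, dist_eq_norm] at h2
  exact h2.trans_eq (by ring)

lemma norm_deriv_sub_deriv_le {f : ℝ → E} {a b C : ℝ} (hC : 0 ≤ C)
    (hf : ∀ t h, a ≤ t → 0 < h → t + 2 * h ≤ b →
      ‖f (t + 2 * h) - (2 : ℝ) • f (t + h) + f t‖ ≤ C * (h * Real.sqrt h))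
    {s t : ℝ} (hs : DifferentiableAt ℝ f s) (ht : DifferentiableAt ℝ f t) (ha : a ≤ s)
    (hst : s < t) (hb : t + (t - s) ≤ b) :
    ‖deriv f s - deriv f t‖ ≤ 5 * C * Real.sqrt (t - s) := by
  set h := t - s with hh
  have hpos : 0 < h := by linarith
  have h1 := norm_quotient_sub_deriv_le hC hf hs ha hpos (by linarith)
  have h2 := norm_quotient_sub_deriv_le hC hf ht (by linarith) hpos hb
  have h3 := hf s h ha hpos (by linarith)
  have e1 : s + h = t := by linarith
  have e2 : s + 2 * h = t + h := by linarith
  rw [e1, e2] at h3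
  rw [e1] at h1
  have h4 : ‖h⁻¹ • (f t - f s) - h⁻¹ • (f (t + h) - f t)‖ ≤ C * Real.sqrt h := by
    rw [← smul_sub, norm_smul, Real.norm_eq_abs, abs_of_pos (by positivity), ← norm_neg]
    have : -(f t - f s - (f (t + h) - f t)) = f (t + h) - (2 : ℝ) • f t + f s := by
      rw [two_smul]; abel
    rw [this]
    calc _ ≤ h⁻¹ * (C * (h * Real.sqrt h)) := by gcongr
      _ = _ := by field_simp
  have h5 : deriv f s - deriv f t = -(h⁻¹ • (f t - f s) - deriv f s)
      + (h⁻¹ • (f t - f s) - h⁻¹ • (f (t + h) - f t))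
      + (h⁻¹ • (f (t + h) - f t) - deriv f t) := by abel
  rw [h5]
  refine (norm_add₃_le).trans ?_
  rw [norm_neg]
  linarith

end SecondDifference

namespace TorusMetric

/-- The uniform constant in the Hölder estimate for the velocity of metric geodesics. -/
def hol (M : TorusMetric) : ℝ := 5 * (4 * M.bd ^ 3)

lemma second_difference_le (M : TorusMetric) {γ : ℝ → ℝ × ℝ} {a b : ℝ} (hγ : M.IsMetGeod γ a b)
    (t h : ℝ) (ha : a ≤ t) (hh : 0 < h) (hb : t + 2 * h ≤ b) :
    ‖γ (t + 2 * h) - (2 : ℝ) • γ (t + h) + γ t‖ ≤ 4 * M.bd ^ 3 * (h * Real.sqrt h) := by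
  have m0 : t ∈ Icc a b := ⟨ha, by linarith⟩
  have m1 : t + h ∈ Icc a b := ⟨by linarith, by linarith⟩
  have m2 : t + 2 * h ∈ Icc a b := ⟨by linarith, hb⟩
  have d1 : M.dist (γ t) (γ (t + h)) = h := by
    rw [hγ _ m0 _ m1, abs_of_nonpos (by linarith)]; ring
  have d2 : M.dist (γ (t + h)) (γ (t + 2 * h)) = h := by
    rw [hγ _ m1 _ m2, abs_of_nonpos (by linarith)]; ring
  have d3 : M.dist (γ t) (γ (t + 2 * h)) = 2 * h := by
    rw [hγ _ m0 _ m2, abs_of_nonpos (by linarith)]; ring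
  have g1 := M.abs_g_sub_dist_sq_le (γ t) (γ (t + h))
  have g2 := M.abs_g_sub_dist_sq_le (γ (t + h)) (γ (t + 2 * h))
  have g3 := M.abs_g_sub_dist_sq_le (γ t) (γ (t + 2 * h))
  have n1 := M.norm_sub_le (γ t) (γ (t + h))
  have n2 := M.norm_sub_le (γ (t + 2 * h)) (γ (t + h))
  rw [M.dist_comm] at n2
  rw [d1] at g1 n1
  rw [d2] at g2 n2
  rw [d3] at g3
  have g4 := M.abs_g_sub_le (γ t) (γ (t + h)) (γ (t + 2 * h) - γ (t + h))
  have hB := M.bd_pos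
  have g5 : M.bd * ‖γ t - γ (t + h)‖ * ‖γ (t + 2 * h) - γ (t + h)‖ ^ 2 ≤
      M.bd * (M.bd * h) * (M.bd * h) ^ 2 := by gcongr
  have par : M.g (γ t) (γ (t + 2 * h) - (2 : ℝ) • γ (t + h) + γ t)
      (γ (t + 2 * h) - (2 : ℝ) • γ (t + h) + γ t) =
      2 * M.g (γ t) (γ (t + h) - γ t) (γ (t + h) - γ t)
      + 2 * M.g (γ t) (γ (t + 2 * h) - γ (t + h)) (γ (t + 2 * h) - γ (t + h))
      - M.g (γ t) (γ (t + 2 * h) - γ t) (γ (t + 2 * h) - γ t) := by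
    simp only [g_eq, Prod.fst_add, Prod.snd_add, Prod.fst_sub, Prod.snd_sub, Prod.smul_fst,
      Prod.smul_snd, smul_eq_mul]
    ring
  have key : M.g (γ t) (γ (t + 2 * h) - (2 : ℝ) • γ (t + h) + γ t)
      (γ (t + 2 * h) - (2 : ℝ) • γ (t + h) + γ t) ≤ 16 * M.bd ^ 4 * h ^ 3 := by
    rw [par]
    have := (abs_le.1 g1).2
    have := (abs_le.1 g2).2
    have := (abs_le.1 g3).1
    have := (abs_le.1 g4).2
    have hp : 0 < M.bd ^ 4 * h ^ 3 := by positivity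
    nlinarith
  have h6 := M.norm_sq_le (γ t) (γ (t + 2 * h) - (2 : ℝ) • γ (t + h) + γ t)
  refine abs_le_of_sq_le_sq' ?_ (by positivity) |>.2
  refine h6.trans ?_
  have : Real.sqrt h ^ 2 = h := Real.sq_sqrt hh.le
  calc _ ≤ M.bd ^ 2 * (16 * M.bd ^ 4 * h ^ 3) := by gcongr
    _ = (4 * M.bd ^ 3) ^ 2 * (h ^ 2 * h) := by ring
    _ = (4 * M.bd ^ 3) ^ 2 * (h ^ 2 * Real.sqrt h ^ 2) := by rw [this]
    _ = _ := by ring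

lemma IsMetGeod.differentiableAt {M : TorusMetric} {γ : ℝ → ℝ × ℝ} {a b : ℝ}
    (hγ : M.IsMetGeod γ a b) {t : ℝ} (ht : t ∈ Ioo a b) : DifferentiableAt ℝ γ t := by
  have hab : a ≤ b := (ht.1.trans ht.2).le
  have hc : Continuous (IccExtend hab ((Icc a b).domRestrict γ)) :=
    (continuousOn_iff_continuous_domRestrict.1 hγ.lip.continuousOn).Icc_extend'
  have he : ∀ s ∈ Icc a b, IccExtend hab ((Icc a b).domRestrict γ) s = γ s := by
    intro s hs; rw [IccExtend_of_mem _ _ hs]; rfl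
  have h2 : M.IsMetGeod (IccExtend hab ((Icc a b).domRestrict γ)) a b := by
    intro s hs t ht; rw [he s hs, he t ht]; exact hγ s hs t ht
  have hB := M.bd_pos
  have h3 := differentiableAt_of_second_difference hc (by positivity) (M.second_difference_le h2) ht
  refine h3.congr_of_eventuallyEq ?_
  filter_upwards [isOpen_Ioo.mem_nhds ht] with s hs using (he s ⟨hs.1.le, hs.2.le⟩).symm

lemma IsMetGeod.norm_deriv_sub_le {M : TorusMetric} {γ : ℝ → ℝ × ℝ} {a b : ℝ}
    (hγ : M.IsMetGeod γ a b) {s t : ℝ} (ha : a < s) (hst : s < t) (hb : t + (t - s) ≤ b) :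
    ‖deriv γ s - deriv γ t‖ ≤ M.hol * Real.sqrt (t - s) := by
  have hB := M.bd_pos
  exact norm_deriv_sub_deriv_le (by positivity) (M.second_difference_le hγ)
    (hγ.differentiableAt ⟨ha, by linarith⟩) (hγ.differentiableAt ⟨by linarith, by linarith⟩)
    ha.le hst hb

lemma IsMetGeod.continuousOn_deriv {M : TorusMetric} {γ : ℝ → ℝ × ℝ} {a b : ℝ}
    (hγ : M.IsMetGeod γ a b) : ContinuousOn (deriv γ) (Ioo a b) := by
  refine (isOpen_Ioo.continuousOn_iff).2 fun t ht => ?_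
  rw [ContinuousAt, tendsto_iff_norm_sub_tendsto_zero]
  have h : Continuous fun s => M.hol * Real.sqrt |s - t| := by fun_prop
  have h0 := h.tendsto t
  simp only [sub_self, abs_zero, Real.sqrt_zero, mul_zero] at h0
  refine squeeze_zero' (Eventually.of_forall fun _ => norm_nonneg _) ?_ h0
  have e1 : ∀ᶠ s in 𝓝 t, a < s := eventually_gt_nhds ht.1
  have e2 : ∀ᶠ s in 𝓝 t, t + (t - s) < b := by
    have : ContinuousAt (fun s => t + (t - s)) t := by fun_prop
    exact this.eventually_lt_const (by simpa using ht.2)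
  have e3 : ∀ᶠ s in 𝓝 t, s + (s - t) < b := by
    have : ContinuousAt (fun s => s + (s - t)) t := by fun_prop
    exact this.eventually_lt_const (by simpa using ht.2)
  filter_upwards [e1, e2, e3] with s h1 h2 h3
  rcases lt_trichotomy s t with h | h | h
  · rw [abs_of_neg (by linarith), neg_sub]; exact hγ.norm_deriv_sub_le h1 h h2.le
  · simp [h]
  · rw [abs_of_pos (by linarith), norm_sub_rev]; exact hγ.norm_deriv_sub_le ht.1 h h3.le

lemma IsMetGeod.speed {M : TorusMetric} {γ : ℝ → ℝ × ℝ} {a b : ℝ}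
    (hγ : M.IsMetGeod γ a b) {t : ℝ} (ht : t ∈ Ioo a b) :
    M.g (γ t) (deriv γ t) (deriv γ t) = 1 := by
  have h := hasDerivAt_iff_tendsto_slope_zero.1 (hγ.differentiableAt ht).hasDerivAt
  have hg : Continuous fun v => M.g (γ t) v v := by
    simp only [g_eq]; fun_prop
  have h1 := (hg.tendsto _).comp h
  refine tendsto_nhds_unique h1 ?_
  rw [← tendsto_sub_nhds_zero_iff]
  rw [tendsto_zero_iff_abs_tendsto_zero]
  have hl : Continuous fun h : ℝ => M.bd ^ 4 * |h| := by fun_prop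
  have hl0 := (hl.tendsto 0).mono_left (nhdsWithin_le_nhds (s := {0}ᶜ))
  simp only [abs_zero, mul_zero] at hl0
  refine squeeze_zero' (Eventually.of_forall fun _ => abs_nonneg _) ?_ hl0
  have e1 : ∀ᶠ h : ℝ in 𝓝[≠] 0, t + h ∈ Icc a b := by
    have : ContinuousAt (fun h : ℝ => t + h) 0 := by fun_prop
    exact (this.eventually_mem (by rw [add_zero]; exact Icc_mem_nhds ht.1 ht.2)).filter_mono nhdsWithin_le_nhds
  filter_upwards [e1, self_mem_nhdsWithin] with h hh h0
  have h0 : h ≠ 0 := h0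
  have k := M.abs_g_sub_dist_sq_le (γ t) (γ (t + h))
  rw [hγ t ⟨ht.1.le, ht.2.le⟩ _ hh] at k
  have e2 : |t - (t + h)| = |h| := by rw [← abs_neg]; congr 1; ring
  rw [e2, sq_abs] at k
  simp only [Function.comp, g_smul]
  have e3 : h⁻¹ ^ 2 * M.g (γ t) (γ (t + h) - γ t) (γ (t + h) - γ t) - 1
      = h⁻¹ ^ 2 * (M.g (γ t) (γ (t + h) - γ t) (γ (t + h) - γ t) - h ^ 2) := by
    field_simp
  rw [e3, abs_mul, abs_of_nonneg (by positivity)]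
  calc _ ≤ h⁻¹ ^ 2 * (M.bd ^ 4 * |h| ^ 3) := by gcongr
    _ = h⁻¹ ^ 2 * (M.bd ^ 4 * (|h| * h ^ 2)) := by rw [← sq_abs h]; ring
    _ = _ := by field_simp

end TorusMetric

lemma hasDerivAt_primitive {E : Type*} [NormedAddCommGroup E] [NormedSpace ℝ E] [CompleteSpace E]
    {f : ℝ → E} (hf : Continuous f) (a x : ℝ) :
    HasDerivAt (fun x => ∫ u in a..x, f u) (f x) x :=
  intervalIntegral.integral_hasDerivAt_right (hf.intervalIntegrable _ _)
    (hf.stronglyMeasurableAtFilter _ _) hf.continuousAt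

/-- The du Bois-Reymond lemma. -/
lemma exists_eq_const_add_integral {p l : ℝ → ℝ} (hp : Continuous p) (hl : Continuous l) {a b : ℝ}
    (hab : a < b)
    (h : ∀ φ : ℝ → ℝ, Continuous φ → ∫ t in a..b, φ t = 0 →
      ∫ t in a..b, (l t * (∫ u in a..t, φ u) + p t * φ t) = 0) :
    ∃ k, ∀ t ∈ Icc a b, p t = k + ∫ u in a..t, l u := by
  set A : ℝ → ℝ := fun t => ∫ u in a..t, l u with hA
  have hAd : ∀ t, HasDerivAt A (l t) t := hasDerivAt_primitive hl a
  have hAc : Continuous A := continuous_iff_continuousAt.2 fun t => (hAd t).continuousAt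
  set k := (b - a)⁻¹ * ∫ t in a..b, (p t - A t) with hk
  set φ : ℝ → ℝ := fun t => p t - A t - k with hφ
  have hφc : Continuous φ := (hp.sub hAc).sub continuous_const
  have hφ0 : ∫ t in a..b, φ t = 0 := by
    have hpA : Continuous fun t => p t - A t := hp.sub hAc
    change ∫ t in a..b, (p t - A t - k) = 0
    rw [intervalIntegral.integral_sub (hpA.intervalIntegrable _ _) intervalIntegrable_const,
      intervalIntegral.integral_const, hk, smul_eq_mul]
    have : b - a ≠ 0 := by linarith
    field_simp; ring
  set Φ : ℝ → ℝ := fun t => ∫ u in a..t, φ u with hΦ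
  have hΦd : ∀ t, HasDerivAt Φ (φ t) t := hasDerivAt_primitive hφc a
  have hΦc : Continuous Φ := continuous_iff_continuousAt.2 fun t => (hΦd t).continuousAt
  have h1 := h φ hφc hφ0
  have h2 := intervalIntegral.integral_mul_deriv_eq_deriv_mul (a := a) (b := b)
    (fun t _ => hAd t) (fun t _ => hΦd t)
    (hl.intervalIntegrable _ _) (hφc.intervalIntegrable _ _)
  have e1 : Φ a = 0 := intervalIntegral.integral_same
  rw [e1, show Φ b = 0 from hφ0] at h2
  have c1 : Continuous fun t => l t * Φ t := hl.mul hΦc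
  have c2 : Continuous fun t => p t * φ t := hp.mul hφc
  have c3 : Continuous fun t => A t * φ t := hAc.mul hφc
  have c4 : Continuous fun t => k * φ t := continuous_const.mul hφc
  have c5 : Continuous fun t => p t * φ t - A t * φ t := c2.sub c3
  change ∫ t in a..b, (l t * Φ t + p t * φ t) = 0 at h1
  rw [intervalIntegral.integral_add (c1.intervalIntegrable _ _) (c2.intervalIntegrable _ _)] at h1
  have h3 : ∫ t in a..b, φ t * φ t = 0 := by
    have : ∀ t, φ t * φ t = p t * φ t - A t * φ t - k * φ t := by
      intro t; simp only [hφ]; ring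
    simp only [this]
    rw [intervalIntegral.integral_sub (c5.intervalIntegrable _ _) (c4.intervalIntegrable _ _),
      intervalIntegral.integral_sub (c2.intervalIntegrable _ _) (c3.intervalIntegrable _ _),
      intervalIntegral.integral_const_mul, hφ0]
    linarith
  refine ⟨k, fun t ht => ?_⟩
  by_contra hne
  have hne' : φ t ≠ 0 := fun h0 => hne (by simp only [hφ] at h0; simp only [hA] at h0 ⊢; linarith)
  have := intervalIntegral.integral_pos hab (hφc.mul hφc).continuousOn
    (fun x _ => mul_self_nonneg _) ⟨t, ht, mul_self_pos.2 hne'⟩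
  exact this.ne' h3

namespace TorusMetric

/-- The derivative of `x ↦ g x v v` in the direction `e`. -/
def dg (M : TorusMetric) (x e v : ℝ × ℝ) : ℝ :=
  fderiv ℝ M.cE x e * (v.1 * v.1) + fderiv ℝ M.cF x e * (2 * (v.1 * v.2))
    + fderiv ℝ M.cG x e * (v.2 * v.2)

lemma continuous_dg (M : TorusMetric) {X : Type*} [TopologicalSpace X] {c e v : X → ℝ × ℝ}
    (hc : Continuous c) (he : Continuous e) (hv : Continuous v) :
    Continuous fun t => M.dg (c t) (e t) (v t) := by
  have h1 : Continuous fun t => fderiv ℝ M.cE (c t) (e t) :=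
    ((M.contDiff_cE.continuous_fderiv (by simp)).comp hc).clm_apply he
  have h2 : Continuous fun t => fderiv ℝ M.cF (c t) (e t) :=
    ((M.contDiff_cF.continuous_fderiv (by simp)).comp hc).clm_apply he
  have h3 : Continuous fun t => fderiv ℝ M.cG (c t) (e t) :=
    ((M.contDiff_cG.continuous_fderiv (by simp)).comp hc).clm_apply he
  unfold dg
  fun_prop

lemma continuous_g' (M : TorusMetric) {X : Type*} [TopologicalSpace X] {u v w : X → ℝ × ℝ}
    (hu : Continuous u) (hv : Continuous v) (hw : Continuous w) :
    Continuous fun t => M.g (u t) (v t) (w t) :=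
  M.smooth.continuous.comp (hu.prodMk (hv.prodMk hw))

lemma hasDerivAt_g (M : TorusMetric) {c u : ℝ → ℝ × ℝ} {c' u' : ℝ × ℝ} {r : ℝ}
    (hc : HasDerivAt c c' r) (hu : HasDerivAt u u' r) :
    HasDerivAt (fun r => M.g (c r) (u r) (u r))
      (M.dg (c r) c' (u r) + 2 * M.g (c r) (u r) u') r := by
  have h1 := (((M.contDiff_cE.differentiable (by simp)) (c r)).hasFDerivAt).comp_hasDerivAt r hc
  have h2 := (((M.contDiff_cF.differentiable (by simp)) (c r)).hasFDerivAt).comp_hasDerivAt r hc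
  have h3 := (((M.contDiff_cG.differentiable (by simp)) (c r)).hasFDerivAt).comp_hasDerivAt r hc
  have u1 := hasDerivAt_fst_comp hu
  have u2 := hasDerivAt_snd_comp hu
  simp only [M.g_eq]
  refine (((h1.mul (u1.mul u1)).add (h2.mul ((u1.mul u2).add (u2.mul u1)))).add
    (h3.mul (u2.mul u2))).congr_deriv ?_
  simp only [dg, Function.comp, Pi.mul_apply, Pi.add_apply]
  ring

lemma first_variation (M : TorusMetric) {c : ℝ → ℝ × ℝ} (hc : ContDiff ℝ 1 c) {a b : ℝ}
    (hab : a < b) (hd : M.dist (c a) (c b) = b - a)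
    (hs : ∀ t ∈ Icc a b, M.g (c t) (deriv c t) (deriv c t) = 1) (e : ℝ × ℝ)
    {φ : ℝ → ℝ} (hφ : Continuous φ) (hφ0 : ∫ t in a..b, φ t = 0) :
    ∫ t in a..b, (M.dg (c t) e (deriv c t) * (∫ u in a..t, φ u)
      + 2 * M.g (c t) (deriv c t) e * φ t) = 0 := by
  set Φ : ℝ → ℝ := fun t => ∫ u in a..t, φ u with hΦ
  have hΦd : ∀ t, HasDerivAt Φ (φ t) t := hasDerivAt_primitive hφ a
  have hΦc : Continuous Φ := continuous_iff_continuousAt.2 fun t => (hΦd t).continuousAt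
  have hΦ1 : ContDiff ℝ 1 Φ := contDiff_one_iff_deriv.2
    ⟨fun t => (hΦd t).differentiableAt, by rw [show deriv Φ = φ from funext fun t => (hΦd t).deriv]; exact hφ⟩
  have hw := hc.continuous_deriv le_rfl
  set F : ℝ → ℝ → ℝ := fun r t => M.g (c t + r • Φ t • e) (deriv c t + r • φ t • e)
    (deriv c t + r • φ t • e) with hF
  set F' : ℝ → ℝ → ℝ := fun r t => M.dg (c t + r • Φ t • e) (Φ t • e) (deriv c t + r • φ t • e)
    + 2 * M.g (c t + r • Φ t • e) (deriv c t + r • φ t • e) (φ t • e) with hF'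
  have hcc := hc.continuous
  have cF : Continuous (fun p : ℝ × ℝ => F p.1 p.2) :=
    M.continuous_g' (by fun_prop) (by fun_prop) (by fun_prop)
  have cF' : Continuous (fun p : ℝ × ℝ => F' p.1 p.2) :=
    (M.continuous_dg (by fun_prop) (by fun_prop) (by fun_prop)).add
      (continuous_const.mul (M.continuous_g' (by fun_prop) (by fun_prop) (by fun_prop)))
  have cFr : ∀ r, Continuous (F r) := fun r => cF.comp (by fun_prop : Continuous fun t => (r, t))
  have cFr' : ∀ r, Continuous (F' r) := fun r => cF'.comp (by fun_prop : Continuous fun t => (r, t))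
  have hder : ∀ r t, HasDerivAt (fun r => F r t) (F' r t) r := by
    intro r t
    have k : ∀ x v : ℝ × ℝ, HasDerivAt (fun r : ℝ => x + r • v) v r := by
      intro x v
      simpa using ((hasDerivAt_id r).smul_const v).const_add x
    exact M.hasDerivAt_g (k _ _) (k _ _)
  obtain ⟨B, hB⟩ := (isCompact_Icc (a := (-1 : ℝ)) (b := 1) |>.prod
    (isCompact_Icc (a := a) (b := b))).exists_bound_of_continuousOn cF'.continuousOn
  have hJ := (intervalIntegral.hasDerivAt_integral_of_dominated_loc_of_deriv_le
    (F := F) (F' := F') (x₀ := 0) (a := a) (b := b) (μ := MeasureTheory.volume)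
    (bound := fun _ => B) (s := Ioo (-1) 1) (Ioo_mem_nhds (by norm_num) (by norm_num))
    (Eventually.of_forall fun r => (cFr r).aestronglyMeasurable)
    ((cFr 0).intervalIntegrable _ _) (cFr' 0).aestronglyMeasurable
    (MeasureTheory.ae_of_all _ fun t ht r hr => hB (r, t) ⟨⟨hr.1.le, hr.2.le⟩, by
      rw [uIoc_of_le hab.le] at ht; exact ⟨ht.1.le, ht.2⟩⟩)
    (by simp) (MeasureTheory.ae_of_all _ fun t ht r hr => hder r t)).2
  have hmin : IsLocalMin (fun r => ∫ t in a..b, F r t) 0 := by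
    refine Eventually.of_forall fun r => ?_
    have e0 : ∫ t in a..b, F 0 t = b - a := by
      have : ∫ t in a..b, F 0 t = ∫ t in a..b, (1 : ℝ) := by
        refine intervalIntegral.integral_congr fun t ht => ?_
        rw [uIcc_of_le hab.le] at ht
        simp only [hF, zero_smul, add_zero]
        exact hs t ht
      rw [this]; simp
    simp only [e0]
    have hcr : ContDiff ℝ 1 fun t => c t + r • Φ t • e :=
      hc.add (((hΦ1.smul contDiff_const : ContDiff ℝ 1 fun t => Φ t • e)).const_smul r)
    have hdr : ∀ t, deriv (fun t => c t + r • Φ t • e) t = deriv c t + r • φ t • e := fun t =>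
      ((((hc.differentiable (by simp)) t).hasDerivAt).add
        (((hΦd t).smul_const e).const_smul r)).deriv
    have h1 := M.dist_le_length hcr hab.le
    have z1 : Φ a = 0 := intervalIntegral.integral_same
    have z2 : Φ b = 0 := hφ0
    simp only [z1, z2, zero_smul, smul_zero, add_zero, hd] at h1
    have h2 : M.length (fun t => c t + r • Φ t • e) a b ≤ ∫ t in a..b, (1 / 2 + 1 / 2 * F r t) := by
      refine intervalIntegral.integral_mono_on hab.le
        ((M.continuous_speed hcr).intervalIntegrable _ _)
        ((continuous_const.add (continuous_const.mul (cFr r))).intervalIntegrable _ _)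
        fun t ht => ?_
      rw [hdr]
      change Real.sqrt (F r t) ≤ _
      have hp : 0 ≤ F r t := M.g_nonneg _ _
      have := Real.sq_sqrt hp
      nlinarith [sq_nonneg (Real.sqrt (F r t) - 1)]
    have c1 : Continuous fun t => 1 / 2 * F r t := continuous_const.mul (cFr r)
    rw [intervalIntegral.integral_add intervalIntegrable_const (c1.intervalIntegrable _ _),
      intervalIntegral.integral_const_mul, intervalIntegral.integral_const, smul_eq_mul] at h2
    linarith
  have := hmin.hasDerivAt_eq_zero hJ
  rw [← this]
  refine intervalIntegral.integral_congr fun t _ => ?_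
  simp only [hF', zero_smul, add_zero]
  have k1 : ∀ x (s : ℝ) v, M.dg x (s • e) v = M.dg x e v * s := by
    intro x s v; simp only [dg, map_smul, smul_eq_mul]; ring
  have k2 : ∀ x v (s : ℝ), M.g x v (s • e) = M.g x v e * s := by
    intro x v s; simp only [g_eq, Prod.smul_fst, Prod.smul_snd, smul_eq_mul]; ring
  rw [k1, k2]; ring

/-- The Euler–Lagrange equation of metric geodesics. -/
lemma IsMetGeod.euler_lagrange {M : TorusMetric} {γ : ℝ → ℝ × ℝ} {a b : ℝ}
    (hγ : M.IsMetGeod γ a b) {t : ℝ} (ht : t ∈ Ioo a b) (e : ℝ × ℝ) :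
    HasDerivAt (fun t => 2 * M.g (γ t) (deriv γ t) e) (M.dg (γ t) e (deriv γ t)) t := by
  obtain ⟨a', ha1, ha2⟩ := exists_between ht.1
  obtain ⟨b', hb1, hb2⟩ := exists_between ht.2
  have hab : a' < b' := ha2.trans hb1
  have hsub : Icc a' b' ⊆ Ioo a b := fun s hs => ⟨ha1.trans_le hs.1, hs.2.trans_lt hb2⟩
  set w : ℝ → ℝ × ℝ := IccExtend hab.le ((Icc a' b').domRestrict (deriv γ)) with hw
  have hwc : Continuous w :=
    (continuousOn_iff_continuous_domRestrict.1 (hγ.continuousOn_deriv.mono hsub)).Icc_extend'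
  have hwe : ∀ s ∈ Icc a' b', w s = deriv γ s := by
    intro s hs; rw [hw, IccExtend_of_mem _ _ hs]; rfl
  set c : ℝ → ℝ × ℝ := fun s => γ a' + ∫ u in a'..s, w u with hc
  have hcd : ∀ s, HasDerivAt c (w s) s := fun s => (hasDerivAt_primitive hwc a' s).const_add _
  have hdc : deriv c = w := funext fun s => (hcd s).deriv
  have hc1 : ContDiff ℝ 1 c := contDiff_one_iff_deriv.2
    ⟨fun s => (hcd s).differentiableAt, by rw [hdc]; exact hwc⟩
  have hce : ∀ s ∈ Icc a' b', c s = γ s := by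
    intro s hs
    have : ∫ u in a'..s, w u = γ s - γ a' := by
      refine intervalIntegral.integral_eq_sub_of_hasDerivAt (fun u hu => ?_)
        (hwc.intervalIntegrable _ _)
      rw [uIcc_of_le hs.1] at hu
      have hu' : u ∈ Icc a' b' := ⟨hu.1, hu.2.trans hs.2⟩
      rw [hwe u hu']
      exact (hγ.differentiableAt (hsub hu')).hasDerivAt
    simp only [hc, this]; abel
  have ma : a' ∈ Icc a' b' := ⟨le_rfl, hab.le⟩
  have mb : b' ∈ Icc a' b' := ⟨hab.le, le_rfl⟩
  have hdist : M.dist (c a') (c b') = b' - a' := by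
    rw [hce a' ma, hce b' mb, hγ a' (Ioo_subset_Icc_self (hsub ma)) b'
      (Ioo_subset_Icc_self (hsub mb)), abs_of_neg (by linarith)]; ring
  obtain ⟨k, hk⟩ := exists_eq_const_add_integral
    (p := fun t => 2 * M.g (c t) (deriv c t) e) (l := fun t => M.dg (c t) e (deriv c t))
    (by rw [hdc]; exact continuous_const.mul (M.continuous_g hc1.continuous hwc continuous_const))
    (by rw [hdc]; exact M.continuous_dg hc1.continuous continuous_const hwc) hab
    (fun φ hφ hφ0 => M.first_variation hc1 hab hdist (fun s hs => by
      rw [hdc, hce s hs, hwe s hs]; exact hγ.speed (hsub hs)) e hφ hφ0)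
  have ht' : t ∈ Icc a' b' := ⟨ha2.le, hb1.le⟩
  have hlc : Continuous fun t => M.dg (c t) e (deriv c t) := by
    rw [hdc]; exact M.continuous_dg hc1.continuous continuous_const hwc
  have := (hasDerivAt_primitive hlc a' t).const_add k
  rw [hdc, hce t ht', hwe t ht'] at this
  refine this.congr_of_eventuallyEq ?_
  filter_upwards [Ioo_mem_nhds ha2 hb1] with s hs
  have hs' := Ioo_subset_Icc_self hs
  have := hk s hs'
  simp only [hdc] at this
  rw [hce s hs', hwe s hs'] at this
  simpa only [hdc] using this

end TorusMetric

namespace TorusMetric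

lemma det_pos (M : TorusMetric) (x : ℝ × ℝ) : 0 < M.cE x * M.cG x - M.cF x ^ 2 := by
  have hE : 0 < M.cE x := M.posdef x _ (by simp)
  have h := M.posdef x (-M.cF x, M.cE x) (by
    intro h; exact hE.ne' (congrArg Prod.snd h))
  rw [g_eq] at h
  have : 0 < M.cE x * (M.cE x * M.cG x - M.cF x ^ 2) := by
    simp only at h; nlinarith
  exact (pos_iff_pos_of_mul_pos this).1 hE

/-- The momentum of a tangent vector. -/
def mom (M : TorusMetric) (x v : ℝ × ℝ) : ℝ × ℝ :=
  (2 * M.g x v (1, 0), 2 * M.g x v (0, 1))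

/-- The tangent vector with a given momentum. -/
def vel (M : TorusMetric) (x p : ℝ × ℝ) : ℝ × ℝ :=
  ((M.cG x * p.1 - M.cF x * p.2) / (2 * (M.cE x * M.cG x - M.cF x ^ 2)),
    (M.cE x * p.2 - M.cF x * p.1) / (2 * (M.cE x * M.cG x - M.cF x ^ 2)))

lemma vel_mom (M : TorusMetric) (x v : ℝ × ℝ) : M.vel x (M.mom x v) = v := by
  have h := (mul_pos two_pos (M.det_pos x)).ne'
  ext <;> simp only [vel, mom, g_eq] <;> rw [div_eq_iff h] <;> ring

/-- The geodesic vector field in position and momentum coordinates. -/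
def field (M : TorusMetric) (y : (ℝ × ℝ) × (ℝ × ℝ)) : (ℝ × ℝ) × (ℝ × ℝ) :=
  (M.vel y.1 y.2, (M.dg y.1 (1, 0) (M.vel y.1 y.2), M.dg y.1 (0, 1) (M.vel y.1 y.2)))

lemma contDiff_field (M : TorusMetric) : ContDiff ℝ (⊤ : ℕ∞) M.field := by
  have hE : ContDiff ℝ (⊤ : ℕ∞) fun y : (ℝ × ℝ) × (ℝ × ℝ) => M.cE y.1 := M.contDiff_cE.comp contDiff_fst
  have hF : ContDiff ℝ (⊤ : ℕ∞) fun y : (ℝ × ℝ) × (ℝ × ℝ) => M.cF y.1 := M.contDiff_cF.comp contDiff_fst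
  have hG : ContDiff ℝ (⊤ : ℕ∞) fun y : (ℝ × ℝ) × (ℝ × ℝ) => M.cG y.1 := M.contDiff_cG.comp contDiff_fst
  have h1 : ContDiff ℝ (⊤ : ℕ∞) fun y : (ℝ × ℝ) × (ℝ × ℝ) => y.2.1 := contDiff_fst.comp contDiff_snd
  have h2 : ContDiff ℝ (⊤ : ℕ∞) fun y : (ℝ × ℝ) × (ℝ × ℝ) => y.2.2 := contDiff_snd.comp contDiff_snd
  have hne : ∀ y : (ℝ × ℝ) × (ℝ × ℝ), 2 * (M.cE y.1 * M.cG y.1 - M.cF y.1 ^ 2) ≠ 0 := fun y =>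
    (mul_pos two_pos (M.det_pos y.1)).ne'
  have hdet : ContDiff ℝ (⊤ : ℕ∞)
      fun y : (ℝ × ℝ) × (ℝ × ℝ) => 2 * (M.cE y.1 * M.cG y.1 - M.cF y.1 ^ 2) :=
    contDiff_const.mul ((hE.mul hG).sub (hF.pow 2))
  have v1 : ContDiff ℝ (⊤ : ℕ∞) fun y : (ℝ × ℝ) × (ℝ × ℝ) => (M.vel y.1 y.2).1 :=
    ((hG.mul h1).sub (hF.mul h2)).div hdet hne
  have v2 : ContDiff ℝ (⊤ : ℕ∞) fun y : (ℝ × ℝ) × (ℝ × ℝ) => (M.vel y.1 y.2).2 :=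
    ((hE.mul h2).sub (hF.mul h1)).div hdet hne
  have dc : ∀ (f : ℝ × ℝ → ℝ) (e : ℝ × ℝ), ContDiff ℝ (⊤ : ℕ∞) f →
      ContDiff ℝ (⊤ : ℕ∞) fun y : (ℝ × ℝ) × (ℝ × ℝ) => fderiv ℝ f y.1 e := fun f e hf =>
    ((hf.fderiv_right (m := (⊤ : ℕ∞)) (by simp)).comp contDiff_fst).clm_apply contDiff_const
  have d : ∀ e : ℝ × ℝ, ContDiff ℝ (⊤ : ℕ∞)
      fun y : (ℝ × ℝ) × (ℝ × ℝ) => M.dg y.1 e (M.vel y.1 y.2) := fun e =>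
    (((dc _ e M.contDiff_cE).mul (v1.mul v1)).add
      ((dc _ e M.contDiff_cF).mul (contDiff_const.mul (v1.mul v2)))).add
      ((dc _ e M.contDiff_cG).mul (v2.mul v2))
  exact (v1.prodMk v2).prodMk ((d _).prodMk (d _))

/-- The phase curve of a metric geodesic. -/
def phase (M : TorusMetric) (γ : ℝ → ℝ × ℝ) (t : ℝ) : (ℝ × ℝ) × (ℝ × ℝ) :=
  (γ t, M.mom (γ t) (deriv γ t))

lemma IsMetGeod.hasDerivAt_phase {M : TorusMetric} {γ : ℝ → ℝ × ℝ} {a b : ℝ}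
    (hγ : M.IsMetGeod γ a b) {t : ℝ} (ht : t ∈ Ioo a b) :
    HasDerivAt (M.phase γ) (M.field (M.phase γ t)) t := by
  simp only [field, phase, vel_mom]
  exact (hγ.differentiableAt ht).hasDerivAt.prodMk
    ((hγ.euler_lagrange ht (1, 0)).prodMk (hγ.euler_lagrange ht (0, 1)))

lemma IsMetGeod.norm_deriv_le {M : TorusMetric} {γ : ℝ → ℝ × ℝ} {a b : ℝ}
    (hγ : M.IsMetGeod γ a b) {t : ℝ} (ht : t ∈ Ioo a b) : ‖deriv γ t‖ ≤ M.bd := by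
  simpa [hγ.speed ht] using M.norm_le_speed (γ t) (deriv γ t)

lemma continuous_mom (M : TorusMetric) : Continuous fun p : (ℝ × ℝ) × (ℝ × ℝ) => M.mom p.1 p.2 :=
  (continuous_const.mul (M.continuous_g' continuous_fst continuous_snd continuous_const)).prodMk
    (continuous_const.mul (M.continuous_g' continuous_fst continuous_snd continuous_const))

lemma IsMetGeod.exists_phase_mem {M : TorusMetric} {γ : ℝ → ℝ × ℝ} {a b : ℝ}
    (hγ : M.IsMetGeod γ a b) : ∃ R, ∀ t ∈ Ioo a b, M.phase γ t ∈ Metric.closedBall 0 R := by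
  have h1 : IsCompact (γ '' Icc a b) := isCompact_Icc.image_of_continuousOn hγ.lip.continuousOn
  have h2 := h1.prod (isCompact_closedBall (0 : ℝ × ℝ) M.bd)
  have h3 : Continuous fun p : (ℝ × ℝ) × (ℝ × ℝ) => (p.1, M.mom p.1 p.2) :=
    continuous_fst.prodMk M.continuous_mom
  obtain ⟨R, hR⟩ := (h2.image h3).isBounded.subset_closedBall 0
  exact ⟨R, fun t ht => hR ⟨(γ t, deriv γ t), ⟨⟨t, Ioo_subset_Icc_self ht, rfl⟩,
    mem_closedBall_zero_iff.2 (hγ.norm_deriv_le ht)⟩, rfl⟩⟩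

lemma IsMetGeod.eqOn_of_tangent {M : TorusMetric} {γ η : ℝ → ℝ × ℝ} {a b : ℝ}
    (hγ : M.IsMetGeod γ a b) (hη : M.IsMetGeod η a b) {t : ℝ} (ht : t ∈ Ioo a b)
    (h : γ t = η t) (h' : deriv γ t = deriv η t) : EqOn γ η (Icc a b) := by
  obtain ⟨R, hR⟩ := hγ.exists_phase_mem
  obtain ⟨R', hR'⟩ := hη.exists_phase_mem
  obtain ⟨K, hK⟩ := (M.contDiff_field.contDiffOn
    (s := Metric.closedBall 0 (max R R'))).exists_lipschitzOnWith (by simp)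
    (convex_closedBall _ _) (isCompact_closedBall _ _)
  have key : EqOn (M.phase γ) (M.phase η) (Ioo a b) :=
    ODE_solution_unique_of_mem_Ioo (v := fun _ => M.field) (fun _ _ => hK) ht
      (fun s hs => ⟨hγ.hasDerivAt_phase hs,
        Metric.closedBall_subset_closedBall (le_max_left _ _) (hR s hs)⟩)
      (fun s hs => ⟨hη.hasDerivAt_phase hs,
        Metric.closedBall_subset_closedBall (le_max_right _ _) (hR' s hs)⟩)
      (by simp only [phase, h, h'])
  have hab : a ≠ b := (ht.1.trans ht.2).ne
  have k2 : EqOn γ η (Ioo a b) := fun s hs => congrArg Prod.fst (key hs)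
  have := k2.of_subset_closure hγ.lip.continuousOn hη.lip.continuousOn Ioo_subset_Icc_self
    (by rw [closure_Ioo hab])
  exact this

/-- The curve `γ` is isometric at scale `r`. -/
def IsLocGeod (M : TorusMetric) (γ : ℝ → ℝ × ℝ) (r : ℝ) : Prop :=
  ∀ s t, |s - t| ≤ r → M.dist (γ s) (γ t) = |s - t|

lemma IsLocGeod.isMetGeod {M : TorusMetric} {γ : ℝ → ℝ × ℝ} {r : ℝ} (h : M.IsLocGeod γ r)
    {a b : ℝ} (hab : b - a ≤ r) : M.IsMetGeod γ a b := fun s hs t ht =>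
  h s t (abs_le.2 ⟨by linarith [hs.1, hs.2, ht.1, ht.2], by linarith [hs.1, hs.2, ht.1, ht.2]⟩)

lemma IsLocGeod.isGeodesic {M : TorusMetric} {γ : ℝ → ℝ × ℝ} {r : ℝ} (hr : 0 < r)
    (h : M.IsLocGeod γ r) : M.IsGeodesic γ := by
  have hm : ∀ t, M.IsMetGeod γ (t - r / 2) (t + r / 2) := fun t => h.isMetGeod (by linarith)
  have hi : ∀ t, t ∈ Ioo (t - r / 2) (t + r / 2) := fun t => ⟨by linarith, by linarith⟩
  have hd : ∀ t, HasDerivAt (M.phase γ) (M.field (M.phase γ t)) t := fun t =>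
    (hm t).hasDerivAt_phase (hi t)
  have hn : ∀ n : ℕ, ContDiff ℝ n (M.phase γ) := by
    intro n
    induction n with
    | zero => exact contDiff_zero.2 (continuous_iff_continuousAt.2 fun t => (hd t).continuousAt)
    | succ n ih =>
      push_cast
      refine contDiff_succ_iff_deriv.2 ⟨fun t => (hd t).differentiableAt, by simp, ?_⟩
      rw [show deriv (M.phase γ) = fun t => M.field (M.phase γ t) from funext fun t => (hd t).deriv]
      exact (M.contDiff_field.of_le (by exact_mod_cast le_top)).comp ih
  have hs : ContDiff ℝ (⊤ : ℕ∞) γ := contDiff_fst.comp (contDiff_infty.2 hn)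
  have hsp : ∀ t, M.g (γ t) (deriv γ t) (deriv γ t) = 1 := fun t => (hm t).speed (hi t)
  refine ⟨hs, hsp, fun t => ⟨r / 2, by positivity, fun s₁ s₂ h1 h2 h3 => ?_⟩⟩
  rw [h s₁ s₂ (abs_le.2 ⟨by linarith, by linarith⟩), abs_of_nonpos (by linarith)]
  simp [length, hsp]

lemma IsGeodesic.length_eq {M : TorusMetric} {c : ℝ → ℝ × ℝ} (hc : M.IsGeodesic c) (s t : ℝ) :
    M.length c s t = t - s := by
  simp [length, hc.2.1]

lemma IsGeodesic.lip {M : TorusMetric} {c : ℝ → ℝ × ℝ} (hc : M.IsGeodesic c) (a b : ℝ) :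
    M.Lip c a b := by
  have : ∀ s t, s ≤ t → M.dist (c s) (c t) ≤ t - s := fun s t h => by
    have := M.dist_le_length (hc.1.of_le (by simp)) h
    rwa [hc.length_eq] at this
  intro s _ t _
  rcases le_total s t with h | h
  · rw [abs_of_nonpos (by linarith)]; linarith [this s t h]
  · rw [abs_of_nonneg (by linarith), M.dist_comm]; linarith [this t s h]

/-- Geodesics are isometric at a uniform scale on bounded intervals. -/
lemma IsGeodesic.exists_isMetGeod {M : TorusMetric} {c : ℝ → ℝ × ℝ} (hc : M.IsGeodesic c)
    (a b : ℝ) : ∃ r > 0, ∀ t ∈ Icc a b, M.IsMetGeod c (t - r) (t + r) := by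
  choose ε hε hεd using hc.2.2
  have hloc : ∀ t, ∀ᶠ p : ℝ × ℝ in 𝓝 (t, 0), M.IsMetGeod c (p.1 - p.2) (p.1 + p.2) := by
    intro t
    have h1 : Tendsto (fun p : ℝ × ℝ => p.1 - p.2) (𝓝 (t, 0)) (𝓝 t) :=
      Continuous.tendsto' (by fun_prop) _ _ (by simp)
    have h2 : Tendsto (fun p : ℝ × ℝ => p.1 + p.2) (𝓝 (t, 0)) (𝓝 t) :=
      Continuous.tendsto' (by fun_prop) _ _ (by simp)
    filter_upwards [h1 (Icc_mem_nhds (show t - ε t < t by linarith [hε t])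
      (show t < t + ε t by linarith [hε t])), h2 (Icc_mem_nhds (show t - ε t < t by linarith [hε t])
      (show t < t + ε t by linarith [hε t]))] with p hp1 hp2
    have key : ∀ u v, t - ε t ≤ u → u ≤ v → v ≤ t + ε t → M.dist (c u) (c v) = v - u := fun u v a1 a2 a3 => by
      rw [hεd t u v a1 a2 a3, hc.length_eq]
    intro u hu v hv
    rcases le_total u v with h | h
    · rw [key u v (hp1.1.trans hu.1) h (hv.2.trans hp2.2), abs_of_nonpos (by linarith)]; ring
    · rw [M.dist_comm, key v u (hp1.1.trans hv.1) h (hu.2.trans hp2.2), abs_of_nonneg (by linarith)]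
  obtain ⟨r, hr, hr'⟩ : ∃ r > 0, ∀ t ∈ Icc a b, ∀ s, |s| < r → M.IsMetGeod c (t - s) (t + s) := by
    have := (isCompact_Icc (a := a) (b := b)).mem_nhdsSet_prod_of_forall
      (l := 𝓝 (0 : ℝ)) (s := {p : ℝ × ℝ | M.IsMetGeod c (p.1 - p.2) (p.1 + p.2)}) (fun t _ => by
        rw [← nhds_prod_eq]; exact hloc t)
    obtain ⟨U, hU, V, hV, hUV⟩ := Filter.mem_prod_iff.1 this
    obtain ⟨r, hr, hrV⟩ := Metric.mem_nhds_iff.1 hV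
    exact ⟨r, hr, fun t ht s hs => hUV (a := (t, s)) ⟨subset_of_mem_nhdsSet hU ht, hrV (by simpa using hs)⟩⟩
  exact ⟨r / 2, by positivity, fun t ht => hr' t ht _ (by rw [abs_of_pos (by positivity)]; linarith)⟩

end TorusMetric

namespace TorusMetric

lemma IsMetGeod.comp_add {M : TorusMetric} {γ : ℝ → ℝ × ℝ} {a b : ℝ} (h : M.IsMetGeod γ a b)
    (τ : ℝ) : M.IsMetGeod (fun t => γ (t + τ)) (a - τ) (b - τ) := fun s hs t ht => by
  rw [h (s + τ) ⟨by linarith [hs.1], by linarith [hs.2]⟩ (t + τ)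
    ⟨by linarith [ht.1], by linarith [ht.2]⟩]
  congr 1; ring

lemma IsMetGeod.comp_neg {M : TorusMetric} {γ : ℝ → ℝ × ℝ} {a b : ℝ} (h : M.IsMetGeod γ a b) :
    M.IsMetGeod (fun t => γ (-t)) (-b) (-a) := fun s hs t ht => by
  rw [h (-s) ⟨by linarith [hs.2], by linarith [hs.1]⟩ (-t) ⟨by linarith [ht.2], by linarith [ht.1]⟩,
    abs_sub_comm]
  congr 1; ring

/-- Two geodesic segments with the same endpoints are tangent where they can be exchanged. -/
lemma IsMetGeod.deriv_eq_of_meet {M : TorusMetric} {η κ : ℝ → ℝ × ℝ} {a b t s : ℝ}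
    (hη : M.IsMetGeod η a b) (hκ : M.IsMetGeod κ 0 s) (hat : a < t) (hs : 0 < s) (hb : t + s ≤ b)
    (h0 : η t = κ 0) (h1 : η (t + s) = κ s) (dη : DifferentiableAt ℝ η t)
    (dκ : DifferentiableAt ℝ κ 0) : deriv η t = deriv κ 0 := by
  set ζ : ℝ → ℝ × ℝ := fun u => if u ≤ t then η u else κ (u - t) with hζ
  have e1 : ∀ u, u ≤ t → ζ u = η u := fun u hu => if_pos hu
  have e2 : ∀ u, t ≤ u → ζ u = κ (u - t) := by
    intro u hu
    rcases hu.eq_or_lt with rfl | hu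
    · rw [e1 _ le_rfl, h0, sub_self]
    · exact if_neg hu.not_ge
  have hle : ∀ u ∈ Icc a (t + s), ∀ v ∈ Icc a (t + s), u ≤ v → M.dist (ζ u) (ζ v) ≤ v - u := by
    intro u hu v hv huv
    rcases le_total v t with hvt | hvt
    · rw [e1 u (huv.trans hvt), e1 v hvt, hη u ⟨hu.1, hu.2.trans hb⟩ v ⟨hv.1, hv.2.trans hb⟩,
        abs_of_nonpos (by linarith)]
      linarith
    · rcases le_total u t with hut | hut
      · have k1 := hη u ⟨hu.1, hu.2.trans hb⟩ t ⟨hat.le, by linarith⟩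
        have k2 := hκ 0 ⟨le_rfl, hs.le⟩ (v - t) ⟨by linarith, by linarith [hv.2]⟩
        rw [e1 u hut, e2 v hvt]
        have := M.dist_triangle (η u) (η t) (κ (v - t))
        rw [k1, h0, k2, abs_of_nonpos (by linarith), abs_of_nonpos (by linarith)] at this
        linarith
      · rw [e2 u hut, e2 v hvt, hκ (u - t) ⟨by linarith, by linarith [hu.2]⟩ (v - t)
          ⟨by linarith, by linarith [hv.2]⟩, abs_of_nonpos (by linarith)]
        linarith
  have hL : M.Lip ζ a (t + s) := by
    intro u hu v hv
    rcases le_total u v with h | h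
    · rw [abs_of_nonpos (by linarith)]; linarith [hle u hu v hv h]
    · rw [abs_of_nonneg (by linarith), M.dist_comm]; linarith [hle v hv u hu h]
  have hG : M.IsMetGeod ζ a (t + s) := hL.isMetGeod (by
    rw [e1 a hat.le, e2 (t + s) (by linarith), add_sub_cancel_left, ← h1,
      hη a ⟨le_rfl, by linarith⟩ _ ⟨by linarith, hb⟩, abs_of_nonpos (by linarith)]
    linarith)
  have dζ := (hG.differentiableAt ⟨hat, by linarith⟩ : DifferentiableAt ℝ ζ t).hasDerivAt
  have dκ' : HasDerivAt (fun u => κ (u - t)) (deriv κ 0) t := by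
    have := dκ.hasDerivAt
    rw [show (0 : ℝ) = t - t by ring] at this
    have h2 := this.comp_sub_const t t
    simpa using h2
  have k1 : deriv ζ t = deriv η t :=
    (uniqueDiffWithinAt_Iic t).eq_deriv _ dζ.hasDerivWithinAt
      ((dη.hasDerivAt.hasDerivWithinAt).congr (fun u hu => e1 u hu) (e1 t le_rfl))
  have k2 : deriv ζ t = deriv κ 0 :=
    (uniqueDiffWithinAt_Ici t).eq_deriv _ dζ.hasDerivWithinAt
      ((dκ'.hasDerivWithinAt).congr (fun u hu => e2 u hu) (e2 t le_rfl))
  rw [← k1, k2]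

lemma crossDet_self (v : ℝ × ℝ) : crossDet v v = 0 := by simp [crossDet]; ring

lemma IsMetGeod.crossDet_eq_zero_of_meet {M : TorusMetric} {η κ : ℝ → ℝ × ℝ} {a b r t t' s : ℝ}
    (hη : M.IsMetGeod η a b) (hκ : M.IsMetGeod κ (-r) r) (ht : t ∈ Ioo a b) (ht' : t' ∈ Icc a b)
    (hs : s ∈ Icc (-r) r) (h0 : η t = κ 0) (h1 : η t' = κ s) (hne : t' ≠ t) :
    crossDet (deriv κ 0) (deriv η t) = 0 := by
  have hr : 0 ≤ r := by linarith [hs.1, hs.2]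
  have habs : |t' - t| = |s| := by
    have k1 := hη t' ht' t (Ioo_subset_Icc_self ht)
    rw [h0, h1, hκ s hs 0 ⟨by linarith, hr⟩, sub_zero] at k1
    exact k1.symm
  have hs0 : 0 < |s| := by rw [← habs]; exact abs_pos.2 (sub_ne_zero.2 hne)
  have hr0 : 0 < r := hs0.trans_le (abs_le.2 hs)
  have dη := hη.differentiableAt ht
  have dκ : DifferentiableAt ℝ κ 0 := hκ.differentiableAt ⟨by linarith, hr0⟩
  have hκn : M.IsMetGeod (fun t => κ (-t)) (-r) r := by simpa using hκ.comp_neg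
  have dκn : DifferentiableAt ℝ (fun t => κ (-t)) 0 := hκn.differentiableAt ⟨by linarith, hr0⟩
  have eκn : deriv (fun t => κ (-t)) 0 = -deriv κ 0 := by rw [deriv_comp_neg]; simp
  have dηn : DifferentiableAt ℝ (fun t => η (-t)) (-t) :=
    hη.comp_neg.differentiableAt ⟨by linarith [ht.2], by linarith [ht.1]⟩
  have eηn : deriv (fun t => η (-t)) (-t) = -deriv η t := by rw [deriv_comp_neg]; simp
  rcases lt_or_gt_of_ne hne with h | h <;> rcases le_total 0 s with h' | h'
  · rw [abs_of_neg (by linarith), abs_of_nonneg h'] at habs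
    have := hη.comp_neg.deriv_eq_of_meet (hκ.mono (by linarith) hs.2) (t := -t) (s := s)
      (by linarith [ht.2]) (by linarith) (by linarith [ht'.1]) (by simpa using h0)
      (by rw [← h1]; congr 1; linarith) dηn dκ
    rw [← this, eηn]; simp [crossDet]; ring
  · rw [abs_of_neg (by linarith), abs_of_nonpos h'] at habs
    have := hη.comp_neg.deriv_eq_of_meet (hκn.mono (b' := -s) (by linarith) (by linarith [hs.1]))
      (t := -t) (s := -s)
      (by linarith [ht.2]) (by linarith) (by linarith [ht'.1]) (by simpa using h0)
      (by rw [neg_neg, ← h1]; congr 1; linarith) dηn dκn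
    rw [eηn, eκn] at this
    rw [neg_injective this]; simp [crossDet]; ring
  · rw [abs_of_pos (by linarith), abs_of_nonneg h'] at habs
    have := hη.deriv_eq_of_meet (hκ.mono (by linarith) hs.2) (t := t) (s := s)
      (by linarith [ht.1]) (by linarith) (by linarith [ht'.2]) h0
      (by rw [← h1]; congr 1; linarith) dη dκ
    rw [this]; simp [crossDet]; ring
  · rw [abs_of_pos (by linarith), abs_of_nonpos h'] at habs
    have := hη.deriv_eq_of_meet (hκn.mono (b' := -s) (by linarith) (by linarith [hs.1]))
      (t := t) (s := -s)
      (by linarith [ht.1]) (by linarith) (by linarith [ht'.2]) (by simpa using h0)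
      (by rw [neg_neg, ← h1]; congr 1; linarith) dη dκn
    rw [this, eκn]; simp [crossDet]; ring

lemma eq_or_eq_neg_of_crossDet_eq_zero (M : TorusMetric) {x v w : ℝ × ℝ} (hv : M.g x v v = 1)
    (hw : M.g x w w = 1) (h : crossDet v w = 0) : w = v ∨ w = -v := by
  obtain ⟨l, hl⟩ : ∃ l : ℝ, w = l • v := by
    simp only [crossDet] at h
    by_cases h1 : v.1 = 0
    · by_cases h2 : v.2 = 0
      · rw [show v = 0 from Prod.ext h1 h2] at hv
        simp [g_eq] at hv
      · refine ⟨w.2 / v.2, Prod.ext ?_ ?_⟩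
        · simp only [Prod.smul_fst, smul_eq_mul]; field_simp; linarith
        · simp only [Prod.smul_snd, smul_eq_mul]; field_simp
    · refine ⟨w.2 / v.1 * 0 + w.1 / v.1, Prod.ext ?_ ?_⟩
      · simp only [Prod.smul_fst, smul_eq_mul]; field_simp; ring
      · simp only [Prod.smul_snd, smul_eq_mul]; field_simp; linarith
  rw [hl, g_smul, hv, mul_one] at hw
  rcases sq_eq_one_iff.1 hw with rfl | rfl
  · left; simpa using hl
  · right; simpa using hl

/-- A geodesic segment tangent to a longer one is contained in it. -/
lemma IsMetGeod.mem_of_crossDet_eq_zero {M : TorusMetric} {η κ : ℝ → ℝ × ℝ} {a b r t : ℝ}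
    (hη : M.IsMetGeod η a b) (hκ : M.IsMetGeod κ (-r) r) (ht : t ∈ Ioo a b) (hab : b - a ≤ r)
    (h0 : η t = κ 0) (h : crossDet (deriv κ 0) (deriv η t) = 0) :
    η a ∈ κ '' Icc (-r) r := by
  have hr : 0 < r := by linarith [ht.1, ht.2]
  have h00 : (0 : ℝ) ∈ Ioo (-r) r := ⟨by linarith, hr⟩
  have key : ∀ κ : ℝ → ℝ × ℝ, M.IsMetGeod κ (-r) r → η t = κ 0 → deriv η t = deriv κ 0 →
      η a = κ (a - t) := by
    intro κ hκ h0 h'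
    have h1 := (hκ.comp_add (-t)).mono (a' := a) (b' := b) (by linarith [ht.2])
      (by linarith [ht.1])
    refine hη.eqOn_of_tangent h1 ht (by simpa using h0) ?_ ⟨le_rfl, (ht.1.trans ht.2).le⟩
    rw [h', deriv_comp_add_const, add_neg_cancel]
  have m1 : a - t ∈ Icc (-r) r := ⟨by linarith [ht.2], by linarith [ht.1]⟩
  have hsp := hη.speed ht
  rw [h0] at hsp
  rcases M.eq_or_eq_neg_of_crossDet_eq_zero (hκ.speed h00) hsp h with e | e
  · exact ⟨_, m1, (key κ hκ h0 e).symm⟩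
  · refine ⟨-(a - t), ⟨by linarith [m1.2], by linarith [m1.1]⟩, ?_⟩
    refine (key (fun t => κ (-t)) (by simpa using hκ.comp_neg) (by simpa using h0) ?_).symm
    rw [e, deriv_comp_neg]; simp

end TorusMetric

namespace TorusMetric

lemma IsMetGeod.one_le_dot {M : TorusMetric} {x w : ℝ × ℝ} (h : M.g x w w = 1) :
    1 / M.bd ^ 2 ≤ w.1 * w.1 + w.2 * w.2 := by
  have h1 := M.g_le x w
  have h2 : ‖w‖ ^ 2 ≤ w.1 * w.1 + w.2 * w.2 := by
    rcases max_choice ‖w.1‖ ‖w.2‖ with e | e <;>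
      rw [Prod.norm_def, e, Real.norm_eq_abs, sq_abs] <;> nlinarith [sq_nonneg w.1, sq_nonneg w.2]
  rw [h] at h1
  rw [div_le_iff₀ (by have := M.bd_pos; positivity)]
  nlinarith [sq_nonneg M.bd]

lemma abs_dot_le (v w : ℝ × ℝ) : |v.1 * w.1 + v.2 * w.2| ≤ 2 * (‖v‖ * ‖w‖) := by
  have h1 : |v.1 * w.1| ≤ ‖v‖ * ‖w‖ := by
    rw [abs_mul]; exact mul_le_mul (norm_fst_le v) (norm_fst_le w) (abs_nonneg _) (norm_nonneg _)
  have h2 : |v.2 * w.2| ≤ ‖v‖ * ‖w‖ := by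
    rw [abs_mul]; exact mul_le_mul (norm_snd_le v) (norm_snd_le w) (abs_nonneg _) (norm_nonneg _)
  linarith [abs_add_le (v.1 * w.1) (v.2 * w.2)]

/-- Geodesic strands of a given length locally separate balls of a uniform radius. -/
lemma exists_side (M : TorusMetric) {r : ℝ} (hr : 0 < r) : ∃ δ > 0, ∀ κ : ℝ → ℝ × ℝ,
    M.IsMetGeod κ (-r) r → ∃ f : ℝ × ℝ → ℝ, ContinuousOn f (Metric.closedBall (κ 0) δ) ∧
      f (κ 0) = 0 ∧ (∀ p ∈ Metric.closedBall (κ 0) δ, f p = 0 → p ∈ κ '' Icc (-r) r) ∧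
      ∀ (η : ℝ → ℝ × ℝ) (v : ℝ × ℝ) (t : ℝ), η t = κ 0 → HasDerivAt η v t →
        HasDerivAt (fun t => f (η t)) (crossDet (deriv κ 0) v) t := by
  have hb := M.bd_pos
  have hh : 0 < M.hol := by unfold hol; positivity
  set c := 1 / (2 * M.bd ^ 2) with hc
  have hc0 : 0 < c := by positivity
  set ρ := min (r / 4) ((1 / (4 * M.bd ^ 3 * M.hol)) ^ 2) with hρ
  have hρ0 : 0 < ρ := lt_min (by positivity) (by positivity)
  have hρr : ρ ≤ r / 4 := min_le_left _ _
  have hsq : 2 * M.bd * M.hol * Real.sqrt ρ ≤ c := by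
    have : Real.sqrt ρ ≤ 1 / (4 * M.bd ^ 3 * M.hol) :=
      Real.sqrt_le_iff.2 ⟨by positivity, min_le_right _ _⟩
    calc 2 * M.bd * M.hol * Real.sqrt ρ ≤ 2 * M.bd * M.hol * (1 / (4 * M.bd ^ 3 * M.hol)) := by gcongr
      _ = c := by rw [hc]; field_simp; norm_num
  refine ⟨c * ρ / (2 * M.bd), by positivity, fun κ hκ => ?_⟩
  set z := κ 0
  set w := deriv κ 0 with hw
  have h00 : (0 : ℝ) ∈ Ioo (-r) r := ⟨by linarith, hr⟩
  have hwn : ‖w‖ ≤ M.bd := hκ.norm_deriv_le h00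
  have hww := IsMetGeod.one_le_dot (hκ.speed h00)
  rw [← hw] at hww
  have hin : Icc (-ρ) ρ ⊆ Ioo (-r) r := fun s hs => ⟨by linarith [hs.1], by linarith [hs.2]⟩
  have hhol : ∀ s ∈ Icc (-ρ) ρ, ‖deriv κ s - w‖ ≤ M.hol * Real.sqrt ρ := by
    intro s hs
    have hm : ∀ x ≤ ρ, M.hol * Real.sqrt x ≤ M.hol * Real.sqrt ρ := fun x hx =>
      mul_le_mul_of_nonneg_left (Real.sqrt_le_sqrt hx) hh.le
    rcases lt_trichotomy s 0 with h | h | h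
    · refine (hκ.norm_deriv_sub_le (by linarith [hs.1]) h (by linarith [hs.1])).trans (hm _ (by linarith [hs.1]))
    · rw [h, ← hw, sub_self, norm_zero]; positivity
    · rw [norm_sub_rev]
      exact (hκ.norm_deriv_sub_le (by linarith) h (by linarith [hs.2])).trans (hm _ (by linarith [hs.2]))
  set A : ℝ × ℝ → ℝ := fun p => (p - z).1 * w.1 + (p - z).2 * w.2 with hA
  set B : ℝ × ℝ → ℝ := fun p => crossDet w (p - z) with hB
  have hκd : ∀ s ∈ Icc (-ρ) ρ, HasDerivAt κ (deriv κ s) s := fun s hs =>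
    (hκ.differentiableAt (hin hs)).hasDerivAt
  have hAd : ∀ (η : ℝ → ℝ × ℝ) v t, HasDerivAt η v t →
      HasDerivAt (fun t => A (η t)) (v.1 * w.1 + v.2 * w.2) t := fun η v t h =>
    ((hasDerivAt_fst_comp (h.sub_const z)).mul_const _).add
      ((hasDerivAt_snd_comp (h.sub_const z)).mul_const _)
  have hBd : ∀ (η : ℝ → ℝ × ℝ) v t, HasDerivAt η v t →
      HasDerivAt (fun t => B (η t)) (crossDet w v) t := fun η v t h =>
    ((hasDerivAt_snd_comp (h.sub_const z)).const_mul _).sub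
      ((hasDerivAt_fst_comp (h.sub_const z)).const_mul _)
  have hAc : Continuous A := by simp only [hA]; fun_prop
  have hBc : Continuous B := by simp only [hB, crossDet]; fun_prop
  have hmono : ∀ s ∈ Icc (-ρ) ρ, ∀ t ∈ Icc (-ρ) ρ, s ≤ t → c * (t - s) ≤ A (κ t) - A (κ s) := by
    refine (convex_Icc _ _).mul_sub_le_image_sub_of_le_deriv
      (fun s hs => (hAd _ _ _ (hκd s hs)).continuousAt.continuousWithinAt)
      (fun s hs => (hAd _ _ _ (hκd s (interior_subset hs))).differentiableAt.differentiableWithinAt) ?_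
    intro s hs
    have hs' := interior_subset hs
    rw [(hAd _ _ _ (hκd s hs')).deriv]
    have h1 := abs_dot_le (deriv κ s - w) w
    have h2 : ‖deriv κ s - w‖ * ‖w‖ ≤ M.hol * Real.sqrt ρ * M.bd :=
      mul_le_mul (hhol s hs') hwn (norm_nonneg _) (by positivity)
    have h3 := (abs_le.1 h1).1
    simp only [Prod.fst_sub, Prod.snd_sub] at h3
    have h4 : 1 / M.bd ^ 2 = 2 * c := by rw [hc]; field_simp
    rw [h4] at hww
    nlinarith
  have mρ : ρ ∈ Icc (-ρ) ρ := ⟨by linarith, le_rfl⟩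
  have mρ' : -ρ ∈ Icc (-ρ) ρ := ⟨le_rfl, by linarith⟩
  have m0 : (0 : ℝ) ∈ Icc (-ρ) ρ := ⟨by linarith, by linarith⟩
  have hA0 : A (κ 0) = 0 := by simp [hA, z]
  have hB0 : B (κ 0) = 0 := by simp [hB, z, crossDet]
  have hex : ∀ u : ℝ, ∃ s, u ∈ Icc (-(c * ρ)) (c * ρ) → s ∈ Icc (-ρ) ρ ∧ A (κ s) = u := by
    intro u
    by_cases hu : u ∈ Icc (-(c * ρ)) (c * ρ)
    · have k1 := hmono 0 m0 ρ mρ hρ0.le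
      have k2 := hmono (-ρ) mρ' 0 m0 (by linarith)
      rw [hA0] at k1 k2
      obtain ⟨s, hs, hs'⟩ := intermediate_value_Icc (show -ρ ≤ ρ by linarith)
        (f := fun s => A (κ s))
        (fun s hs => (hAd _ _ _ (hκd s hs)).continuousAt.continuousWithinAt)
        (show u ∈ Icc _ _ from ⟨by linarith [hu.1], by linarith [hu.2]⟩)
      exact ⟨s, fun _ => ⟨hs, hs'⟩⟩
    · exact ⟨0, fun h => absurd h hu⟩
  choose σ hσ using hex
  have hlip : ∀ s ∈ Icc (-ρ) ρ, ∀ t ∈ Icc (-ρ) ρ, c * |s - t| ≤ |A (κ s) - A (κ t)| := by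
    intro s hs t ht
    rcases le_total s t with h | h
    · rw [abs_sub_comm s, abs_sub_comm (A _), abs_of_nonneg (by linarith)]
      exact (hmono s hs t ht h).trans (le_abs_self _)
    · rw [abs_of_nonneg (by linarith)]
      exact (hmono t ht s hs h).trans (le_abs_self _)
  have hσc : ContinuousOn σ (Icc (-(c * ρ)) (c * ρ)) := by
    refine (LipschitzOnWith.of_dist_le_mul (K := (⟨c⁻¹, by positivity⟩ : NNReal)) ?_).continuousOn
    intro u hu v hv
    have := hlip _ (hσ u hu).1 _ (hσ v hv).1
    rw [(hσ u hu).2, (hσ v hv).2] at this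
    rw [Real.dist_eq, Real.dist_eq]
    change _ ≤ c⁻¹ * _
    rw [inv_mul_eq_div, le_div_iff₀ hc0]; linarith
  have n0 : (0 : ℝ) ∈ Icc (-(c * ρ)) (c * ρ) := ⟨by nlinarith, by positivity⟩
  have hσ0 : σ 0 = 0 := by
    have := hlip _ (hσ 0 n0).1 _ m0
    rw [(hσ 0 n0).2, hA0, sub_zero, sub_zero, abs_zero] at this
    exact abs_eq_zero.1 (le_antisymm (by nlinarith [abs_nonneg (σ 0)]) (abs_nonneg _))
  set V : ℝ → ℝ := fun u => B (κ (σ u)) with hV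
  have hVd : HasDerivAt V 0 0 := by
    have h1 := hBd κ w 0 (hκd 0 m0)
    rw [crossDet_self, hasDerivAt_iff_isLittleO] at h1
    rw [hasDerivAt_iff_isLittleO]
    simp only [hV, hσ0, hB0, sub_zero, smul_zero] at h1 ⊢
    have hnear : ∀ᶠ u in 𝓝 (0 : ℝ), u ∈ Icc (-(c * ρ)) (c * ρ) :=
      Icc_mem_nhds (by nlinarith) (by positivity)
    have h2 : Tendsto σ (𝓝 0) (𝓝 0) := by
      have := hσc.continuousAt hnear
      rwa [ContinuousAt, hσ0] at this
    refine (h1.comp_tendsto h2).trans_isBigO (Asymptotics.IsBigO.of_bound c⁻¹ ?_)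
    filter_upwards [hnear] with u hu
    have := hlip _ (hσ u hu).1 _ m0
    rw [(hσ u hu).2, hA0, sub_zero, sub_zero] at this
    rw [inv_mul_eq_div, le_div_iff₀ hc0]
    simpa [mul_comm] using this
  have hball : ∀ p ∈ Metric.closedBall z (c * ρ / (2 * M.bd)), A p ∈ Icc (-(c * ρ)) (c * ρ) := by
    intro p hp
    rw [mem_closedBall_iff_norm] at hp
    refine abs_le.1 ((abs_dot_le (p - z) w).trans ?_)
    calc 2 * (‖p - z‖ * ‖w‖) ≤ 2 * (c * ρ / (2 * M.bd) * M.bd) := by gcongr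
      _ = c * ρ := by field_simp
  refine ⟨fun p => B p - V (A p), ?_, ?_, ?_, ?_⟩
  · refine hBc.continuousOn.sub (hBc.comp_continuousOn ?_)
    refine (hκ.lip.continuousOn.mono (hin.trans Ioo_subset_Icc_self)).comp
      (hσc.comp hAc.continuousOn hball) fun p hp => (hσ _ (hball p hp)).1
  · change B (κ 0) - B (κ (σ (A (κ 0)))) = 0
    rw [hA0, hσ0, sub_self]
  · intro p hp h0
    obtain ⟨h1, h2⟩ := hσ _ (hball p hp)
    refine ⟨σ (A p), Ioo_subset_Icc_self (hin h1), ?_⟩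
    have h3 : B (κ (σ (A p))) = B p := (sub_eq_zero.1 h0).symm
    set q := κ (σ (A p))
    simp only [hA, hB, crossDet, Prod.fst_sub, Prod.snd_sub] at h2 h3
    have hpos : 0 < w.1 * w.1 + w.2 * w.2 := lt_of_lt_of_le (by positivity) hww
    have e1 : (q.1 - p.1) * (w.1 * w.1 + w.2 * w.2) = 0 := by linear_combination w.1 * h2 - w.2 * h3
    have e2 : (q.2 - p.2) * (w.1 * w.1 + w.2 * w.2) = 0 := by linear_combination w.2 * h2 + w.1 * h3
    refine Prod.ext ?_ ?_
    · exact sub_eq_zero.1 ((mul_eq_zero.1 e1).resolve_right hpos.ne')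
    · exact sub_eq_zero.1 ((mul_eq_zero.1 e2).resolve_right hpos.ne')
  · intro η v t h0 hη
    have h1 := hAd η v t hη
    have h2 : HasDerivAt V 0 (A (η t)) := by rw [h0, hA0]; exact hVd
    have k := (hBd η v t hη).sub (h2.comp t h1)
    exact k.congr_deriv (by rw [zero_mul, sub_zero])

lemma pos_of_ne_zero {f : ℝ → ℝ} {a b : ℝ} (hab : a ≤ b) (hf : ContinuousOn f (Icc a b))
    (h : ∀ t ∈ Icc a b, f t ≠ 0) (ha : 0 < f a) : 0 < f b := by
  by_contra hb
  obtain ⟨t, ht, h0⟩ := intermediate_value_Icc' hab hf ⟨not_lt.1 hb, ha.le⟩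
  exact h t ht h0

/-- Complements of unions of geodesic strands are locally convex. -/
lemma exists_local_convexity (M : TorusMetric) {r : ℝ} (hr : 0 < r) : ∃ δ₀ > 0,
    ∀ δ ≤ δ₀, ∀ (O : Set (ℝ × ℝ)) (γ η : ℝ → ℝ × ℝ) (T L : ℝ), M.Lip γ 0 T → 0 ≤ T → T ≤ δ →
      (∀ t ∈ Icc 0 T, γ t ∉ O) →
      (∀ z ∈ O, M.dist (γ 0) z ≤ δ → ∃ κ, M.IsMetGeod κ (-r) r ∧ κ 0 = z ∧ κ '' Icc (-r) r ⊆ O) →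
      M.IsMetGeod η 0 L → 0 ≤ L → η 0 = γ 0 → η L = γ T → ∀ t ∈ Icc 0 L, η t ∉ O := by
  have hb := M.bd_pos
  obtain ⟨δ', hδ', hside⟩ := M.exists_side hr
  refine ⟨min r (δ' / (2 * M.bd)), lt_min hr (by positivity), ?_⟩
  intro δ hδle O γ η T L hγ hT hTδ hγO hstr hη hL h0 h1 t ht htO
  have hLT : L ≤ T := by
    have k1 := hη 0 ⟨le_rfl, hL⟩ L ⟨hL, le_rfl⟩
    have k2 := hγ 0 ⟨le_rfl, hT⟩ T ⟨hT, le_rfl⟩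
    rw [h0, h1] at k1
    rw [k1, zero_sub, zero_sub, abs_neg, abs_neg, abs_of_nonneg hL, abs_of_nonneg hT] at k2
    exact k2
  have h0O : η 0 ∉ O := h0 ▸ hγO 0 ⟨le_rfl, hT⟩
  have h1O : η L ∉ O := h1 ▸ hγO T ⟨hT, le_rfl⟩
  have ht0 : t ∈ Ioo 0 L := ⟨lt_of_le_of_ne ht.1 fun h => h0O (h ▸ htO),
    lt_of_le_of_ne ht.2 fun h => h1O (h ▸ htO)⟩
  have hdη : ∀ u ∈ Icc 0 L, M.dist (η t) (η u) ≤ δ := fun u hu => by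
    rw [hη t ht u hu]
    exact abs_le.2 ⟨by linarith [ht.1, hu.2], by linarith [ht.2, hu.1]⟩
  obtain ⟨κ, hκ, hκ0, hκO⟩ := hstr (η t) htO (by
    rw [← h0, M.dist_comm]; exact hdη 0 ⟨le_rfl, hL⟩)
  have hcr : crossDet (deriv κ 0) (deriv η t) ≠ 0 := fun h =>
    h0O (hκO (hη.mem_of_crossDet_eq_zero hκ ht0
      (by linarith [hδle.trans (min_le_left _ _)]) hκ0.symm h))
  have honly : ∀ u ∈ Icc 0 L, u ≠ t → η u ∉ κ '' Icc (-r) r := by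
    rintro u hu hne ⟨s, hs, hse⟩
    exact hcr (hη.crossDet_eq_zero_of_meet hκ ht0 hu hs hκ0.symm hse.symm hne)
  obtain ⟨f, hfc, hfκ, hf0, hfd⟩ := hside κ hκ
  have hbd : ∀ p, M.dist (η t) p ≤ 2 * δ → p ∈ Metric.closedBall (κ 0) δ' := by
    intro p hp
    rw [mem_closedBall_iff_norm, hκ0, norm_sub_rev]
    calc ‖η t - p‖ ≤ M.bd * M.dist (η t) p := M.norm_sub_le _ _
      _ ≤ M.bd * (2 * (δ' / (2 * M.bd))) := by
        gcongr; exact hp.trans (by linarith [hδle.trans (min_le_right _ _)])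
      _ = δ' := by field_simp
  have hδ0 : 0 ≤ δ := hT.trans hTδ
  have hηb : ∀ u ∈ Icc 0 L, η u ∈ Metric.closedBall (κ 0) δ' := fun u hu =>
    hbd _ ((hdη u hu).trans (by linarith))
  have hγb : ∀ u ∈ Icc 0 T, γ u ∈ Metric.closedBall (κ 0) δ' := fun u hu => by
    refine hbd _ ((M.dist_triangle _ (η 0) _).trans ?_)
    have k1 := hdη 0 ⟨le_rfl, hL⟩
    have k2 := hγ 0 ⟨le_rfl, hT⟩ u hu
    rw [zero_sub, abs_neg, abs_of_nonneg hu.1] at k2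
    rw [h0] at k1 ⊢
    linarith [hu.2]
  have hFη : ContinuousOn (fun u => f (η u)) (Icc 0 L) := hfc.comp hη.lip.continuousOn hηb
  have hFγ : ContinuousOn (fun u => f (γ u)) (Icc 0 T) := hfc.comp hγ.continuousOn hγb
  have nη : ∀ u ∈ Icc 0 L, u ≠ t → f (η u) ≠ 0 := fun u hu hne h =>
    honly u hu hne (hf0 _ (hηb u hu) h)
  have nγ : ∀ u ∈ Icc 0 T, f (γ u) ≠ 0 := fun u hu h => hγO u hu (hκO (hf0 _ (hγb u hu) h))
  have hder := hfd η (deriv η t) t hκ0.symm (hη.differentiableAt ht0).hasDerivAt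
  obtain ⟨ε, hε, hεp⟩ : ∃ ε : ℝ, ε ≠ 0 ∧ 0 < ε * f (γ 0) :=
    ⟨f (γ 0), nγ 0 ⟨le_rfl, hT⟩, mul_self_pos.2 (nγ 0 ⟨le_rfl, hT⟩)⟩
  have pT : 0 < ε * f (γ T) := pos_of_ne_zero (f := fun u => ε * f (γ u)) hT
    (continuousOn_const.mul hFγ) (fun u hu => mul_ne_zero hε (nγ u hu)) hεp
  have p0 : 0 < ε * f (η 0) := by rwa [h0]
  have pL : 0 < ε * f (η L) := by rwa [h1]
  have hFt : f (η t) = 0 := by rw [← hκ0, hfκ]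
  have hmin : IsLocalMin (fun u => ε * f (η u)) t := by
    filter_upwards [Ioo_mem_nhds ht0.1 ht0.2] with u hu
    rw [hFt, mul_zero]
    rcases lt_trichotomy u t with h | rfl | h
    · refine (pos_of_ne_zero (f := fun v => ε * f (η v)) hu.1.le ((continuousOn_const.mul hFη).mono
        (Icc_subset_Icc le_rfl hu.2.le)) (fun v hv => mul_ne_zero hε
          (nη v ⟨hv.1, hv.2.trans hu.2.le⟩ (hv.2.trans_lt h).ne)) p0).le
    · rw [hFt, mul_zero]
    · have hm : ∀ v ∈ Icc (-L) (-u), -v ∈ Icc 0 L := fun v hv =>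
        ⟨by linarith [hv.2, hu.1], by linarith [hv.1]⟩
      have hc : ContinuousOn (fun v => ε * f (η (-v))) (Icc (-L) (-u)) :=
        continuousOn_const.mul (hFη.comp continuousOn_neg hm)
      have := pos_of_ne_zero (by linarith [hu.2]) hc (fun v hv => mul_ne_zero hε
        (nη (-v) (hm v hv) (by linarith [hv.2] : t < -v).ne')) (by simpa using pL)
      simpa using this.le
  have := hmin.hasDerivAt_eq_zero (hder.const_mul ε)
  exact hcr ((mul_eq_zero.1 this).resolve_left hε)

end TorusMetric

lemma Real.mem_Icc_of_sin_nonneg {φ : ℝ → ℝ} (hφ : Continuous φ)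
    (h : ∀ t, 0 ≤ Real.sin (φ t)) (h0 : φ 0 ∈ Icc 0 Real.pi) (t : ℝ) : φ t ∈ Icc 0 Real.pi := by
  have hπ := Real.pi_pos
  by_contra hn
  have key : ∀ z, (z ∈ Ioo (-Real.pi) 0 ∨ z ∈ Ioo Real.pi (2 * Real.pi)) → z ∉ range φ := by
    rintro z hz ⟨u, rfl⟩
    have := h u
    rcases hz with hz | hz
    · linarith [Real.sin_neg_of_neg_of_neg_pi_lt hz.2 hz.1]
    · have h2 := Real.sin_pos_of_pos_of_lt_pi (x := φ u - Real.pi) (by linarith [hz.1])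
        (by linarith [hz.2])
      rw [Real.sin_sub_pi] at h2
      linarith
  have hconv : (range φ).OrdConnected := (isPreconnected_range hφ).ordConnected
  have m0 : φ 0 ∈ range φ := ⟨0, rfl⟩
  have mt : φ t ∈ range φ := ⟨t, rfl⟩
  rcases not_and_or.1 hn with hn | hn
  · push Not at hn
    refine key (max (φ t) (-Real.pi / 2)) (Or.inl ⟨?_, max_lt hn (by linarith)⟩)
      (hconv.out mt m0 ⟨le_max_left _ _, max_le (by linarith [h0.1]) (by linarith [h0.1])⟩)
    exact lt_of_lt_of_le (by linarith) (le_max_right _ _)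
  · push Not at hn
    refine key (min (φ t) (3 * Real.pi / 2)) (Or.inr ⟨lt_min hn (by linarith), ?_⟩)
      (hconv.out m0 mt ⟨le_min (by linarith [h0.2]) (by linarith [h0.2]), min_le_left _ _⟩)
    exact lt_of_le_of_lt (min_le_right _ _) (by linarith)

/-- Two paths joining opposite sides of a rectangle intersect. -/
lemma exists_eq_of_crossing {f g : ℝ → ℝ × ℝ} (hf : Continuous f) (hg : Continuous g)
    (hgx : ∀ t, (f 0).1 ≤ (g t).1 ∧ (g t).1 ≤ (f 1).1)
    (hfy : ∀ s, (g 0).2 ≤ (f s).2 ∧ (f s).2 ≤ (g 1).2) : ∃ s t, f s = g t := by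
  by_contra! hne
  have hπ := Real.pi_pos
  let H : C(ℝ × ℝ, ℂ) := ⟨fun p => ⟨(f p.1).1 - (g p.2).1, (f p.1).2 - (g p.2).2⟩, by
    have : (fun p : ℝ × ℝ => (⟨(f p.1).1 - (g p.2).1, (f p.1).2 - (g p.2).2⟩ : ℂ)) =
        fun p => (((f p.1).1 - (g p.2).1 : ℝ) : ℂ) + (((f p.1).2 - (g p.2).2 : ℝ) : ℂ) * Complex.I := by
      ext p
      exact (Complex.mk_eq_add_mul_I _ _)
    rw [this]; fun_prop⟩
  have hH : ∀ p, H p ≠ 0 := by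
    intro p h
    have h1 := congrArg Complex.re h
    have h2 := congrArg Complex.im h
    exact hne p.1 p.2 (Prod.ext (sub_eq_zero.1 h1) (sub_eq_zero.1 h2))
  obtain ⟨K, ⟨hK0, hK⟩, -⟩ := Complex.isCoveringMapOn_exp.existsUnique_continuousMap_lifts
    H (a₀ := (0, 0)) (Complex.exp_log (hH _)) hH
  have hexp : ∀ p, Complex.exp (K p) = H p := fun p => congrFun hK p
  set θ : ℝ → ℝ → ℝ := fun s t => (K (s, t)).im with hθ
  have hcos : ∀ s t, (f s).1 - (g t).1 = Real.exp (K (s, t)).re * Real.cos (θ s t) := fun s t => by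
    rw [hθ, ← Complex.exp_re, hexp]; rfl
  have hsin : ∀ s t, (f s).2 - (g t).2 = Real.exp (K (s, t)).re * Real.sin (θ s t) := fun s t => by
    rw [hθ, ← Complex.exp_im, hexp]; rfl
  have cos_nonneg : ∀ t, 0 ≤ Real.cos (θ 1 t) := fun t =>
    nonneg_of_mul_nonneg_right ((sub_nonneg.2 (hgx t).2).trans_eq (hcos 1 t)) (Real.exp_pos _)
  have cos_nonpos : ∀ t, 0 ≤ -Real.cos (θ 0 t) := fun t =>
    nonneg_of_mul_nonneg_right (by rw [mul_neg, ← hcos]; linarith [hgx t]) (Real.exp_pos _)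
  have sin_nonneg : ∀ s, 0 ≤ Real.sin (θ s 0) := fun s =>
    nonneg_of_mul_nonneg_right ((sub_nonneg.2 (hfy s).1).trans_eq (hsin s 0)) (Real.exp_pos _)
  have sin_nonpos : ∀ s, 0 ≤ -Real.sin (θ s 1) := fun s =>
    nonneg_of_mul_nonneg_right (by rw [mul_neg, ← hsin]; linarith [hfy s]) (Real.exp_pos _)
  have turn : ∀ x, x ∈ Icc 0 Real.pi → 0 ≤ Real.cos x → x + Real.pi / 2 ∈ Icc 0 Real.pi := by
    intro x hx hc
    refine ⟨by linarith [hx.1], ?_⟩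
    by_contra! h
    linarith [Real.cos_neg_of_pi_div_two_lt_of_lt (by linarith : Real.pi / 2 < x)
      (by linarith [hx.2])]
  have start : θ 0 0 ∈ Icc 0 Real.pi := by
    have h1 : θ 0 0 = (H (0, 0)).arg := by rw [hθ, ← Complex.log_im, ← hK0]
    have h2 : 0 ≤ (H (0, 0)).im := sub_nonneg.2 (hfy 0).1
    rw [h1]
    exact ⟨Complex.arg_nonneg_iff.2 h2, Complex.arg_le_pi _⟩
  have e1 := Real.mem_Icc_of_sin_nonneg (φ := fun s => θ s 0) (by fun_prop) sin_nonneg start 1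
  have e2 := Real.mem_Icc_of_sin_nonneg (φ := fun t => θ 1 t + Real.pi / 2) (by fun_prop)
    (fun t => by simpa only [Real.sin_add_pi_div_two] using cos_nonneg t)
    (turn _ e1 (cos_nonneg 0)) 1
  have e3 := Real.mem_Icc_of_sin_nonneg (φ := fun s => θ (1 - s) 1 + Real.pi / 2 + Real.pi / 2)
    (by fun_prop) (fun s => by
      simpa only [Real.sin_add_pi_div_two, Real.cos_add_pi_div_two] using sin_nonpos (1 - s))
    (by simpa only [sub_zero] using turn _ e2 (by
      simpa only [Real.cos_add_pi_div_two] using sin_nonpos 1)) 1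
  have e4 := Real.mem_Icc_of_sin_nonneg
    (φ := fun t => θ 0 (1 - t) + Real.pi / 2 + Real.pi / 2 + Real.pi / 2)
    (by fun_prop) (fun s => by
      simpa only [Real.sin_add_pi_div_two, Real.cos_add_pi_div_two] using cos_nonpos (1 - s))
    (by simpa only [sub_zero, sub_self] using turn _ e3 (by
      simpa only [Real.sin_add_pi_div_two, Real.cos_add_pi_div_two, sub_self] using cos_nonpos 1)) 1
  simp only [sub_self] at e4
  linarith [e4.2, start.1]

/-- Two path connections between opposite sides of a rectangle intersect. -/
lemma JoinedIn.inter_nonempty {F G : Set (ℝ × ℝ)} {a b c d : ℝ × ℝ} (hF : JoinedIn F a b)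
    (hG : JoinedIn G c d) (hGx : ∀ p ∈ G, a.1 ≤ p.1 ∧ p.1 ≤ b.1)
    (hFy : ∀ p ∈ F, c.2 ≤ p.2 ∧ p.2 ≤ d.2) : (F ∩ G).Nonempty := by
  obtain ⟨f, hf⟩ := hF
  obtain ⟨g, hg⟩ := hG
  have hf' : ∀ s, f.extend s ∈ F := fun s => hf _
  have hg' : ∀ s, g.extend s ∈ G := fun s => hg _
  obtain ⟨s, t, h⟩ := exists_eq_of_crossing (f := f.extend) (g := g.extend) f.continuous_extend
    g.continuous_extend (by simpa using fun t => hGx _ (hg' t)) (by simpa using fun t => hFy _ (hf' t))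
  exact ⟨_, hf' s, h ▸ hg' t⟩

namespace TorusMetric

/-- A closed geodesic in the homotopy class `(1, 0)`, lifted to the plane, that minimizes on
intervals up to its period; `low` and `high` are parameters of its lowest and highest points. -/
structure Axis (M : TorusMetric) where
  curve : ℝ → ℝ × ℝ
  period : ℝ
  low : ℝ
  high : ℝ
  period_pos : 0 < period
  curve_add : ∀ t, curve (t + period) = curve t + (1, 0)
  isLocGeod : M.IsLocGeod curve period
  low_le : ∀ t, (curve low).2 ≤ (curve t).2
  le_high : ∀ t, (curve t).2 ≤ (curve high).2

lemma exists_le_dist_add (M : TorusMetric) : ∃ x, ∀ y, M.dist x (x + (1, 0)) ≤ M.dist y (y + (1, 0)) := by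
  have hc : Continuous fun x : ℝ × ℝ => M.dist x (x + (1, 0)) :=
    M.continuous_dist.comp (f := fun x : ℝ × ℝ => (x, x + (1, 0))) (by fun_prop)
  obtain ⟨x, -, hx⟩ := (isCompact_Icc (a := (0 : ℝ × ℝ)) (b := (1, 1))).exists_isMinOn
    ⟨0, ⟨le_rfl, le_rfl⟩, ⟨zero_le_one, zero_le_one⟩⟩ hc.continuousOn
  refine ⟨x, fun y => ?_⟩
  have h1 := hx (show (Int.fract y.1, Int.fract y.2) ∈ Icc (0 : ℝ × ℝ) (1, 1) from
    ⟨⟨Int.fract_nonneg _, Int.fract_nonneg _⟩, ⟨(Int.fract_lt_one _).le, (Int.fract_lt_one _).le⟩⟩)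
  have h2 : y = (Int.fract y.1, Int.fract y.2) + lat (⌊y.1⌋, ⌊y.2⌋) := by
    ext <;> simp [lat]
  refine (show M.dist x (x + (1, 0)) ≤ _ from h1).trans_eq ?_
  conv_rhs => rw [h2, add_right_comm, M.dist_add_lat]

lemma IsLocGeod.continuous {M : TorusMetric} {γ : ℝ → ℝ × ℝ} {r : ℝ} (hr : 0 < r)
    (h : M.IsLocGeod γ r) : Continuous γ := by
  rw [continuous_iff_continuousAt]
  intro t
  exact (h.isMetGeod (a := t - r / 2) (b := t + r / 2) (by linarith)).lip.continuousOn.continuousAt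
    (Icc_mem_nhds (by linarith) (by linarith))

lemma exists_periodic_isLocGeod (M : TorusMetric) : ∃ (α : ℝ → ℝ × ℝ) (ℓ : ℝ), 0 < ℓ ∧
    (∀ t, α (t + ℓ) = α t + (1, 0)) ∧ M.IsLocGeod α ℓ := by
  obtain ⟨x, hx⟩ := M.exists_le_dist_add
  obtain ⟨η, hη, h0, h1⟩ := M.exists_isMetGeod x (x + (1, 0))
  set ℓ := M.dist x (x + (1, 0)) with hℓ
  have hpos : 0 < ℓ := lt_of_le_of_ne (M.dist_nonneg _ _) fun h => by
    have := M.eq_of_dist_eq_zero h.symm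
    have := congrArg Prod.fst this
    simp at this
  set α : ℝ → ℝ × ℝ := fun t => η (t - ⌊t / ℓ⌋ * ℓ) + lat (⌊t / ℓ⌋, 0) with hα
  have lat_succ : ∀ n : ℤ, lat (n + 1, 0) = (1, 0) + lat (n, 0) := fun n => by
    ext <;> simp [lat, add_comm]
  have hadd : ∀ t, α (t + ℓ) = α t + (1, 0) := by
    intro t
    have : ⌊(t + ℓ) / ℓ⌋ = ⌊t / ℓ⌋ + 1 := by
      rw [add_div, div_self hpos.ne', Int.floor_add_one]
    simp only [hα, this, lat_succ]
    rw [add_assoc, add_comm (lat _)]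
    congr 2
    push_cast; ring
  have hfl : ∀ t, (⌊t / ℓ⌋ : ℝ) * ℓ ≤ t ∧ t < (⌊t / ℓ⌋ + 1) * ℓ := fun t =>
    ⟨(le_div_iff₀ hpos).1 (Int.floor_le _), (div_lt_iff₀ hpos).1 (Int.lt_floor_add_one _)⟩
  have hlip : ∀ s t, s ≤ t → t ≤ s + ℓ → M.dist (α s) (α t) ≤ t - s := by
    intro s t hst hts
    have hs := hfl s
    have ht := hfl t
    have m1 : ⌊s / ℓ⌋ ≤ ⌊t / ℓ⌋ := Int.floor_mono (by gcongr)
    have m2 : ⌊t / ℓ⌋ ≤ ⌊s / ℓ⌋ + 1 := by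
      rw [← Int.floor_add_one]
      refine Int.floor_mono ?_
      rw [div_add_one hpos.ne']; gcongr
    rcases (show ⌊t / ℓ⌋ = ⌊s / ℓ⌋ ∨ ⌊t / ℓ⌋ = ⌊s / ℓ⌋ + 1 by omega) with h | h
    · simp only [hα, h, M.dist_add_lat] at ht ⊢
      rw [hη _ ⟨by linarith, by linarith⟩ _ ⟨by linarith, by linarith⟩, abs_sub_comm,
        abs_of_nonneg (by linarith)]
      linarith
    · simp only [hα, h, lat_succ]
      rw [h] at ht
      push_cast at ht ⊢
      refine (M.dist_triangle _ (η ℓ + lat (⌊s / ℓ⌋, 0)) _).trans ?_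
      have e : (1, 0) = lat (1, 0) := by simp [lat]
      rw [M.dist_add_lat, ← add_assoc, M.dist_add_lat, h1, ← h0, e, M.dist_add_lat,
        hη 0 ⟨le_rfl, hpos.le⟩ _ ⟨by linarith, by linarith⟩, h0, ← e, ← h1,
        hη _ ⟨by linarith, by linarith⟩ ℓ ⟨hpos.le, le_rfl⟩, abs_sub_comm, abs_of_nonneg (by linarith),
        abs_sub_comm, abs_of_nonneg (by linarith)]
      linarith
  refine ⟨α, ℓ, hpos, hadd, ?_⟩
  have key : ∀ s t, s ≤ t → t ≤ s + ℓ → M.dist (α s) (α t) = t - s := by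
    intro s t hst hts
    refine le_antisymm (hlip s t hst hts) ?_
    have k1 := hlip t (s + ℓ) hts (by linarith)
    have k2 := hx (α s)
    rw [← hadd] at k2
    linarith [M.dist_triangle (α s) (α t) (α (s + ℓ))]
  intro s t h
  rcases abs_le.1 h with ⟨l1, l2⟩
  rcases le_total s t with hst | hst
  · rw [key s t hst (by linarith), abs_sub_comm, abs_of_nonneg (by linarith)]
  · rw [M.dist_comm, key t s hst (by linarith), abs_of_nonneg (by linarith)]

lemma add_zsmul_of_add {α : ℝ → ℝ × ℝ} {ℓ : ℝ} (h : ∀ t, α (t + ℓ) = α t + (1, 0)) (t : ℝ)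
    (n : ℤ) : α (t + n * ℓ) = α t + ((n : ℝ), 0) := by
  induction n using Int.induction_on with
  | zero => simp
  | succ n ih =>
    rw [show t + ((n + 1 : ℤ) : ℝ) * ℓ = (t + ((n : ℤ) : ℝ) * ℓ) + ℓ by push_cast; ring, h, ih]
    ext <;> simp; ring
  | pred n ih =>
    have := h (t + ((-n - 1 : ℤ) : ℝ) * ℓ)
    rw [show t + ((-n - 1 : ℤ) : ℝ) * ℓ + ℓ = t + ((-n : ℤ) : ℝ) * ℓ by push_cast; ring, ih] at this
    rw [← sub_eq_iff_eq_add] at this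
    rw [← this]
    ext <;> simp; ring

lemma nonempty_axis (M : TorusMetric) : Nonempty M.Axis := by
  obtain ⟨α, ℓ, hℓ, hadd, hloc⟩ := M.exists_periodic_isLocGeod
  have hc := (hloc.continuous hℓ).snd
  obtain ⟨a, -, ha⟩ := (isCompact_Icc (a := 0) (b := ℓ)).exists_isMinOn ⟨0, le_rfl, hℓ.le⟩ hc.continuousOn
  obtain ⟨b, -, hb⟩ := (isCompact_Icc (a := 0) (b := ℓ)).exists_isMaxOn ⟨0, le_rfl, hℓ.le⟩ hc.continuousOn
  have key : ∀ t, ∃ s ∈ Icc 0 ℓ, (α t).2 = (α s).2 := fun t => by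
    refine ⟨t + (-⌊t / ℓ⌋ : ℤ) * ℓ, ⟨?_, ?_⟩, by rw [add_zsmul_of_add hadd]; simp⟩
    · have := (le_div_iff₀ hℓ).1 (Int.floor_le (t / ℓ))
      push_cast; linarith
    · have := (div_lt_iff₀ hℓ).1 (Int.lt_floor_add_one (t / ℓ))
      push_cast; linarith
  refine ⟨⟨α, ℓ, a, b, hℓ, hadd, hloc, fun t => ?_, fun t => ?_⟩⟩
  · obtain ⟨s, hs, e⟩ := key t
    rw [e]; exact ha hs
  · obtain ⟨s, hs, e⟩ := key t
    rw [e]; exact hb hs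

end TorusMetric

namespace TorusMetric

variable {M : TorusMetric} {O : Set (ℝ × ℝ)}

/-- `x` and `y` are joined by a `1`-Lipschitz path of duration `L` that avoids `O`. -/
def Reach (M : TorusMetric) (O : Set (ℝ × ℝ)) (x y : ℝ × ℝ) (L : ℝ) : Prop :=
  0 ≤ L ∧ ∃ γ : ℝ → ℝ × ℝ, M.Lip γ 0 L ∧ γ 0 = x ∧ γ L = y ∧ ∀ t ∈ Icc 0 L, γ t ∉ O

lemma Lip.comp_add {γ : ℝ → ℝ × ℝ} {a b : ℝ} (h : M.Lip γ a b) (τ : ℝ) :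
    M.Lip (fun t => γ (t + τ)) (a - τ) (b - τ) := fun s hs t ht => by
  have := h (s + τ) ⟨by linarith [hs.1], by linarith [hs.2]⟩ (t + τ)
    ⟨by linarith [ht.1], by linarith [ht.2]⟩
  simpa using this

lemma Lip.reach {γ : ℝ → ℝ × ℝ} {a b : ℝ} (h : M.Lip γ a b) (hab : a ≤ b)
    (hO : ∀ t ∈ Icc a b, γ t ∉ O) : M.Reach O (γ a) (γ b) (b - a) := by
  refine ⟨sub_nonneg.2 hab, fun t => γ (t + a), ?_, by simp, by simp, fun t ht =>
    hO _ ⟨by linarith [ht.1], by linarith [ht.2]⟩⟩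
  simpa using h.comp_add a

lemma Reach.symm {x y : ℝ × ℝ} {L : ℝ} (h : M.Reach O x y L) : M.Reach O y x L := by
  obtain ⟨hL, γ, hγ, h0, h1, hO⟩ := h
  refine ⟨hL, fun t => γ (L - t), fun s hs t ht => ?_, by simpa, by simpa, fun t ht =>
    hO _ ⟨by linarith [ht.2], by linarith [ht.1]⟩⟩
  refine (hγ _ ⟨by linarith [hs.2], by linarith [hs.1]⟩ _
    ⟨by linarith [ht.2], by linarith [ht.1]⟩).trans_eq ?_
  rw [sub_sub_sub_cancel_left, abs_sub_comm]

lemma Reach.trans {x y z : ℝ × ℝ} {L L' : ℝ} (h : M.Reach O x y L) (h' : M.Reach O y z L') :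
    M.Reach O x z (L + L') := by
  obtain ⟨hL, γ, hγ, h0, h1, hO⟩ := h
  obtain ⟨hL', η, hη, k0, k1, kO⟩ := h'
  set ζ : ℝ → ℝ × ℝ := fun t => if t ≤ L then γ t else η (t - L) with hζ
  have e1 : ∀ t, t ≤ L → ζ t = γ t := fun t ht => if_pos ht
  have e2 : ∀ t, L ≤ t → ζ t = η (t - L) := fun t ht => by
    rcases ht.eq_or_lt with rfl | ht
    · rw [e1 _ le_rfl, h1, sub_self, k0]
    · exact if_neg (not_le.2 ht)
  have key : ∀ s t, 0 ≤ s → s ≤ t → t ≤ L + L' → M.dist (ζ s) (ζ t) ≤ t - s := by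
    intro s t hs hst ht
    rcases le_total t L with h | h
    · rw [e1 s (hst.trans h), e1 t h]
      refine (hγ s ⟨hs, hst.trans h⟩ t ⟨hs.trans hst, h⟩).trans_eq ?_
      rw [abs_sub_comm, abs_of_nonneg (by linarith)]
    rcases le_total s L with h' | h'
    · refine (M.dist_triangle _ (ζ L) _).trans ?_
      have l1 := hγ s ⟨hs, h'⟩ L ⟨hL, le_rfl⟩
      have l2 := hη 0 ⟨le_rfl, hL'⟩ (t - L) ⟨by linarith, by linarith⟩
      rw [abs_sub_comm, abs_of_nonneg (by linarith)] at l1 l2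
      rw [e1 s h', e1 L le_rfl, e2 t h]
      rw [k0, ← h1] at l2
      linarith
    · rw [e2 s h', e2 t h]
      refine (hη _ ⟨by linarith, by linarith⟩ _ ⟨by linarith, by linarith⟩).trans_eq ?_
      rw [abs_sub_comm, abs_of_nonneg (by linarith)]
      ring
  refine ⟨by linarith, ζ, fun s hs t ht => ?_, by rw [e1 0 hL, h0], ?_, fun t ht => ?_⟩
  · rcases le_total s t with h | h
    · rw [abs_sub_comm, abs_of_nonneg (by linarith)]
      exact key s t hs.1 h ht.2
    · rw [abs_of_nonneg (by linarith), M.dist_comm]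
      exact key t s ht.1 h hs.2
  · rw [e2 _ (by linarith), add_sub_cancel_left, k1]
  · rcases le_total t L with h | h
    · rw [e1 t h]; exact hO t ⟨ht.1, h⟩
    · rw [e2 t h]; exact kO _ ⟨by linarith, by linarith [ht.2]⟩

lemma reach_of_segment (M : TorusMetric) {x y : ℝ × ℝ} (h : ∀ z ∈ segment ℝ x y, z ∉ O) :
    M.Reach O x y (M.bd * ‖y - x‖) := by
  have hb := M.bd_pos
  set L := M.bd * ‖y - x‖ with hL
  have hL0 : 0 ≤ L := by positivity
  refine ⟨hL0, fun t => x + (t / L) • (y - x), fun s _ t _ => ?_, by simp, ?_, fun t ht => h _ ?_⟩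
  · refine (M.dist_le _ _).trans ?_
    rw [add_sub_add_left_eq_sub, ← sub_smul, norm_smul, ← sub_div, norm_div, Real.norm_eq_abs,
      Real.norm_eq_abs, abs_of_nonneg hL0]
    calc M.bd * (|s - t| / L * ‖y - x‖) = |s - t| * (L / L) := by rw [hL]; ring
      _ ≤ |s - t| := mul_le_of_le_one_right (abs_nonneg _) (div_self_le_one _)
  · rcases eq_or_ne L 0 with h0 | h0
    · have : y - x = 0 := norm_eq_zero.1 ((mul_eq_zero.1 (hL.symm.trans h0)).resolve_left hb.ne')
      simp [(sub_eq_zero.1 this)]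
    · simp [div_self h0]
  · rw [segment_eq_image']
    exact ⟨t / L, ⟨div_nonneg ht.1 hL0, div_le_one_of_le₀ ht.2 hL0⟩, rfl⟩

/-- Up to an error `e`, each segment of `γ` has the shortest duration among the paths
that avoid `O`. -/
structure NearMin (M : TorusMetric) (O : Set (ℝ × ℝ)) (γ : ℝ → ℝ × ℝ) (a b e : ℝ) : Prop where
  lip : M.Lip γ a b
  notMem : ∀ t ∈ Icc a b, γ t ∉ O
  sub_le : ∀ s ∈ Icc a b, ∀ t ∈ Icc a b, ∀ L, M.Reach O (γ s) (γ t) L → |t - s| ≤ L + e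

lemma NearMin.comp_add {γ : ℝ → ℝ × ℝ} {a b e : ℝ} (h : M.NearMin O γ a b e) (τ : ℝ) :
    M.NearMin O (fun t => γ (t + τ)) (a - τ) (b - τ) e := by
  have hm : ∀ t ∈ Icc (a - τ) (b - τ), t + τ ∈ Icc a b := fun t ht =>
    ⟨by linarith [ht.1], by linarith [ht.2]⟩
  refine ⟨h.lip.comp_add τ, fun t ht => h.notMem _ (hm t ht), fun s hs t ht L hL => ?_⟩
  simpa using h.sub_le _ (hm s hs) _ (hm t ht) L hL

lemma NearMin.mono {γ : ℝ → ℝ × ℝ} {a b a' b' e e' : ℝ} (h : M.NearMin O γ a b e) (ha : a ≤ a')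
    (hb : b' ≤ b) (he : e ≤ e') : M.NearMin O γ a' b' e' := by
  have hm : ∀ t ∈ Icc a' b', t ∈ Icc a b := fun t ht => ⟨ha.trans ht.1, ht.2.trans hb⟩
  exact ⟨h.lip.mono ha hb, fun t ht => h.notMem _ (hm t ht), fun s hs t ht L hL =>
    (h.sub_le _ (hm s hs) _ (hm t ht) L hL).trans (by linarith)⟩

lemma Reach.exists_nearMin {x y : ℝ × ℝ} {L : ℝ} (h : M.Reach O x y L) {e : ℝ} (he : 0 < e) :
    ∃ γ L', 0 ≤ L' ∧ γ 0 = x ∧ γ L' = y ∧ M.NearMin O γ 0 L' e := by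
  obtain ⟨L', hL', hlt⟩ := Real.lt_sInf_add_pos (s := {L | M.Reach O x y L}) ⟨L, h⟩ he
  have hbdd : BddBelow {L | M.Reach O x y L} := ⟨0, fun L hL => hL.1⟩
  obtain ⟨h0, γ, hγ, e0, e1, hO⟩ := id hL'
  have key : ∀ s t, 0 ≤ s → s ≤ t → t ≤ L' → ∀ K, M.Reach O (γ s) (γ t) K → t - s ≤ K + e := by
    intro s t hs hst ht K hK
    have r1 := (hγ.mono le_rfl (hst.trans ht)).reach hs fun u hu => hO u ⟨hu.1, hu.2.trans (hst.trans ht)⟩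
    have r2 := (hγ.mono (hs.trans hst) le_rfl).reach ht fun u hu => hO u ⟨(hs.trans hst).trans hu.1, hu.2⟩
    rw [e0] at r1
    rw [e1] at r2
    linarith [csInf_le hbdd ((r1.trans hK).trans r2)]
  refine ⟨γ, L', h0, e0, e1, hγ, hO, fun s hs t ht K hK => ?_⟩
  rcases le_total s t with h | h
  · rw [abs_of_nonneg (by linarith)]
    exact key s t hs.1 h ht.2 K hK
  · rw [abs_sub_comm, abs_of_nonneg (by linarith)]
    exact key t s ht.1 h hs.2 K hK.symm

/-- Each point of `O` of height in `[lo, hi]` is the middle of a minimal geodesic of length `2 * r`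
contained in `O`. -/
def Stranded (M : TorusMetric) (O : Set (ℝ × ℝ)) (r lo hi : ℝ) : Prop :=
  ∀ z ∈ O, lo ≤ z.2 → z.2 ≤ hi → ∃ κ, M.IsMetGeod κ (-r) r ∧ κ 0 = z ∧ κ '' Icc (-r) r ⊆ O

lemma Stranded.mono {r r' lo hi : ℝ} (h : M.Stranded O r lo hi) (hr : r' ≤ r) :
    M.Stranded O r' lo hi := fun z hz h1 h2 => by
  obtain ⟨κ, hκ, h0, hO⟩ := h z hz h1 h2
  exact ⟨κ, hκ.mono (by linarith) hr, h0, (image_mono (Icc_subset_Icc (by linarith) hr)).trans hO⟩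

lemma Stranded.iUnion {ι : Sort*} {O : ι → Set (ℝ × ℝ)} {r lo hi : ℝ}
    (h : ∀ i, M.Stranded (O i) r lo hi) : M.Stranded (⋃ i, O i) r lo hi := fun z hz h1 h2 => by
  obtain ⟨i, hi⟩ := mem_iUnion.1 hz
  obtain ⟨κ, hκ, h0, hO⟩ := h i z hi h1 h2
  exact ⟨κ, hκ, h0, hO.trans (subset_iUnion O i)⟩

lemma Stranded.union {O' : Set (ℝ × ℝ)} {r lo hi : ℝ}
    (h : M.Stranded O r lo hi) (h' : M.Stranded O' r lo hi) : M.Stranded (O ∪ O') r lo hi := by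
  rw [union_eq_iUnion]
  exact Stranded.iUnion fun b => by cases b <;> assumption

lemma IsMetGeod.add_lat {γ : ℝ → ℝ × ℝ} {a b : ℝ} (h : M.IsMetGeod γ a b) (k : ℤ × ℤ) :
    M.IsMetGeod (fun t => γ t + lat k) a b := fun s hs t ht => by
  rw [M.dist_add_lat]; exact h s hs t ht

lemma Stranded.image_add_lat {r lo hi : ℝ} (h : M.Stranded O r lo hi) (k : ℤ) :
    M.Stranded ((fun z => z + lat (k, 0)) '' O) r lo hi := by
  rintro _ ⟨z, hz, rfl⟩ h1 h2
  have e : (z + lat (k, 0)).2 = z.2 := by simp [lat]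
  rw [e] at h1 h2
  obtain ⟨κ, hκ, h0, hO⟩ := h z hz h1 h2
  refine ⟨_, hκ.add_lat (k, 0), by rw [h0], ?_⟩
  rintro _ ⟨t, ht, rfl⟩
  exact ⟨κ t, hO ⟨t, ht, rfl⟩, rfl⟩

lemma exists_sub_le_dist_add (M : TorusMetric) {r : ℝ} (hr : 0 < r) : ∃ δ > 0,
    ∀ (O : Set (ℝ × ℝ)) (lo hi : ℝ) (γ : ℝ → ℝ × ℝ) (a b e : ℝ), M.Stranded O r (lo - 1) (hi + 1) →
      M.NearMin O γ a b e → (∀ t ∈ Icc a b, lo ≤ (γ t).2 ∧ (γ t).2 ≤ hi) →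
      ∀ s ∈ Icc a b, ∀ t ∈ Icc a b, s ≤ t → t - s ≤ δ → t - s ≤ M.dist (γ s) (γ t) + e := by
  have hb := M.bd_pos
  obtain ⟨δ, hδ, H⟩ := M.exists_local_convexity hr
  refine ⟨min δ (1 / M.bd), lt_min hδ (by positivity), ?_⟩
  intro O lo hi γ a b e hO hγ hy s hs t ht hst hle
  obtain ⟨η, hη, h0, h1⟩ := M.exists_isMetGeod (γ s) (γ t)
  set D := M.dist (γ s) (γ t)
  have hD0 : 0 ≤ D := M.dist_nonneg _ _
  have hDle : D ≤ t - s := by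
    have := hγ.lip s hs t ht
    rwa [abs_sub_comm, abs_of_nonneg (by linarith)] at this
  have hlip : M.Lip (fun u => γ (u + s)) 0 (t - s) := by
    simpa using (hγ.lip.mono hs.1 ht.2).comp_add s
  have hη' : ∀ u ∈ Icc 0 D, η u ∉ O := by
    refine H _ (min_le_left _ (1 / M.bd)) O (fun u => γ (u + s)) η (t - s) D hlip (by linarith) hle
      (fun u hu => hγ.notMem _ ⟨by linarith [hs.1, hu.1], by linarith [ht.2, hu.2]⟩) ?_ hη hD0
      (by simp [h0]) (by simp [h1])
    intro z hz hd
    have k1 : ‖γ s - z‖ ≤ 1 := by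
      refine (M.norm_sub_le _ _).trans ?_
      rw [zero_add] at hd
      calc M.bd * M.dist (γ s) z ≤ M.bd * (1 / M.bd) := by
            gcongr; exact hd.trans (min_le_right _ _)
        _ = 1 := by field_simp
    have k2 := abs_le.1 ((norm_snd_le (γ s - z)).trans k1)
    rw [Prod.snd_sub] at k2
    exact hO z hz (by linarith [(hy s hs).1, k2.2]) (by linarith [(hy s hs).2, k2.1])
  have := hγ.sub_le s hs t ht D ⟨hD0, η, hη.lip, h0, h1, hη'⟩
  rwa [abs_of_nonneg (by linarith)] at this

/-- Near minimal paths avoiding a stranded set converge to geodesics. -/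
lemma exists_isLocGeod_limit (M : TorusMetric) {r : ℝ} (hr : 0 < r) : ∃ δ > 0,
    ∀ (O : Set (ℝ × ℝ)) (lo hi R : ℝ) (γ : ℕ → ℝ → ℝ × ℝ) (a b e : ℕ → ℝ),
      M.Stranded O r (lo - 1) (hi + 1) → (∀ n, M.NearMin O (γ n) (a n) (b n) (e n)) →
      (∀ n, ∀ t ∈ Icc (a n) (b n), lo ≤ (γ n t).2 ∧ (γ n t).2 ≤ hi) → (∀ n, ‖γ n 0‖ ≤ R) →
      Tendsto a atTop atBot → Tendsto b atTop atTop → Tendsto e atTop (𝓝 0) →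
      ∃ γ' : ℝ → ℝ × ℝ, M.IsLocGeod γ' δ ∧
        ∀ t, Tendsto (fun n => γ n t) (hyperfilter ℕ) (𝓝 (γ' t)) := by
  obtain ⟨δ, hδ, H⟩ := M.exists_sub_le_dist_add hr
  refine ⟨δ, hδ, fun O lo hi R γ a b e hO hγ hy hR ha hb he => ?_⟩
  have hmem : ∀ t, ∀ᶠ n in atTop, t ∈ Icc (a n) (b n) := fun t =>
    ((ha.eventually_le_atBot t).and (hb.eventually_ge_atTop t)).mono fun n h => h
  obtain ⟨γ', h⟩ := exists_ultralimit (γ := γ) (S := univ) fun t _ => by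
    refine ⟨R + M.bd * |t|, ?_⟩
    filter_upwards [hmem t, hmem 0] with n ht h0
    have k1 := M.norm_sub_le (γ n t) (γ n 0)
    have k2 := (hγ n).lip t ht 0 h0
    rw [sub_zero] at k2
    have k3 := norm_le_norm_add_norm_sub' (γ n t) (γ n 0)
    have k4 := mul_le_mul_of_nonneg_left k2 M.bd_pos.le
    linarith [hR n]
  have hle : (hyperfilter ℕ : Filter ℕ) ≤ atTop := Nat.hyperfilter_le_atTop
  refine ⟨γ', ?_, fun t => h t trivial⟩
  have hlim : ∀ s t, Tendsto (fun n => M.dist (γ n s) (γ n t)) (hyperfilter ℕ)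
      (𝓝 (M.dist (γ' s) (γ' t))) := fun s t => M.tendsto_dist (h s trivial) (h t trivial)
  have key : ∀ s t, s ≤ t → t - s ≤ δ → M.dist (γ' s) (γ' t) = t - s := by
    intro s t hst hts
    refine le_antisymm (le_of_tendsto (hlim s t) (hle ?_)) ?_
    · filter_upwards [hmem s, hmem t] with n hs ht
      have := (hγ n).lip s hs t ht
      rwa [abs_sub_comm, abs_of_nonneg (by linarith)] at this
    · have h2 := (hlim s t).add (he.mono_left hle)
      rw [add_zero] at h2
      refine ge_of_tendsto h2 (hle ?_)
      filter_upwards [hmem s, hmem t] with n hs ht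
      exact H O lo hi (γ n) (a n) (b n) (e n) hO (hγ n) (hy n) s hs t ht hst hts
  intro s t hst
  rcases abs_le.1 hst with ⟨l1, l2⟩
  rcases le_total s t with h | h
  · rw [key s t h (by linarith), abs_sub_comm, abs_of_nonneg (by linarith)]
  · rw [M.dist_comm, key t s h (by linarith), abs_of_nonneg (by linarith)]

lemma eventually_forall_norm_sub_le {l : Filter ℕ} {γ : ℕ → ℝ → ℝ × ℝ} {γ' : ℝ → ℝ × ℝ} {a b : ℝ}
    (hγ : ∀ᶠ n in l, M.Lip (γ n) a b) (hγ' : M.Lip γ' a b)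
    (h : ∀ t ∈ Icc a b, Tendsto (fun n => γ n t) l (𝓝 (γ' t))) {ε : ℝ} (hε : 0 < ε) :
    ∀ᶠ n in l, ∀ t ∈ Icc a b, ‖γ n t - γ' t‖ ≤ ε := by
  have hb := M.bd_pos
  obtain ⟨S, hS, hfin, hcov⟩ := Metric.finite_approx_of_totallyBounded
    (isCompact_Icc (a := a) (b := b)).totallyBounded (ε / (3 * M.bd)) (by positivity)
  have hev : ∀ᶠ n in l, ∀ s ∈ S, ‖γ n s - γ' s‖ < ε / 3 := by
    rw [eventually_all_finite hfin]
    intro s hs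
    have := (tendsto_iff_norm_sub_tendsto_zero.1 (h s (hS hs)))
    exact this.eventually_lt_const (by positivity)
  filter_upwards [hev, hγ] with n hn hlip t ht
  obtain ⟨s, hs, hst⟩ := mem_iUnion₂.1 (hcov ht)
  rw [Metric.mem_ball, Real.dist_eq] at hst
  have key : ∀ η : ℝ → ℝ × ℝ, M.Lip η a b → ‖η t - η s‖ ≤ ε / 3 := fun η hη => by
    refine (M.norm_sub_le _ _).trans ?_
    calc M.bd * M.dist (η t) (η s) ≤ M.bd * (ε / (3 * M.bd)) := by
          gcongr; exact (hη t ht s (hS hs)).trans hst.le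
      _ = ε / 3 := by field_simp
  have k1 := key _ hlip
  have k2 := key _ hγ'
  have k3 := hn s hs
  have e : γ n t - γ' t = (γ n t - γ n s) + (γ n s - γ' s) - (γ' t - γ' s) := by abel
  rw [e]
  refine (_root_.norm_sub_le _ _).trans ?_
  linarith [norm_add_le (γ n t - γ n s) (γ n s - γ' s)]

end TorusMetric

lemma ContinuousOn.joinedIn_image {γ : ℝ → ℝ × ℝ} {s t : ℝ} (h : ContinuousOn γ (uIcc s t)) :
    JoinedIn (γ '' uIcc s t) (γ s) (γ t) :=
  (((convex_uIcc s t).isPathConnected ⟨s, left_mem_uIcc⟩).image' h).joinedIn _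
    (mem_image_of_mem γ left_mem_uIcc) _ (mem_image_of_mem γ right_mem_uIcc)

lemma joinedIn_segment (x y : ℝ × ℝ) : JoinedIn (segment ℝ x y) x y :=
  ((convex_segment x y).isPathConnected ⟨x, left_mem_segment ℝ x y⟩).joinedIn _
    (left_mem_segment ℝ x y) _ (right_mem_segment ℝ x y)

lemma JoinedIn.exists_abs_fst_le {S : Set (ℝ × ℝ)} {p q : ℝ × ℝ} (h : JoinedIn S p q) :
    ∃ R, JoinedIn (S ∩ {z | |z.1| ≤ R}) p q := by
  obtain ⟨f, hf⟩ := h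
  obtain ⟨R, hR⟩ := (isCompact_range f.continuous).exists_bound_of_continuousOn
    (f := fun z : ℝ × ℝ => z.1) continuous_fst.continuousOn
  exact ⟨R, f, fun t => ⟨hf t, hR _ ⟨t, rfl⟩⟩⟩

namespace TorusMetric

variable {M : TorusMetric}

lemma Lip.continuousOn_uIcc {γ : ℝ → ℝ × ℝ} {a b s t : ℝ} (h : M.Lip γ a b) (hs : s ∈ Icc a b)
    (ht : t ∈ Icc a b) : ContinuousOn γ (uIcc s t) :=
  h.continuousOn.mono (uIcc_subset_Icc hs ht)

namespace Axis

/-- The translate of an axis by a vertical lattice vector. -/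
def shift (α : M.Axis) (m : ℤ) : M.Axis where
  curve t := α.curve t + lat (0, m)
  period := α.period
  low := α.low
  high := α.high
  period_pos := α.period_pos
  curve_add t := by rw [α.curve_add]; abel
  isLocGeod s t h := by rw [M.dist_add_lat]; exact α.isLocGeod s t h
  low_le t := add_le_add_left (α.low_le t) _
  le_high t := add_le_add_left (α.le_high t) _

variable (α : M.Axis)

lemma continuous : Continuous α.curve := α.isLocGeod.continuous α.period_pos

lemma exists_abs_sub_le : ∃ K, ∀ t, |(α.curve t).1 - t / α.period| ≤ K := by
  have hℓ := α.period_pos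
  have hp : Function.Periodic (fun t => (α.curve t).1 - t / α.period) α.period := fun t => by
    simp only [α.curve_add, add_div, div_self hℓ.ne', Prod.fst_add]; ring
  obtain ⟨K, hK⟩ := isBounded_iff_forall_norm_le.1 (hp.isBounded_of_continuous hℓ.ne'
    (α.continuous.fst.sub (continuous_id.div_const _)))
  exact ⟨K, fun t => hK _ ⟨t, rfl⟩⟩

lemma exists_lt_fst (x : ℝ) : ∃ t, x < (α.curve t).1 := by
  obtain ⟨K, hK⟩ := α.exists_abs_sub_le
  refine ⟨(x + K + 1) * α.period, ?_⟩
  have := (abs_le.1 (hK ((x + K + 1) * α.period))).1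
  rw [mul_div_cancel_right₀ _ α.period_pos.ne'] at this
  linarith

lemma exists_fst_lt (x : ℝ) : ∃ t, (α.curve t).1 < x := by
  obtain ⟨K, hK⟩ := α.exists_abs_sub_le
  refine ⟨(x - K - 1) * α.period, ?_⟩
  have := (abs_le.1 (hK ((x - K - 1) * α.period))).2
  rw [mul_div_cancel_right₀ _ α.period_pos.ne'] at this
  linarith

lemma nonempty_fiber (x : ℝ) : {t | (α.curve t).1 = x}.Nonempty := by
  obtain ⟨s, hs⟩ := α.exists_fst_lt x
  obtain ⟨t, ht⟩ := α.exists_lt_fst x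
  exact mem_range_of_exists_le_of_exists_ge α.continuous.fst ⟨s, hs.le⟩ ⟨t, ht.le⟩

lemma isCompact_fiber (x : ℝ) : IsCompact {t | (α.curve t).1 = x} := by
  obtain ⟨K, hK⟩ := α.exists_abs_sub_le
  refine (isCompact_Icc (a := (x - K) * α.period) (b := (x + K) * α.period)).of_isClosed_subset
    (isClosed_eq α.continuous.fst continuous_const) fun t (ht : _ = x) => ?_
  have := abs_le.1 (hK t)
  rw [ht] at this
  exact ⟨(le_div_iff₀ α.period_pos).1 (by linarith), (div_le_iff₀ α.period_pos).1 (by linarith)⟩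

lemma exists_highest (x : ℝ) : ∃ t, (α.curve t).1 = x ∧
    ∀ s, (α.curve s).1 = x → (α.curve s).2 ≤ (α.curve t).2 := by
  obtain ⟨t, ht, h⟩ := (α.isCompact_fiber x).exists_isMaxOn (α.nonempty_fiber x)
    α.continuous.snd.continuousOn
  exact ⟨t, ht, fun s hs => h hs⟩

lemma exists_lowest (x : ℝ) : ∃ t, (α.curve t).1 = x ∧
    ∀ s, (α.curve s).1 = x → (α.curve t).2 ≤ (α.curve s).2 := by
  obtain ⟨t, ht, h⟩ := (α.isCompact_fiber x).exists_isMinOn (α.nonempty_fiber x)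
    α.continuous.snd.continuousOn
  exact ⟨t, ht, fun s hs => h hs⟩

/-- An axis separates the plane. -/
lemma inter_range_nonempty {S : Set (ℝ × ℝ)} {p q : ℝ × ℝ} (h : JoinedIn S p q)
    (hp : p.2 ≤ (α.curve α.low).2) (hq : (α.curve α.high).2 ≤ q.2) :
    (S ∩ range α.curve).Nonempty := by
  obtain ⟨R, hR⟩ := h.exists_abs_fst_le
  obtain ⟨s, hs⟩ := α.exists_fst_lt (-R)
  obtain ⟨t, ht⟩ := α.exists_lt_fst R
  obtain ⟨z, ⟨u, -, rfl⟩, hz, -⟩ := JoinedIn.inter_nonempty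
    (α.continuous.continuousOn.joinedIn_image (s := s) (t := t)) hR
    (fun z hz => by
      have := abs_le.1 (show |z.1| ≤ R from hz.2)
      exact ⟨by linarith, by linarith⟩)
    (by rintro _ ⟨u, -, rfl⟩; exact ⟨hp.trans (α.low_le u), (α.le_high u).trans hq⟩)
  exact ⟨_, hz, mem_range_self u⟩

lemma joinedIn (t s : ℝ) : ∃ s', (α.curve s').2 = (α.curve s).2 ∧
    JoinedIn (range α.curve ∩ {z | |z.1 - (α.curve t).1| ≤ M.bd * α.period})
      (α.curve t) (α.curve s') := by
  have hℓ := α.period_pos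
  set n := ⌊(t - s) / α.period⌋
  have h1 := (le_div_iff₀ hℓ).1 (Int.floor_le ((t - s) / α.period))
  have h2 := (div_lt_iff₀ hℓ).1 (Int.lt_floor_add_one ((t - s) / α.period))
  refine ⟨s + n * α.period, by rw [add_zsmul_of_add α.curve_add]; simp, ?_⟩
  refine α.continuous.continuousOn.joinedIn_image.mono ?_
  rintro _ ⟨u, hu, rfl⟩
  rw [uIcc_of_ge (by linarith)] at hu
  have hut : |u - t| ≤ α.period := abs_le.2 ⟨by linarith [hu.1], by linarith [hu.2]⟩
  refine ⟨mem_range_self u, ?_⟩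
  have := (norm_fst_le (α.curve u - α.curve t)).trans (M.norm_sub_le _ _)
  rw [α.isLocGeod u t hut] at this
  exact this.trans (mul_le_mul_of_nonneg_left hut M.bd_pos.le)

end Axis

end TorusMetric

namespace TorusMetric

variable {M : TorusMetric} {O : Set (ℝ × ℝ)}

lemma Reach.of_le {x y : ℝ × ℝ} {L L' : ℝ} (h : M.Reach O x y L) (hL : L ≤ L') :
    M.Reach O x y L' := by
  obtain ⟨hL0, γ, -, -, h1, hO⟩ := id h
  have : M.Reach O y y (L' - L) := ⟨sub_nonneg.2 hL, fun _ => y,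
    fun s _ t _ => by rw [M.dist_self]; exact abs_nonneg _, rfl, rfl,
    fun t _ => h1 ▸ hO L ⟨hL0, le_rfl⟩⟩
  simpa using h.trans this

lemma reach_vertical (M : TorusMetric) {x y y' L : ℝ} (h : ∀ u ∈ uIcc y y', (x, u) ∉ O)
    (hL : |y' - y| ≤ L) : M.Reach O (x, y) (x, y') (M.bd * L) := by
  refine (M.reach_of_segment (fun z hz => ?_)).of_le (mul_le_mul_of_nonneg_left ?_ M.bd_pos.le)
  · obtain ⟨h1, h2⟩ := ((convex_singleton x).prod (convex_uIcc y y')).segment_subset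
      (x := (x, y)) (y := (x, y')) ⟨rfl, left_mem_uIcc⟩ ⟨rfl, right_mem_uIcc⟩ hz
    exact (Prod.ext h1 rfl : z = (x, z.2)) ▸ h _ h2
  · simpa [Prod.norm_def] using hL

lemma reach_horizontal (M : TorusMetric) {x x' y L : ℝ} (h : ∀ u ∈ uIcc x x', (u, y) ∉ O)
    (hL : |x' - x| ≤ L) : M.Reach O (x, y) (x', y) (M.bd * L) := by
  refine (M.reach_of_segment (fun z hz => ?_)).of_le (mul_le_mul_of_nonneg_left ?_ M.bd_pos.le)
  · obtain ⟨h1, h2⟩ := ((convex_uIcc x x').prod (convex_singleton y)).segment_subset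
      (x := (x, y)) (y := (x', y)) ⟨left_mem_uIcc, rfl⟩ ⟨right_mem_uIcc, rfl⟩ hz
    exact (Prod.ext rfl h2 : z = (z.1, y)) ▸ h _ h1
  · simpa [Prod.norm_def] using hL

lemma Axis.stranded (α : M.Axis) (lo hi : ℝ) :
    M.Stranded (range α.curve) (α.period / 2) lo hi := by
  rintro _ ⟨t, rfl⟩ - -
  refine ⟨fun s => α.curve (s + t), fun s hs u hu => ?_, by simp, ?_⟩
  · rw [α.isLocGeod _ _ (by
      rw [add_sub_add_right_eq_sub]
      exact abs_le.2 ⟨by linarith [hs.1, hu.2], by linarith [hs.2, hu.1]⟩), add_sub_add_right_eq_sub]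
  · rintro _ ⟨s, -, rfl⟩
    exact mem_range_self _

/-- A strip bounded by two translates of a minimal axis, together with a set `U` that can be used
as an obstacle attached to the bottom and a set `D` that can be used as an obstacle attached to
the top of the strip. -/
structure Board (M : TorusMetric) where
  α : M.Axis
  (A h r : ℝ)
  (m X : ℤ)
  (U D : Set (ℝ × ℝ))
  (low tip top bot : ℝ × ℝ)
  r_pos : 0 < r
  abs_snd_le : ∀ t, |(α.curve t).2| ≤ A
  period_le : M.bd * α.period ≤ X
  le_m : 2 * A + 5 + M.bd * (M.bd * (4 * A + 5) + 1) ≤ m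
  lt_h : m - A - 2 < h
  h_le : h ≤ m - A - 1
  abs_le_of_mem_U : ∀ z ∈ U, |z.1| ≤ X
  snd_le_of_mem_U : ∀ z ∈ U, z.2 ≤ h
  joinedIn_U : JoinedIn U low tip
  low_snd : low.2 ≤ -A
  tip_snd : tip.2 = h
  abs_le_of_mem_D : ∀ z ∈ D, |z.1| ≤ X
  le_snd_of_mem_D : ∀ z ∈ D, A + 1 ≤ z.2
  joinedIn_D : JoinedIn D bot top
  bot_snd : bot.2 ≤ A + 2
  top_snd : m + A ≤ top.2
  stranded_U : M.Stranded U r (-A - 1) (m + A + 1)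
  stranded_D : M.Stranded D r (-A - 1) (m + A + 1)

namespace Board

variable (B : M.Board)

/-- The width of a column of the board. -/
def N : ℤ := 8 * B.X + 8

/-- The obstacles of the column `k` are translates of `U` if `k ∈ σ` and is a translate of `D`
otherwise. -/
def obstacle (σ : Set ℤ) : Set (ℝ × ℝ) :=
  (range B.α.curve ∪ range (B.α.shift B.m).curve) ∪
    ((⋃ k ∈ σ, ⋃ i ∈ Icc (2 * B.X + 2) (6 * B.X + 4), (fun z => z + lat (k * B.N + i, 0)) '' B.U) ∪
      ⋃ k ∉ σ, (fun z => z + lat (k * B.N + (4 * B.X + 3), 0)) '' B.D)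

lemma A_nonneg : 0 ≤ B.A := (abs_nonneg _).trans (B.abs_snd_le 0)

lemma X_nonneg : (0 : ℝ) ≤ B.X := (by have := M.bd_pos; have := B.α.period_pos; positivity :
  0 ≤ M.bd * B.α.period).trans B.period_le

lemma cast_N : (B.N : ℝ) = 8 * B.X + 8 := by simp [N]

lemma N_pos : (0 : ℝ) < B.N := by rw [cast_N]; linarith [B.X_nonneg]

lemma le_m' : 2 * B.A + 6 ≤ B.m := by
  have := B.A_nonneg
  have := M.one_le_bd
  have := B.le_m
  nlinarith [mul_nonneg M.bd_pos.le (mul_nonneg M.bd_pos.le (by linarith : 0 ≤ 4 * B.A + 5))]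

lemma stranded (σ : Set ℤ) : M.Stranded (B.obstacle σ) (min B.r (B.α.period / 2))
    (-B.A - 1) (B.m + B.A + 1) := by
  refine .union (.union ?_ ?_) (.union ?_ ?_)
  · exact (B.α.stranded _ _).mono (min_le_right _ _)
  · exact ((B.α.shift B.m).stranded _ _).mono (min_le_right _ _)
  · exact .iUnion fun k => .iUnion fun _ => .iUnion fun i => .iUnion fun _ =>
      (B.stranded_U.mono (min_le_left _ _)).image_add_lat _
  · exact .iUnion fun k => .iUnion fun _ => (B.stranded_D.mono (min_le_left _ _)).image_add_lat _

lemma curve_mem_obstacle (σ : Set ℤ) (t : ℝ) : B.α.curve t ∈ B.obstacle σ := .inl (.inl ⟨t, rfl⟩)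

lemma shift_curve_mem_obstacle (σ : Set ℤ) (t : ℝ) :
    (B.α.shift B.m).curve t ∈ B.obstacle σ := .inl (.inr ⟨t, rfl⟩)

lemma U_mem_obstacle {σ : Set ℤ} {k i : ℤ} (hk : k ∈ σ) (h1 : 2 * B.X + 2 ≤ i)
    (h2 : i ≤ 6 * B.X + 4) {z : ℝ × ℝ} (hz : z ∈ B.U) :
    z + lat (k * B.N + i, 0) ∈ B.obstacle σ :=
  .inr (.inl (mem_iUnion₂.2 ⟨k, hk, mem_iUnion₂.2 ⟨i, ⟨h1, h2⟩, z, hz, rfl⟩⟩))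

lemma D_mem_obstacle {σ : Set ℤ} {k : ℤ} (hk : k ∉ σ) {z : ℝ × ℝ} (hz : z ∈ B.D) :
    z + lat (k * B.N + (4 * B.X + 3), 0) ∈ B.obstacle σ :=
  .inr (.inr (mem_iUnion₂.2 ⟨k, hk, z, hz, rfl⟩))

lemma shift_snd (t : ℝ) : ((B.α.shift B.m).curve t).2 = (B.α.curve t).2 + B.m := by
  simp [Axis.shift, lat]

lemma shift_fst (t : ℝ) : ((B.α.shift B.m).curve t).1 = (B.α.curve t).1 := by
  simp [Axis.shift, lat]

/-- `z` lies strictly between the two axes on its vertical line. -/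
def Between (z : ℝ × ℝ) : Prop :=
  ∀ t, (B.α.curve t).1 = z.1 → (B.α.curve t).2 < z.2 ∧ z.2 < (B.α.curve t).2 + B.m

lemma between_of_lt {z : ℝ × ℝ} (h1 : B.A < z.2) (h2 : z.2 < B.m - B.A) : B.Between z := fun t _ => by
  have := abs_le.1 (B.abs_snd_le t)
  exact ⟨by linarith, by linarith⟩

variable {B}

lemma Between.uIcc {x y y' u : ℝ} (h : B.Between (x, y)) (h' : B.Between (x, y'))
    (hu : u ∈ uIcc y y') : B.Between (x, u) := fun t ht => by
  have h1 := h t ht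
  have h2 := h' t ht
  simp only at h1 h2 ⊢
  rcases le_total y y' with hy | hy
  · rw [uIcc_of_le hy] at hu
    exact ⟨h1.1.trans_le hu.1, hu.2.trans_lt h2.2⟩
  · rw [uIcc_of_ge hy] at hu
    exact ⟨h2.1.trans_le hu.1, hu.2.trans_lt h1.2⟩

lemma Between.abs_sub_le {z : ℝ × ℝ} (h : B.Between z) : -B.A ≤ z.2 ∧ z.2 ≤ B.m + B.A := by
  obtain ⟨t, ht⟩ := B.α.nonempty_fiber z.1
  have h1 := h t ht
  have := abs_le.1 (B.abs_snd_le t)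
  exact ⟨by linarith, by linarith⟩

lemma Between.mem_obstacle {σ : Set ℤ} {z : ℝ × ℝ} (h : B.Between z) (hz : z ∈ B.obstacle σ) :
    ∃ k : ℤ, k * B.N < z.1 ∧ z.1 < (k + 1) * B.N ∧ ((k ∈ σ ∧ z.2 ≤ B.h) ∨ (k ∉ σ ∧ B.A + 1 ≤ z.2)) := by
  have hX := B.X_nonneg
  have hN := B.cast_N
  rcases hz with (⟨t, rfl⟩ | ⟨t, rfl⟩) | hz | hz
  · exact absurd (h t rfl).1 (lt_irrefl _)
  · have := (h t (B.shift_fst t).symm).2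
    rw [B.shift_snd] at this
    exact absurd this (lt_irrefl _)
  · obtain ⟨k, hk, hz⟩ := mem_iUnion₂.1 hz
    obtain ⟨i, ⟨h1, h2⟩, w, hw, rfl⟩ := mem_iUnion₂.1 hz
    have hx := abs_le.1 (B.abs_le_of_mem_U w hw)
    have h1' : (2 * B.X + 2 : ℝ) ≤ i := by exact_mod_cast h1
    have h2' : (i : ℝ) ≤ 6 * B.X + 4 := by exact_mod_cast h2
    refine ⟨k, ?_, ?_, .inl ⟨hk, by simpa [lat] using B.snd_le_of_mem_U w hw⟩⟩ <;>
    · simp only [lat, Prod.fst_add, Int.cast_add, Int.cast_mul]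
      linarith
  · obtain ⟨k, hk, w, hw, rfl⟩ := mem_iUnion₂.1 hz
    have hx := abs_le.1 (B.abs_le_of_mem_D w hw)
    refine ⟨k, ?_, ?_, .inr ⟨hk, by simpa [lat] using B.le_snd_of_mem_D w hw⟩⟩ <;>
    · simp only [lat, Prod.fst_add, Int.cast_add, Int.cast_mul, Int.cast_ofNat]
      linarith

lemma Between.notMem_column {σ : Set ℤ} {z : ℝ × ℝ} (h : B.Between z) (k : ℤ)
    (h1 : k * B.N ≤ z.1) (h2 : z.1 ≤ (k + 1) * B.N) (hU : k ∈ σ → B.h < z.2)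
    (hD : k ∉ σ → z.2 < B.A + 1) : z ∉ B.obstacle σ := fun hz => by
  obtain ⟨j, hj1, hj2, hj⟩ := h.mem_obstacle hz
  have l1 : (j : ℝ) < k + 1 := lt_of_mul_lt_mul_right (hj1.trans_le h2) B.N_pos.le
  have l2 : (k : ℝ) < j + 1 := lt_of_mul_lt_mul_right (h1.trans_lt hj2) B.N_pos.le
  have l3 : j < k + 1 := by exact_mod_cast l1
  have l4 : k < j + 1 := by exact_mod_cast l2
  obtain rfl : j = k := by omega
  rcases hj with ⟨hj, h3⟩ | ⟨hj, h3⟩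
  · exact (hU hj).not_ge h3
  · exact (hD hj).not_ge h3

lemma Between.notMem_of_fst_eq {σ : Set ℤ} {z : ℝ × ℝ} (h : B.Between z) {k : ℤ}
    (hk : z.1 = k * B.N) : z ∉ B.obstacle σ := fun hz => by
  obtain ⟨j, hj1, hj2, -⟩ := h.mem_obstacle hz
  rw [hk] at hj1 hj2
  have l1 : (j : ℝ) < k := lt_of_mul_lt_mul_right hj1 B.N_pos.le
  have l2 : (k : ℝ) < j + 1 := lt_of_mul_lt_mul_right hj2 B.N_pos.le
  have l3 : j < k := by exact_mod_cast l1
  have l4 : k < j + 1 := by exact_mod_cast l2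
  omega

variable (B)

/-- The base point of the left end of column `k`. -/
def base (k : ℤ) : ℝ × ℝ := (k * B.N, B.A + 1 / 2)

lemma reach_base {σ : Set ℤ} {k : ℤ} {y : ℝ} (h : B.Between (k * B.N, y)) :
    M.Reach (B.obstacle σ) (k * B.N, y) (B.base k) (M.bd * B.m) := by
  have hA := B.A_nonneg
  have hm := B.le_m'
  have hb : B.Between (k * B.N, B.A + 1 / 2) := B.between_of_lt (by simp) (by simp; linarith)
  refine M.reach_vertical (fun u hu => (h.uIcc hb hu).notMem_of_fst_eq rfl) ?_
  have := h.abs_sub_le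
  exact abs_le.2 ⟨by linarith, by linarith⟩

lemma reach_base_succ (σ : Set ℤ) (k : ℤ) :
    M.Reach (B.obstacle σ) (B.base k) (B.base (k + 1)) (M.bd * (B.N + 2 * B.m)) := by
  have hA := B.A_nonneg
  have hm := B.le_m'
  have hb := M.bd_pos
  have hN := B.N_pos
  have hle : (k : ℝ) * B.N ≤ ((k + 1 : ℤ) : ℝ) * B.N := by push_cast; linarith
  have hlen : |((k + 1 : ℤ) : ℝ) * B.N - k * B.N| ≤ B.N := by
    rw [abs_of_nonneg (by linarith)]; push_cast; linarith
  by_cases hk : k ∈ σ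
  · set y := (B.m : ℝ) - B.A - 1 / 2
    have hy : ∀ x, B.Between (x, y) := fun x =>
      B.between_of_lt (by simp only [y]; linarith) (by simp only [y]; linarith)
    have h1 := B.reach_base (σ := σ) (hy (k * B.N))
    have h2 := B.reach_base (σ := σ) (hy ((k + 1 : ℤ) * B.N))
    have h3 : M.Reach (B.obstacle σ) (k * B.N, y) ((k + 1 : ℤ) * B.N, y) (M.bd * B.N) := by
      refine M.reach_horizontal (fun u hu => ?_) hlen
      rw [uIcc_of_le hle] at hu
      refine (hy u).notMem_column k hu.1 (by exact_mod_cast hu.2) (fun _ => ?_) fun h => absurd hk h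
      have := B.h_le
      simp only [y]; linarith
    refine ((h1.symm.trans h3).trans h2).of_le (le_of_eq ?_)
    ring
  · refine Reach.of_le (M.reach_horizontal (L := B.N) (fun u hu => ?_) hlen) (by gcongr; linarith)
    rw [uIcc_of_le hle] at hu
    refine (B.between_of_lt ?_ ?_).notMem_column k hu.1 (by exact_mod_cast hu.2)
      (fun h => absurd h hk) fun _ => ?_ <;> simp only <;> linarith

lemma reach_base_add (σ : Set ℤ) (k : ℤ) (n : ℕ) :
    M.Reach (B.obstacle σ) (B.base k) (B.base (k + n)) (n * (M.bd * (B.N + 2 * B.m))) := by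
  induction n with
  | zero =>
    obtain ⟨hL, γ, -, h0, -, hO⟩ := B.reach_base_succ σ k
    refine ⟨by simp, fun _ => B.base k, fun s _ t _ => by rw [M.dist_self]; exact abs_nonneg _, rfl,
      by simp, fun t _ => h0 ▸ hO 0 ⟨le_rfl, hL⟩⟩
  | succ n ih =>
    have := ih.trans (B.reach_base_succ σ _)
    push_cast
    rw [← add_assoc]
    convert this using 1
    ring

end Board

end TorusMetric

namespace TorusMetric

namespace Board

variable {M : TorusMetric} (B : M.Board)

/-- `z` lies above the tip of the `i`-th translate of `U` in column `k`. -/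
def IsGate (k i : ℤ) (z : ℝ × ℝ) : Prop :=
  z.1 = B.tip.1 + (k * B.N + i) ∧ B.h < z.2 ∧ B.Between z

/-- The region between the axes, including the heights attained by the axes. -/
def InStrip (z : ℝ × ℝ) : Prop :=
  (B.α.curve B.α.low).2 ≤ z.2 ∧ z.2 ≤ (B.α.curve B.α.high).2 + B.m

lemma tip_mem : B.tip ∈ B.U := B.joinedIn_U.target_mem

variable {B}

lemma InStrip.le {z : ℝ × ℝ} (h : B.InStrip z) : -B.A ≤ z.2 ∧ z.2 ≤ B.m + B.A := by
  have h1 := abs_le.1 (B.abs_snd_le B.α.low)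
  have h2 := abs_le.1 (B.abs_snd_le B.α.high)
  exact ⟨by linarith [h.1], by linarith [h.2]⟩

lemma inStrip_of_forall_notMem {σ : Set ℤ} {γ : ℝ → ℝ × ℝ} {s t : ℝ}
    (hγ : ContinuousOn γ (uIcc s t)) (hO : ∀ u ∈ uIcc s t, γ u ∉ B.obstacle σ)
    (h1 : B.A ≤ (γ s).2) (h2 : (γ s).2 ≤ B.m - B.A) : B.InStrip (γ t) := by
  have k2 := abs_le.1 (B.abs_snd_le B.α.high)
  have k1 := abs_le.1 (B.abs_snd_le B.α.low)
  constructor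
  · by_contra! hn
    obtain ⟨_, ⟨u, hu, rfl⟩, v, hv⟩ := B.α.inter_range_nonempty hγ.joinedIn_image.symm hn.le
      (by linarith)
    exact hO u hu (hv ▸ B.curve_mem_obstacle σ v)
  · by_contra! hn
    obtain ⟨_, ⟨u, hu, rfl⟩, v, hv⟩ := (B.α.shift B.m).inter_range_nonempty hγ.joinedIn_image
      (by change _ ≤ ((B.α.shift B.m).curve B.α.low).2; rw [B.shift_snd]; linarith)
      (by change ((B.α.shift B.m).curve B.α.high).2 ≤ _; rw [B.shift_snd]; exact hn.le)
    exact hO u hu (hv ▸ B.shift_curve_mem_obstacle σ v)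

/-- A path in the strip that avoids the obstacles passes through each vertical line. -/
lemma exists_between {σ : Set ℤ} {γ : ℝ → ℝ × ℝ} {s t : ℝ}
    (hγ : ContinuousOn γ (uIcc s t)) (hO : ∀ u ∈ uIcc s t, γ u ∉ B.obstacle σ)
    (hS : ∀ u ∈ uIcc s t, B.InStrip (γ u)) {x : ℝ}
    (h1 : (γ s).1 ≤ x - B.X) (h2 : x + B.X ≤ (γ t).1) :
    ∃ u ∈ uIcc s t, (γ u).1 = x ∧ B.Between (γ u) := by
  have hX := B.period_le
  have hm := B.le_m'
  have hA := B.A_nonneg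
  obtain ⟨t₁, e₁, hi₁⟩ := B.α.exists_highest x
  obtain ⟨t₂, e₂, lo₂⟩ := B.α.exists_lowest x
  obtain ⟨l, hl, jl⟩ := B.α.joinedIn t₁ B.α.low
  obtain ⟨r, hr, jr⟩ := (B.α.shift B.m).joinedIn t₂ B.α.high
  have js := joinedIn_segment (B.α.curve t₁) ((B.α.shift B.m).curve t₂)
  have a₁ := abs_le.1 (B.abs_snd_le t₁)
  have a₂ := abs_le.1 (B.abs_snd_le t₂)
  have hseg : segment ℝ (B.α.curve t₁) ((B.α.shift B.m).curve t₂) ⊆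
      {x} ×ˢ Icc (B.α.curve t₁).2 ((B.α.curve t₂).2 + B.m) :=
    ((convex_singleton x).prod (convex_Icc _ _)).segment_subset ⟨e₁, le_rfl, by linarith⟩
      ⟨(B.shift_fst t₂).trans e₂, by rw [B.shift_snd]; linarith, (B.shift_snd t₂).le⟩
  have hper : (B.α.shift B.m).period = B.α.period := rfl
  set G := (range B.α.curve ∩ {z | |z.1 - (B.α.curve t₁).1| ≤ M.bd * B.α.period}) ∪
    segment ℝ (B.α.curve t₁) ((B.α.shift B.m).curve t₂) ∪ (range (B.α.shift B.m).curve ∩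
      {z | |z.1 - ((B.α.shift B.m).curve t₂).1| ≤ M.bd * (B.α.shift B.m).period}) with hG
  have hJ : JoinedIn G (B.α.curve l) ((B.α.shift B.m).curve r) :=
    ((jl.symm.mono fun z hz => .inl (.inl hz)).trans (js.mono fun z hz => .inl (.inr hz))).trans
      (jr.mono fun z hz => .inr hz)
  have hGx : ∀ p ∈ G, (γ s).1 ≤ p.1 ∧ p.1 ≤ (γ t).1 := by
    rintro p ((⟨-, hp⟩ | hp) | ⟨-, hp⟩)
    · rw [mem_ofPred_eq, e₁] at hp
      have := abs_le.1 hp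
      exact ⟨by linarith, by linarith⟩
    · have := (hseg hp).1
      have hX := B.X_nonneg
      rw [mem_singleton_iff] at this
      exact ⟨by linarith, by linarith⟩
    · rw [mem_ofPred_eq, B.shift_fst, e₂, hper] at hp
      have := abs_le.1 hp
      exact ⟨by linarith, by linarith⟩
  obtain ⟨_, ⟨u, hu, rfl⟩, (⟨⟨v, hv⟩, -⟩ | hp) | ⟨⟨v, hv⟩, -⟩⟩ := hγ.joinedIn_image.inter_nonempty hJ hGx
    (by
      rintro _ ⟨u, hu, rfl⟩
      rw [hl, hr]
      refine ⟨(hS u hu).1, (hS u hu).2.trans_eq ?_⟩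
      exact (B.shift_snd _).symm)
  · exact absurd (hv ▸ B.curve_mem_obstacle σ v) (hO u hu)
  · obtain ⟨ex, k1, k2⟩ := hseg hp
    refine ⟨u, hu, ex, fun v hv => ?_⟩
    rw [show (γ u).1 = x from ex] at hv
    have n1 : (B.α.curve t₁).2 ≠ (γ u).2 := fun h =>
      hO u hu ((Prod.ext (e₁.trans ex.symm) h : B.α.curve t₁ = γ u) ▸ B.curve_mem_obstacle σ t₁)
    have n2 : ((B.α.shift B.m).curve t₂).2 ≠ (γ u).2 := fun h =>
      hO u hu ((Prod.ext (((B.shift_fst _).trans e₂).trans ex.symm) h :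
        (B.α.shift B.m).curve t₂ = γ u) ▸ B.shift_curve_mem_obstacle σ t₂)
    rw [B.shift_snd] at n2
    refine ⟨(hi₁ v hv).trans_lt (lt_of_le_of_ne k1 n1), (lt_of_le_of_ne k2 n2.symm).trans_le ?_⟩
    linarith [lo₂ v hv]
  · exact absurd (hv ▸ B.shift_curve_mem_obstacle σ v) (hO u hu)

/-- A path in the strip that avoids the obstacles passes above each translate of `U`. -/
lemma exists_isGate {σ : Set ℤ} {k i : ℤ} (hk : k ∈ σ) (hi : 2 * B.X + 2 ≤ i)
    (hi' : i ≤ 6 * B.X + 4) {γ : ℝ → ℝ × ℝ} {s t : ℝ}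
    (hγ : ContinuousOn γ (uIcc s t)) (hO : ∀ u ∈ uIcc s t, γ u ∉ B.obstacle σ)
    (hS : ∀ u ∈ uIcc s t, B.InStrip (γ u))
    (h1 : (γ s).1 ≤ k * B.N) (h2 : (k + 1) * B.N ≤ (γ t).1) :
    ∃ u ∈ uIcc s t, B.IsGate k i (γ u) := by
  have hX := B.period_le
  have hX0 := B.X_nonneg
  have hm := B.le_m'
  have hA := B.A_nonneg
  have hh := B.lt_h
  have hh' := B.h_le
  have hN := B.cast_N
  have hir : (2 * B.X + 2 : ℝ) ≤ i := by exact_mod_cast hi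
  have hir' : (i : ℝ) ≤ 6 * B.X + 4 := by exact_mod_cast hi'
  have htip := abs_le.1 (B.abs_le_of_mem_U _ B.tip_mem)
  set w : ℝ × ℝ := lat (k * B.N + i, 0) with hw
  have hw1 : w.1 = k * B.N + i := by simp [hw, lat]
  have hw2 : w.2 = 0 := by simp [hw, lat]
  set x := B.tip.1 + (k * B.N + i) with hx
  obtain ⟨t₂, e₂, lo₂⟩ := B.α.exists_lowest x
  obtain ⟨r, hr, jr⟩ := (B.α.shift B.m).joinedIn t₂ B.α.high
  have a₂ := abs_le.1 (B.abs_snd_le t₂)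
  have jl : JoinedIn ((fun z => z + w) '' B.U) (B.low + w) (B.tip + w) := by
    obtain ⟨f, hf⟩ := B.joinedIn_U
    exact ⟨f.map (f := fun z => z + w) (by fun_prop), fun t => ⟨f t, hf t, rfl⟩⟩
  have js := joinedIn_segment (B.tip + w) ((B.α.shift B.m).curve t₂)
  have hseg : segment ℝ (B.tip + w) ((B.α.shift B.m).curve t₂) ⊆
      {x} ×ˢ Icc B.h ((B.α.curve t₂).2 + B.m) :=
    ((convex_singleton x).prod (convex_Icc _ _)).segment_subset
      ⟨by simp [hw1, hx], by simp [hw2, B.tip_snd], by simp [hw2, B.tip_snd]; linarith⟩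
      ⟨(B.shift_fst t₂).trans e₂, by rw [B.shift_snd]; linarith, (B.shift_snd t₂).le⟩
  have hper : (B.α.shift B.m).period = B.α.period := rfl
  set G := ((fun z => z + w) '' B.U) ∪
    segment ℝ (B.tip + w) ((B.α.shift B.m).curve t₂) ∪ (range (B.α.shift B.m).curve ∩
      {z | |z.1 - ((B.α.shift B.m).curve t₂).1| ≤ M.bd * (B.α.shift B.m).period}) with hG
  have hJ : JoinedIn G (B.low + w) ((B.α.shift B.m).curve r) :=
    ((jl.mono fun z hz => .inl (.inl hz)).trans (js.mono fun z hz => .inl (.inr hz))).trans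
      (jr.mono fun z hz => .inr hz)
  have hGx : ∀ p ∈ G, (γ s).1 ≤ p.1 ∧ p.1 ≤ (γ t).1 := by
    rintro p ((⟨z, hz, rfl⟩ | hp) | ⟨-, hp⟩)
    · have := abs_le.1 (B.abs_le_of_mem_U z hz)
      simp only [Prod.fst_add, hw1]
      exact ⟨by linarith, by linarith⟩
    · have := (hseg hp).1
      rw [mem_singleton_iff] at this
      exact ⟨by linarith, by linarith⟩
    · rw [mem_ofPred_eq, B.shift_fst, e₂, hper] at hp
      have := abs_le.1 hp
      exact ⟨by linarith, by linarith⟩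
  have hUO : ∀ z ∈ B.U, z + w ∈ B.obstacle σ := fun z hz => B.U_mem_obstacle hk hi hi' hz
  obtain ⟨_, ⟨u, hu, rfl⟩, (⟨v, hv, hv'⟩ | hp) | ⟨⟨v, hv⟩, -⟩⟩ := hγ.joinedIn_image.inter_nonempty hJ hGx
    (by
      rintro _ ⟨u, hu, rfl⟩
      rw [hr]
      refine ⟨?_, (hS u hu).2.trans_eq (B.shift_snd _).symm⟩
      rw [Prod.snd_add, hw2, add_zero]
      exact B.low_snd.trans (hS u hu).le.1)
  · exact absurd (hv' ▸ hUO v hv) (hO u hu)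
  · obtain ⟨ex, k1, k2⟩ := hseg hp
    rw [mem_singleton_iff] at ex
    have n1 : B.h ≠ (γ u).2 := fun h =>
      hO u hu ((Prod.ext (by simp [hw1, ex, hx]) (by simp [hw2, B.tip_snd, h]) : B.tip + w = γ u) ▸
        hUO _ B.tip_mem)
    have n2 : ((B.α.shift B.m).curve t₂).2 ≠ (γ u).2 := fun h =>
      hO u hu ((Prod.ext (((B.shift_fst _).trans e₂).trans ex.symm) h :
        (B.α.shift B.m).curve t₂ = γ u) ▸ B.shift_curve_mem_obstacle σ t₂)
    rw [B.shift_snd] at n2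
    have hlt := lt_of_le_of_ne k1 n1
    refine ⟨u, hu, ex, hlt, fun v hv => ?_⟩
    rw [ex] at hv
    have a₃ := abs_le.1 (B.abs_snd_le v)
    refine ⟨by linarith, (lt_of_le_of_ne k2 n2.symm).trans_le ?_⟩
    linarith [lo₂ v hv]
  · exact absurd (hv ▸ B.shift_curve_mem_obstacle σ v) (hO u hu)

lemma IsGate.reach {σ : Set ℤ} {k i : ℤ} (hk : k ∈ σ) (hi : 2 * B.X + 2 ≤ i)
    (hi' : i + 1 ≤ 6 * B.X + 4) {z w : ℝ × ℝ} (hz : B.IsGate k i z) (hw : B.IsGate k (i + 1) w) :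
    M.Reach (B.obstacle σ) z w (M.bd * (4 * B.A + 5)) := by
  have hX0 := B.X_nonneg
  have hm := B.le_m'
  have hA := B.A_nonneg
  have hh := B.lt_h
  have hh' := B.h_le
  have hN := B.cast_N
  have hir : (2 * B.X + 2 : ℝ) ≤ i := by exact_mod_cast hi
  have hir' : (i + 1 : ℝ) ≤ 6 * B.X + 4 := by exact_mod_cast hi'
  have htip := abs_le.1 (B.abs_le_of_mem_U _ B.tip_mem)
  set y : ℝ := B.m - B.A - 1 / 2 with hy
  have hb : ∀ x, B.Between (x, y) := fun x =>
    B.between_of_lt (by simp only [y]; linarith) (by simp only [y]; linarith)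
  have key : ∀ x u : ℝ, k * B.N ≤ x → x ≤ (k + 1) * B.N → B.h < u → B.Between (x, u) →
      (x, u) ∉ B.obstacle σ := fun x u h1 h2 h3 h => h.notMem_column k h1 h2 (fun _ => h3)
        fun h => absurd hk h
  have vert : ∀ x u : ℝ, k * B.N ≤ x → x ≤ (k + 1) * B.N → B.h < u → B.Between (x, u) →
      M.Reach (B.obstacle σ) (x, u) (x, y) (M.bd * (2 * B.A + 2)) := by
    intro x u h1 h2 h3 h
    refine M.reach_vertical (fun v hv => key x v h1 h2 ?_ (h.uIcc (hb x) hv)) ?_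
    · rcases le_total u y with huy | huy
      · rw [uIcc_of_le huy] at hv; exact h3.trans_le hv.1
      · rw [uIcc_of_ge huy] at hv; linarith [hv.1]
    · have := h.abs_sub_le
      exact abs_le.2 ⟨by linarith, by linarith⟩
  obtain ⟨z1, z2, z3⟩ := hz
  obtain ⟨w1, w2, w3⟩ := hw
  push_cast at w1
  have hzw : w.1 = z.1 + 1 := by linarith
  have r1 := vert z.1 z.2 (by linarith) (by linarith) z2 z3
  have r2 := vert w.1 w.2 (by linarith) (by linarith) w2 w3
  have r3 : M.Reach (B.obstacle σ) (z.1, y) (w.1, y) (M.bd * 1) := by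
    refine M.reach_horizontal (fun v hv => ?_) (by rw [hzw]; simp)
    rw [uIcc_of_le (by linarith)] at hv
    exact key v y (by linarith [hv.1]) (by linarith [hv.2]) (by linarith) (hb v)
  refine ((r1.trans r3).trans r2.symm).of_le (le_of_eq ?_)
  ring

end Board

end TorusMetric

namespace TorusMetric

namespace Board

variable {M : TorusMetric} (B : M.Board)

/-- An upper bound for the time that near minimal paths need per column. -/
def rate : ℝ := M.bd * (B.N + 2 * B.m) + 2 * (M.bd * B.m) + 1

lemma one_le_rate : 1 ≤ B.rate := by
  have := M.bd_pos
  have := B.N_pos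
  have := B.A_nonneg
  have h : (0 : ℝ) ≤ B.m := by linarith [B.le_m']
  have : 0 ≤ M.bd * (B.N + 2 * B.m) + 2 * (M.bd * B.m) := by positivity
  rw [rate]; linarith

/-- A near minimal path among the obstacles `B.obstacle σ` that makes progress to the right. -/
structure Good (σ : Set ℤ) (T : ℝ) (γ : ℝ → ℝ × ℝ) : Prop where
  nearMin : M.NearMin (B.obstacle σ) γ 0 T 1
  inStrip : ∀ t ∈ Icc 0 T, B.InStrip (γ t)
  exists_fst_eq : ∀ n : ℕ, B.rate * (n + 1) ≤ T → ∃ s ∈ Icc 0 T, (γ s).1 = n * B.N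

lemma exists_nearMin (σ : Set ℤ) {K : ℕ} (hK : 1 ≤ K) {e : ℝ} (he : 0 < e) (he1 : e ≤ 1) :
    ∃ γ a b, M.NearMin (B.obstacle σ) γ a b e ∧ (∀ t ∈ Icc a b, B.InStrip (γ t)) ∧ (γ 0).1 = 0 ∧
      a ≤ -(K * B.N / M.bd) ∧ K * B.N / M.bd ≤ b ∧
      ∀ n : ℕ, n < K → ∃ s ∈ Icc 0 b, s ≤ B.rate * (n + 1) ∧ (γ s).1 = n * B.N := by
  have hA := B.A_nonneg
  have hm := B.le_m'
  have hN := B.N_pos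
  have hX := B.X_nonneg
  have hNX := B.cast_N
  have hb := M.bd_pos
  have hK' : (1 : ℝ) ≤ K := by exact_mod_cast hK
  have hKN : (B.N : ℝ) ≤ K * B.N := by nlinarith
  obtain ⟨γ, L, hL, h0, h1, hγ⟩ := (B.reach_base_add σ (-K) (2 * K)).exists_nearMin he
  have f0 : (γ 0).1 = -(K * B.N) := by rw [h0]; simp [base]
  have f1 : (γ L).1 = K * B.N := by rw [h1]; simp only [base]; push_cast; ring
  have m0 : (0 : ℝ) ∈ Icc 0 L := ⟨le_rfl, hL⟩
  have mL : L ∈ Icc 0 L := ⟨hL, le_rfl⟩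
  have hsub : ∀ {s t}, s ∈ Icc 0 L → t ∈ Icc 0 L → uIcc s t ⊆ Icc 0 L := uIcc_subset_Icc
  have hS : ∀ t ∈ Icc 0 L, B.InStrip (γ t) := fun t ht =>
    inStrip_of_forall_notMem (hγ.lip.continuousOn_uIcc m0 ht)
      (fun u hu => hγ.notMem u (hsub m0 ht hu)) (by rw [h0, base]; simp)
      (by rw [h0, base]; simp only; linarith)
  obtain ⟨τ, hτ, eτ, bτ⟩ := exists_between (hγ.lip.continuousOn_uIcc m0 mL)
    (fun u hu => hγ.notMem u (hsub m0 mL hu)) (fun u hu => hS u (hsub m0 mL hu)) (x := 0)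
    (by rw [f0]; linarith) (by rw [f1]; linarith)
  replace hτ := hsub m0 mL hτ
  have speed : ∀ s ∈ Icc 0 L, ∀ t ∈ Icc 0 L, |(γ s).1 - (γ t).1| ≤ M.bd * |s - t| :=
    fun s hs t ht => (norm_fst_le (γ s - γ t)).trans <| (M.norm_sub_le _ _).trans
      (mul_le_mul_of_nonneg_left (hγ.lip s hs t ht) hb.le)
  refine ⟨fun t => γ (t + τ), 0 - τ, L - τ, hγ.comp_add τ, fun t ht => hS _
    ⟨by linarith [ht.1], by linarith [ht.2]⟩, by simpa using eτ, ?_, ?_, fun n hn => ?_⟩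
  · have := speed τ hτ 0 m0
    rw [eτ, f0, sub_zero, abs_of_nonneg hτ.1, zero_sub, neg_neg] at this
    have := (div_le_iff₀' hb).2 ((le_abs_self _).trans this)
    linarith
  · have := speed L mL τ hτ
    rw [eτ, f1, sub_zero, abs_of_nonneg (by linarith [hτ.2] : 0 ≤ L - τ)] at this
    exact (div_le_iff₀' hb).2 ((le_abs_self _).trans this)
  · obtain ⟨s, hs, es, bs⟩ : ∃ s ∈ Icc τ L, (γ s).1 = n * B.N ∧ B.Between (γ s) := by
      rcases Nat.eq_zero_or_pos n with rfl | hn0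
      · exact ⟨τ, ⟨le_rfl, hτ.2⟩, by simpa using eτ, bτ⟩
      · have hn0' : (1 : ℝ) ≤ n := by exact_mod_cast hn0
        have hn' : (n + 1 : ℝ) ≤ K := by exact_mod_cast hn
        obtain ⟨s, hs, h⟩ := exists_between (hγ.lip.continuousOn_uIcc hτ mL)
          (fun u hu => hγ.notMem u (hsub hτ mL hu)) (fun u hu => hS u (hsub hτ mL hu))
          (x := n * B.N) (by rw [eτ]; nlinarith) (by rw [f1]; nlinarith)
        rw [uIcc_of_le hτ.2] at hs
        exact ⟨s, hs, h⟩
    refine ⟨s - τ, ⟨by linarith [hs.1], by linarith [hs.2]⟩, ?_, by simpa using es⟩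
    have g1 : γ τ = (((0 : ℤ) : ℝ) * B.N, (γ τ).2) := Prod.ext (by simpa using eτ) rfl
    have g2 : γ s = (((0 + n : ℤ) : ℝ) * B.N, (γ s).2) := Prod.ext (by simpa using es) rfl
    have r1 := B.reach_base (σ := σ) (g1 ▸ bτ)
    have r2 := B.reach_base (σ := σ) (g2 ▸ bs)
    rw [← g1] at r1
    rw [← g2] at r2
    have := hγ.sub_le τ hτ s ⟨hτ.1.trans hs.1, hs.2⟩ _
      ((r1.trans (B.reach_base_add σ 0 n)).trans r2.symm)
    have hn0 : (0 : ℝ) ≤ n := n.cast_nonneg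
    have hm0 : (0 : ℝ) ≤ B.m := by linarith
    have : 0 ≤ n * (2 * (M.bd * B.m) + 1) := by positivity
    have : 0 ≤ M.bd * (B.N + 2 * B.m) := by positivity
    rw [rate]
    linarith [le_abs_self (s - τ)]

/-- Each word is realized by a geodesic. -/
lemma exists_isGeodesic (σ : Set ℤ) : ∃ γ, M.IsGeodesic γ ∧ (γ 0).1 = 0 ∧ -B.A ≤ (γ 0).2 ∧
    (γ 0).2 ≤ B.m + B.A ∧ ∀ T, ∃ γ', B.Good σ T γ' ∧ ∀ t ∈ Icc 0 T, ‖γ' t - γ t‖ ≤ 1 / 4 := by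
  have hA := B.A_nonneg
  have hN := B.N_pos
  have hb := M.bd_pos
  have hm := B.le_m'
  have hex := fun n : ℕ => B.exists_nearMin σ (K := n + 1) (by omega) (e := 1 / (n + 1))
    (by positivity) (by rw [div_le_one (by positivity)]; linarith [n.cast_nonneg (α := ℝ)])
  choose γ a b hγ hS h0 ha hb' hits using hex
  obtain ⟨δ, hδ, H⟩ := M.exists_isLocGeod_limit (r := min B.r (B.α.period / 2))
    (lt_min B.r_pos (half_pos B.α.period_pos))
  have tb : Tendsto (fun n : ℕ => ((n + 1 : ℕ) : ℝ) * B.N / M.bd) atTop atTop :=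
    ((tendsto_natCast_atTop_atTop.comp (tendsto_add_atTop_nat 1)).atTop_mul_const hN).atTop_div_const hb
  have ta' : Tendsto a atTop atBot := tendsto_atBot_mono ha (tendsto_neg_atTop_atBot.comp tb)
  have tb' : Tendsto b atTop atTop := tendsto_atTop_mono hb' tb
  have hn0 : ∀ n, (0 : ℝ) ∈ Icc (a n) (b n) := fun n => by
    have : 0 ≤ ((n + 1 : ℕ) : ℝ) * B.N / M.bd := by positivity
    exact ⟨by linarith [ha n], by linarith [hb' n]⟩
  obtain ⟨γ', hloc, hlim⟩ := H (B.obstacle σ) (-B.A) (B.m + B.A) (B.m + B.A) γ a b _ (B.stranded σ) hγ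
    (fun n t ht => (hS n t ht).le) (fun n => by
      have := (hS n 0 (hn0 n)).le
      rw [Prod.norm_def, h0, norm_zero]
      exact max_le (by linarith) (abs_le.2 ⟨by linarith, by linarith⟩)) ta' tb'
      tendsto_one_div_add_atTop_nhds_zero_nat
  have hgeo := hloc.isGeodesic hδ
  have l1 := (continuous_fst.tendsto _).comp (hlim 0)
  have l2 := (continuous_snd.tendsto _).comp (hlim 0)
  refine ⟨γ', hgeo, ?_, ge_of_tendsto' l2 fun n => (hS n 0 (hn0 n)).le.1,
    le_of_tendsto' l2 fun n => (hS n 0 (hn0 n)).le.2, fun T => ?_⟩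
  · refine tendsto_nhds_unique l1 (tendsto_const_nhds.congr fun n => (h0 n).symm)
  have hle : (hyperfilter ℕ : Filter ℕ) ≤ atTop := Nat.hyperfilter_le_atTop
  have ev := eventually_forall_norm_sub_le (M := M) (l := (hyperfilter ℕ : Filter ℕ)) (γ := γ) (γ' := γ')
    (a := 0) (b := T) (hle ((tb'.eventually_ge_atTop T).mono fun n hn =>
      (hγ n).lip.mono (hn0 n).1 hn)) (hgeo.lip 0 T) (fun t _ => hlim t) (ε := 1 / 4) (by norm_num)
  obtain ⟨n, hn1, hn2, hn3⟩ := (ev.and (hle ((tb'.eventually_ge_atTop T).and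
    (tendsto_natCast_atTop_atTop.eventually_ge_atTop T)))).exists
  refine ⟨γ n, ⟨(hγ n).mono (hn0 n).1 hn2 ?_, fun t ht => hS n t ⟨(hn0 n).1.trans ht.1, ht.2.trans hn2⟩,
    fun j hj => ?_⟩, hn1⟩
  · rw [div_le_one (by positivity)]; linarith [n.cast_nonneg (α := ℝ)]
  · have h1 : (j : ℝ) + 1 ≤ B.rate * (j + 1) := le_mul_of_one_le_left (by positivity) B.one_le_rate
    have h2 : (j : ℝ) < (n + 1 : ℕ) := by push_cast; linarith
    obtain ⟨s, hs, hs', es⟩ := hits n j (by exact_mod_cast h2)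
    exact ⟨s, ⟨hs.1, hs'.trans hj⟩, es⟩

/-- Near minimal paths for different words separate. -/
lemma Good.exists_lt {σ σ' : Set ℤ} {k : ℕ} (hk : (k : ℤ) ∈ σ) (hk' : (k : ℤ) ∉ σ') {T : ℝ}
    (hT : B.rate * (k + 2) ≤ T) {γ γ' : ℝ → ℝ × ℝ} (hγ : B.Good σ T γ) (hγ' : B.Good σ' T γ') :
    ∃ t ∈ Icc 0 T, 1 < ‖γ t - γ' t‖ := by
  by_contra! hle
  have hA := B.A_nonneg
  have hX := B.X_nonneg
  have hNX := B.cast_N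
  have hb := M.bd_pos
  have hm := B.le_m
  have hrate := B.one_le_rate
  obtain ⟨s, hs, es⟩ := hγ.exists_fst_eq k (by nlinarith)
  obtain ⟨t, ht, et⟩ := hγ.exists_fst_eq (k + 1) (by push_cast; linarith)
  push_cast at et
  have hsub : ∀ {s t}, s ∈ Icc 0 T → t ∈ Icc 0 T → uIcc s t ⊆ Icc 0 T := uIcc_subset_Icc
  have hgate : ∀ i : ℤ, 2 * B.X + 2 ≤ i → i ≤ 6 * B.X + 4 → ∃ u ∈ Icc 0 T, B.IsGate k i (γ u) := by
    intro i hi hi'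
    obtain ⟨u, hu, h⟩ := exists_isGate hk hi hi' (hγ.nearMin.lip.continuousOn_uIcc hs ht)
      (fun u hu => hγ.nearMin.notMem u (hsub hs ht hu)) (fun u hu => hγ.inStrip u (hsub hs ht hu))
      (by simpa using es.le) (by simpa using et.ge)
    exact ⟨u, hsub hs ht hu, h⟩
  have hclose : ∀ u ∈ Icc 0 T, |(γ u).1 - (γ' u).1| ≤ 1 ∧ |(γ u).2 - (γ' u).2| ≤ 1 := fun u hu =>
    ⟨(norm_fst_le (γ u - γ' u)).trans (hle u hu), (norm_snd_le (γ u - γ' u)).trans (hle u hu)⟩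
  set F := (γ' '' Icc 0 T) ∩ {z | B.A + 2 ≤ z.2} with hF
  have hstep : ∀ i : ℤ, 2 * B.X + 2 ≤ i → i + 1 ≤ 6 * B.X + 4 → ∀ u ∈ Icc 0 T, ∀ v ∈ Icc 0 T,
      B.IsGate k i (γ u) → B.IsGate k (i + 1) (γ v) → JoinedIn F (γ' u) (γ' v) := by
    intro i hi hi' u hu v hv gu gv
    have h1 := hγ.nearMin.sub_le u hu v hv _ (gu.reach hk hi hi' gv)
    refine (hγ'.nearMin.lip.continuousOn_uIcc hu hv).joinedIn_image.mono ?_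
    rintro _ ⟨w, hw, rfl⟩
    have hwT := hsub hu hv hw
    refine ⟨⟨w, hwT, rfl⟩, ?_⟩
    have h2 : |w - u| ≤ |v - u| := abs_sub_left_of_mem_uIcc hw
    have h3 : |(γ w).2 - (γ u).2| ≤ M.bd * (M.bd * (4 * B.A + 5) + 1) :=
      (norm_snd_le (γ w - γ u)).trans <| (M.norm_sub_le _ _).trans <|
        mul_le_mul_of_nonneg_left ((hγ.nearMin.lip w hwT u hu).trans (h2.trans h1)) hb.le
    have h4 := abs_le.1 h3
    have h5 := abs_le.1 (hclose w hwT).2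
    have h6 := gu.2.1
    have h7 := B.lt_h
    change B.A + 2 ≤ (γ' w).2
    linarith
  have hind : ∀ n : ℕ, 2 * B.X + 2 + n ≤ 6 * B.X + 4 → ∃ u ∈ Icc 0 T, ∃ v ∈ Icc 0 T,
      B.IsGate k (2 * B.X + 2) (γ u) ∧ B.IsGate k (2 * B.X + 2 + n) (γ v) ∧
        (n ≠ 0 → JoinedIn F (γ' u) (γ' v)) := by
    intro n
    induction n with
    | zero =>
      intro h
      obtain ⟨u, hu, g⟩ := hgate (2 * B.X + 2) le_rfl (by simpa using h)
      exact ⟨u, hu, u, hu, g, by simpa using g, fun h => absurd rfl h⟩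
    | succ n ih =>
      intro h
      push_cast at h
      obtain ⟨u, hu, v, hv, gu, gv, hJ⟩ := ih (by omega)
      obtain ⟨w, hw, gw⟩ := hgate (2 * B.X + 2 + n + 1) (by omega) (by omega)
      have := hstep _ (by omega) (by omega) v hv w hw gv gw
      refine ⟨u, hu, w, hw, gu, by push_cast; rwa [← add_assoc], fun _ => ?_⟩
      rcases Nat.eq_zero_or_pos n with rfl | hn
      · exact hstep _ le_rfl (by push_cast at h; omega) u hu w hw gu (by simpa using gw)
      · exact (hJ hn.ne').trans this
  have hXi : 0 ≤ B.X := by exact_mod_cast hX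
  obtain ⟨u, hu, v, hv, gu, gv, hJ⟩ := hind (4 * B.X + 2).toNat (by omega)
  have hi : 2 * B.X + 2 + ((4 * B.X + 2).toNat : ℤ) = 6 * B.X + 4 := by omega
  rw [hi] at gv
  have hJ' := hJ (by omega)
  have htip := abs_le.1 (B.abs_le_of_mem_U _ B.tip_mem)
  have e1 := gu.1
  have e2 := gv.1
  push_cast at e1 e2
  have c1 := abs_le.1 (hclose u hu).1
  have c2 := abs_le.1 (hclose v hv).1
  set w : ℝ × ℝ := lat ((k : ℤ) * B.N + (4 * B.X + 3), 0) with hw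
  have hw1 : w.1 = k * B.N + (4 * B.X + 3) := by simp [hw, lat]
  have hw2 : w.2 = 0 := by simp [hw, lat]
  have jD : JoinedIn ((fun z => z + w) '' B.D) (B.bot + w) (B.top + w) := by
    obtain ⟨f, hf⟩ := B.joinedIn_D
    exact ⟨f.map (f := fun z => z + w) (by fun_prop), fun t => ⟨f t, hf t, rfl⟩⟩
  obtain ⟨_, ⟨⟨x, hx, rfl⟩, -⟩, z, hz, hzx⟩ := hJ'.inter_nonempty jD (by
      rintro _ ⟨z, hz, rfl⟩
      have := abs_le.1 (B.abs_le_of_mem_D z hz)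
      simp only [Prod.fst_add, hw1]
      exact ⟨by linarith, by linarith⟩) (by
      rintro _ ⟨⟨x, hx, rfl⟩, h⟩
      simp only [Prod.snd_add, hw2, add_zero]
      exact ⟨B.bot_snd.trans h, (hγ'.inStrip x hx).le.2.trans B.top_snd⟩)
  exact hγ'.nearMin.notMem x hx (hzx ▸ B.D_mem_obstacle hk' hz)

end Board

end TorusMetric

lemma abs_fst_le_norm2 (p : ℝ × ℝ) : |p.1| ≤ norm2 p :=
  Real.abs_le_sqrt (le_add_of_nonneg_right (sq_nonneg _))

lemma abs_snd_le_norm2 (p : ℝ × ℝ) : |p.2| ≤ norm2 p :=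
  Real.abs_le_sqrt (le_add_of_nonneg_left (sq_nonneg _))

lemma exists_int_of_phaseDist_lt {p q : (ℝ × ℝ) × (ℝ × ℝ)} {ε : ℝ} (h : phaseDist p q < ε) :
    ∃ k : ℤ × ℤ, |(p.1 - q.1).1 - k.1| < ε ∧ |(p.1 - q.1).2 - k.2| < ε := by
  have hne : {r : ℝ | ∃ k : ℤ × ℤ, r = norm2 (p.1 - (q.1 + lat k)) + norm2 (p.2 - q.2)}.Nonempty :=
    ⟨_, 0, rfl⟩
  obtain ⟨_, ⟨k, rfl⟩, hk⟩ := exists_lt_of_csInf_lt hne h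
  have h0 : 0 ≤ norm2 (p.2 - q.2) := Real.sqrt_nonneg _
  have h1 := abs_fst_le_norm2 (p.1 - (q.1 + lat k))
  have h2 := abs_snd_le_norm2 (p.1 - (q.1 + lat k))
  have e1 : (p.1 - (q.1 + lat k)).1 = (p.1 - q.1).1 - k.1 := by simp [lat, sub_sub]
  have e2 : (p.1 - (q.1 + lat k)).2 = (p.1 - q.1).2 - k.2 := by simp [lat, sub_sub]
  rw [e1] at h1
  rw [e2] at h2
  exact ⟨k, by linarith, by linarith⟩

lemma abs_le_of_forall_exists_int {f : ℝ → ℝ} (hf : Continuous f) {T : ℝ} (h0 : |f 0| < 1 / 2)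
    (h : ∀ t ∈ Icc 0 T, ∃ k : ℤ, |f t - k| < 1 / 4) {t : ℝ} (ht : t ∈ Icc 0 T) : |f t| ≤ 1 / 4 := by
  have hlt : |f t| < 1 / 2 := by
    by_contra! hn
    obtain ⟨u, hu, hu'⟩ := intermediate_value_Icc ht.1 (f := fun t => |f t|) hf.abs.continuousOn
      ⟨h0.le, hn⟩
    obtain ⟨k, hk⟩ := h u ⟨hu.1, hu.2.trans ht.2⟩
    have hk' := abs_lt.1 hk
    rcases eq_or_eq_neg_of_abs_eq hu' with e | e <;> rw [e] at hk'
    · have h1 : (0 : ℝ) < k := by linarith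
      have h2 : (k : ℝ) < 1 := by linarith
      have h3 : 0 < k := by exact_mod_cast h1
      have h4 : k < 1 := by exact_mod_cast h2
      omega
    · have h1 : (-1 : ℝ) < k := by linarith
      have h2 : (k : ℝ) < 0 := by linarith
      have h3 : -1 < k := by exact_mod_cast h1
      have h4 : k < 0 := by exact_mod_cast h2
      omega
  obtain ⟨k, hk⟩ := h t ht
  have hk' := abs_lt.1 hk
  have hlt' := abs_lt.1 hlt
  have h1 : (-1 : ℝ) < k := by linarith
  have h2 : (k : ℝ) < 1 := by linarith
  have h3 : -1 < k := by exact_mod_cast h1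
  have h4 : k < 1 := by exact_mod_cast h2
  obtain rfl : k = 0 := by omega
  simpa using hk.le

lemma norm_sub_le_of_phaseDist_lt {c₁ c₂ : ℝ → ℝ × ℝ} (h₁ : Continuous c₁) (h₂ : Continuous c₂)
    {T : ℝ} (hx : (c₁ 0).1 = (c₂ 0).1) (hy : |(c₁ 0).2 - (c₂ 0).2| < 1 / 2)
    (h : ∀ t ∈ Icc 0 T, phaseDist (c₁ t, deriv c₁ t) (c₂ t, deriv c₂ t) < 1 / 4) {t : ℝ}
    (ht : t ∈ Icc 0 T) : ‖c₁ t - c₂ t‖ ≤ 1 / 4 := by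
  refine max_le ?_ ?_
  · refine abs_le_of_forall_exists_int (f := fun t => (c₁ t - c₂ t).1) (h₁.sub h₂).fst
      (by simp [hx]) (fun t ht => ?_) ht
    obtain ⟨k, hk, -⟩ := exists_int_of_phaseDist_lt (h t ht)
    exact ⟨k.1, hk⟩
  · refine abs_le_of_forall_exists_int (f := fun t => (c₁ t - c₂ t).2) (h₁.sub h₂).snd
      (by simpa using hy) (fun t ht => ?_) ht
    obtain ⟨k, -, hk⟩ := exists_int_of_phaseDist_lt (h t ht)
    exact ⟨k.2, hk⟩

lemma log_le_elog {x : ℝ} (hx : 0 < x) {s : ℝ≥0∞} (h : ENNReal.ofReal x ≤ s) :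
    ((Real.log x : ℝ) : EReal) ≤ elog s := by
  have h0 : s ≠ 0 := ((ENNReal.ofReal_pos.2 hx).trans_le h).ne'
  rw [elog, if_neg h0]
  split_ifs with ht
  · exact le_top
  · exact EReal.coe_le_coe_iff.2 (Real.log_le_log hx ((ENNReal.ofReal_le_iff_le_toReal ht).1 h))

/-- Exponential growth of separated sets implies positive entropy. -/
lemma topEnt_pos_of_forall_exists {M : TorusMetric} {ε C P : ℝ} (hε : 0 < ε) (hC : 0 < C) (hP : 0 < P)
    (h : ∀ n : ℕ, ∃ F, IsSeparated M ε (C * (n + 1)) F ∧ 2 ^ n / P ≤ F.card) : 0 < topEnt M := by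
  have hlog := Real.log_pos one_lt_two
  set c := Real.log 2 / (2 * C) with hc
  have hc0 : 0 < c := by positivity
  refine lt_of_lt_of_le (EReal.coe_pos.2 hc0) (le_iSup₂_of_le ε hε ?_)
  refine le_limsup_of_frequently_le ?_
  have hT : Tendsto (fun n : ℕ => C * ((n : ℝ) + 1)) atTop atTop :=
    (tendsto_atTop_add_const_right _ _ tendsto_natCast_atTop_atTop).const_mul_atTop hC
  refine hT.frequently (Eventually.frequently ?_)
  filter_upwards [tendsto_natCast_atTop_atTop.eventually_ge_atTop (2 * Real.log P / Real.log 2 + 1)]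
    with n hn
  obtain ⟨F, hF, hcard⟩ := h n
  have hsep : ENNReal.ofReal (2 ^ n / P) ≤ sepCount M ε (C * (n + 1)) := by
    refine le_iSup₂_of_le F hF ?_
    rw [← ENNReal.ofReal_natCast]
    exact ENNReal.ofReal_le_ofReal hcard
  have hpos : 0 < C * ((n : ℝ) + 1) := by positivity
  have hle := mul_le_mul_of_nonneg_left (log_le_elog (by positivity) hsep)
    (EReal.coe_nonneg.2 (inv_nonneg.2 hpos.le))
  refine le_trans ?_ hle
  rw [← EReal.coe_mul, EReal.coe_le_coe_iff, Real.log_div (by positivity) hP.ne', Real.log_pow, hc,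
    inv_mul_eq_div, div_le_div_iff₀ (by positivity) hpos]
  have h1 : 2 * Real.log P / Real.log 2 ≤ n - 1 := by linarith
  rw [div_le_iff₀ hlog] at h1
  nlinarith

namespace TorusMetric.Board

variable {M : TorusMetric}

lemma topEnt_pos (B : M.Board) : 0 < topEnt M := by
  have hrate := B.one_le_rate
  choose γ hgeo hx hlo hhi hgood using fun S : Finset ℕ =>
    B.exists_isGeodesic {k : ℤ | ∃ j ∈ S, (j : ℤ) = k}
  have hmem : ∀ (S : Finset ℕ) (j : ℕ), (j : ℤ) ∈ {k : ℤ | ∃ j ∈ S, (j : ℤ) = k} ↔ j ∈ S := by simp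
  have half : ∀ (n : ℕ) (S S' : Finset ℕ) (j : ℕ), j < n → j ∈ S → j ∉ S' →
      ¬ ∀ t ∈ Icc 0 (B.rate * (n + 1)), ‖γ S t - γ S' t‖ ≤ 1 / 4 := by
    intro n S S' j hj hS hS' hle
    obtain ⟨η, hη, eη⟩ := hgood S (B.rate * (n + 1))
    obtain ⟨η', hη', eη'⟩ := hgood S' (B.rate * (n + 1))
    have hj' : (j : ℝ) + 1 ≤ n := by exact_mod_cast hj
    obtain ⟨t, ht, hlt⟩ := hη.exists_lt _ ((hmem S j).2 hS) (fun h => hS' ((hmem S' j).1 h))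
      (by nlinarith) hη'
    have e : η t - η' t = (η t - γ S t) + (γ S t - γ S' t) - (η' t - γ S' t) := by abel
    have h1 := _root_.norm_sub_le ((η t - γ S t) + (γ S t - γ S' t)) (η' t - γ S' t)
    have h2 := norm_add_le (η t - γ S t) (γ S t - γ S' t)
    rw [← e] at h1
    linarith [eη t ht, eη' t ht, hle t ht]
  have sep : ∀ (n : ℕ), ∀ S ∈ (Finset.range n).powerset, ∀ S' ∈ (Finset.range n).powerset, S ≠ S' →
      ¬ ∀ t ∈ Icc 0 (B.rate * (n + 1)), ‖γ S t - γ S' t‖ ≤ 1 / 4 := by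
    intro n S hS S' hS' hne hle
    rw [Finset.mem_powerset] at hS hS'
    by_cases hsub : S ⊆ S'
    · obtain ⟨j, hj, hj'⟩ := Finset.not_subset.1 fun h => hne (hsub.antisymm h)
      refine half n S' S j (Finset.mem_range.1 (hS' hj)) hj hj' fun t ht => ?_
      rw [norm_sub_rev]; exact hle t ht
    · obtain ⟨j, hj, hj'⟩ := Finset.not_subset.1 hsub
      exact half n S S' j (Finset.mem_range.1 (hS hj)) hj hj' hle
  set cells := Finset.Icc ⌊2 * -B.A⌋ ⌊2 * (B.m + B.A)⌋ with hcells
  have hmaps : ∀ S : Finset ℕ, ⌊2 * (γ S 0).2⌋ ∈ cells := fun S => Finset.mem_Icc.2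
    ⟨Int.floor_mono (by linarith [hlo S]), Int.floor_mono (by linarith [hhi S])⟩
  have hP : 0 < cells.card := Finset.card_pos.2 ⟨_, hmaps ∅⟩
  have hP' : (0 : ℝ) < cells.card := by exact_mod_cast hP
  refine topEnt_pos_of_forall_exists (ε := 1 / 32) (C := B.rate) (P := cells.card) (by norm_num)
    (by linarith) hP' fun n => ?_
  obtain ⟨y, -, hy⟩ := Finset.exists_le_card_fiber_of_nsmul_le_card_of_maps_to
    (s := (Finset.range n).powerset) (t := cells) (f := fun S => ⌊2 * (γ S 0).2⌋)
    (b := (2 ^ n / cells.card : ℝ)) (fun S _ => hmaps S) ⟨_, hmaps ∅⟩ (by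
      rw [Finset.card_powerset, Finset.card_range, nsmul_eq_mul, mul_div_cancel₀ _ hP'.ne']
      simp)
  classical
  refine ⟨({S ∈ (Finset.range n).powerset | ⌊2 * (γ S 0).2⌋ = y} : Finset (Finset ℕ)).image γ,
    ⟨?_, ?_⟩, ?_⟩
  · intro c hc
    obtain ⟨S, -, rfl⟩ := Finset.mem_image.1 hc
    exact hgeo S
  · intro c₁ h₁ c₂ h₂ hne
    obtain ⟨S, hS, rfl⟩ := Finset.mem_image.1 h₁
    obtain ⟨S', hS', rfl⟩ := Finset.mem_image.1 h₂
    rw [Finset.mem_filter] at hS hS'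
    by_contra! hle
    refine sep n S hS.1 S' hS'.1 (fun h => hne (by rw [h])) fun t ht => ?_
    refine norm_sub_le_of_phaseDist_lt (hgeo S).1.continuous (hgeo S').1.continuous
      ((hx S).trans (hx S').symm) ?_ (fun t ht => (hle t ht).trans_lt (by norm_num)) ht
    have := Int.abs_sub_lt_one_of_floor_eq_floor (hS.2.trans hS'.2.symm)
    rw [← mul_sub, abs_mul, abs_two] at this
    linarith
  · rw [Finset.card_image_of_injOn]
    · exact hy
    · intro S hS S' hS' h
      rw [Finset.mem_coe, Finset.mem_filter] at hS hS'
      by_contra hne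
      refine sep n S hS.1 S' hS'.1 hne fun t _ => ?_
      change γ S = γ S' at h
      rw [h, sub_self, norm_zero]; norm_num

end TorusMetric.Board

namespace TorusMetric

variable {M : TorusMetric}

lemma IsGeodesic.abs_sub_le {c : ℝ → ℝ × ℝ} (hc : M.IsGeodesic c) (s t : ℝ) :
    |(c s).2 - (c t).2| ≤ M.bd * |s - t| :=
  (norm_snd_le (c s - c t)).trans <| (M.norm_sub_le _ _).trans <|
    mul_le_mul_of_nonneg_left (hc.lip (min s t) (max s t) s ⟨min_le_left _ _, le_max_left _ _⟩ t
      ⟨min_le_right _ _, le_max_right _ _⟩) M.bd_pos.le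

/-- A geodesic segment is stranded away from the heights of its ends. -/
lemma IsGeodesic.exists_stranded {c : ℝ → ℝ × ℝ} (hc : M.IsGeodesic c) {a b lo hi : ℝ} (j : ℤ)
    (ha : (c a).2 + j ≤ lo - 1 ∨ hi + 1 ≤ (c a).2 + j)
    (hb : (c b).2 + j ≤ lo - 1 ∨ hi + 1 ≤ (c b).2 + j) :
    ∃ r > 0, M.Stranded ((fun t => c t + lat (0, j)) '' Icc a b) r lo hi := by
  have hbd := M.bd_pos
  obtain ⟨r, hr, H⟩ := hc.exists_isMetGeod a b
  refine ⟨min r (1 / M.bd), lt_min hr (by positivity), ?_⟩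
  rintro _ ⟨t, ht, rfl⟩ h1 h2
  have e : (c t + lat (0, j)).2 = (c t).2 + j := by simp [lat]
  rw [e] at h1 h2
  have far : ∀ u, ((c u).2 + j ≤ lo - 1 ∨ hi + 1 ≤ (c u).2 + j) → 1 / M.bd ≤ |t - u| := by
    intro u hu
    rw [div_le_iff₀' hbd]
    refine le_trans ?_ (hc.abs_sub_le t u)
    rcases hu with hu | hu
    · exact le_trans (by linarith) (le_abs_self _)
    · exact le_trans (by linarith) (neg_le_abs _)
  have fa := far a ha
  have fb := far b hb
  rw [abs_of_nonneg (by linarith [ht.1])] at fa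
  rw [abs_of_nonpos (by linarith [ht.2])] at fb
  have hm := min_le_right r (1 / M.bd)
  refine ⟨fun s => c (s + t) + lat (0, j), ?_, by simp, ?_⟩
  · refine IsMetGeod.add_lat (γ := fun s => c (s + t)) ?_ _
    have := (H t ht).comp_add t
    refine IsMetGeod.mono (by simpa using this) (neg_le_neg (min_le_left _ _)) (min_le_left _ _)
  · rintro _ ⟨s, hs, rfl⟩
    exact ⟨s + t, ⟨by linarith [hs.1], by linarith [hs.2]⟩, rfl⟩

lemma topEnt_pos_of_frequently {c : ℝ → ℝ × ℝ} (hc : M.IsGeodesic c) {R : ℝ}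
    (hlow : ∀ T, ∃ t ≥ T, (c t).2 ≤ R) (hhigh : ∀ T H, ∃ t ≥ T, H ≤ (c t).2) : 0 < topEnt M := by
  obtain ⟨α⟩ := M.nonempty_axis
  have hcont := hc.1.continuous
  have hbd := M.bd_pos
  set A := max |(α.curve α.low).2| |(α.curve α.high).2| with hA
  have hA0 : 0 ≤ A := (abs_nonneg _).trans (le_max_left _ _)
  have hAle : ∀ t, |(α.curve t).2| ≤ A := fun t => by
    have h1 := neg_abs_le (α.curve α.low).2
    have h2 := le_abs_self (α.curve α.high).2
    have h3 := le_max_left |(α.curve α.low).2| |(α.curve α.high).2|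
    have h4 := le_max_right |(α.curve α.low).2| |(α.curve α.high).2|
    exact abs_le.2 ⟨by linarith [α.low_le t], by linarith [α.le_high t]⟩
  set m := ⌈2 * A + 5 + M.bd * (M.bd * (4 * A + 5) + 1)⌉
  have hm := Int.le_ceil (2 * A + 5 + M.bd * (M.bd * (4 * A + 5) + 1))
  have hm0 : 2 * A + 5 ≤ m := le_trans (by
    have : 0 ≤ M.bd * (M.bd * (4 * A + 5) + 1) := by positivity
    linarith) hm
  obtain ⟨t₀, -, ht₀⟩ := hlow 0
  obtain ⟨t₁, h01, ht₁⟩ := hhigh t₀ (R + m + 1)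
  obtain ⟨t₂, h12, ht₂⟩ := hlow t₁
  obtain ⟨s₂, h22, hs₂⟩ := hhigh t₂ (R + m + 1)
  obtain ⟨τ, hτ, hmax⟩ := (isCompact_Icc (a := t₀) (b := t₂)).exists_isMaxOn ⟨t₁, h01, h12⟩
    hcont.snd.continuousOn
  obtain ⟨ρ, hρ, hmin⟩ := (isCompact_Icc (a := t₁) (b := s₂)).exists_isMinOn ⟨t₂, h12, h22⟩
    hcont.snd.continuousOn
  have hτ' : R + m + 1 ≤ (c τ).2 := ht₁.trans (hmax ⟨h01, h12⟩)
  have hρ' : (c ρ).2 ≤ R := le_trans (hmin ⟨h12, h22⟩) ht₂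
  set j := -⌈(c τ).2 - (m - A - 1)⌉ with hj
  have j1 := Int.le_ceil ((c τ).2 - (m - A - 1))
  have j2 := Int.ceil_lt_add_one ((c τ).2 - (m - A - 1))
  have ej : (j : ℝ) = -⌈(c τ).2 - (m - A - 1)⌉ := by rw [hj]; push_cast; rfl
  set i := -⌊(c ρ).2 - (A + 1)⌋ with hi
  have i1 := Int.floor_le ((c ρ).2 - (A + 1))
  have i2 := Int.lt_floor_add_one ((c ρ).2 - (A + 1))
  have ei : (i : ℝ) = -⌊(c ρ).2 - (A + 1)⌋ := by rw [hi]; push_cast; rfl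
  obtain ⟨r₁, hr₁, S₁⟩ := hc.exists_stranded (a := t₀) (b := t₂) (lo := -A - 1) (hi := m + A + 1) j
    (.inl (by linarith)) (.inl (by linarith))
  obtain ⟨r₂, hr₂, S₂⟩ := hc.exists_stranded (a := t₁) (b := s₂) (lo := -A - 1) (hi := m + A + 1) i
    (.inr (by linarith)) (.inr (by linarith))
  obtain ⟨X₁, hX₁⟩ := (isCompact_Icc (a := t₀) (b := s₂)).exists_bound_of_continuousOn
    hcont.fst.continuousOn
  set X := ⌈max X₁ (M.bd * α.period)⌉
  have hX := Int.le_ceil (max X₁ (M.bd * α.period))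
  have f1 : ∀ (k : ℤ) t, (c t + lat (0, k)).1 = (c t).1 := fun k t => by simp [lat]
  have f2 : ∀ (k : ℤ) t, (c t + lat (0, k)).2 = (c t).2 + k := fun k t => by simp [lat]
  have hcc : ∀ k : ℤ, Continuous fun t => c t + lat (0, k) := fun k => hcont.add continuous_const
  refine Board.topEnt_pos
    { α := α
      A := A
      h := (c τ).2 + j
      r := min r₁ r₂
      m := m
      X := X
      U := (fun t => c t + lat (0, j)) '' Icc t₀ t₂
      D := (fun t => c t + lat (0, i)) '' Icc t₁ s₂
      low := c t₀ + lat (0, j)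
      tip := c τ + lat (0, j)
      top := c t₁ + lat (0, i)
      bot := c ρ + lat (0, i)
      r_pos := lt_min hr₁ hr₂
      abs_snd_le := hAle
      period_le := (le_max_right _ _).trans hX
      le_m := hm
      lt_h := by linarith
      h_le := by linarith
      abs_le_of_mem_U := ?_
      snd_le_of_mem_U := ?_
      joinedIn_U := ?_
      low_snd := by rw [f2]; linarith
      tip_snd := f2 _ _
      abs_le_of_mem_D := ?_
      le_snd_of_mem_D := ?_
      joinedIn_D := ?_
      bot_snd := by rw [f2]; linarith
      top_snd := by rw [f2]; linarith
      stranded_U := S₁.mono (min_le_left _ _)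
      stranded_D := S₂.mono (min_le_right _ _) }
  · rintro _ ⟨t, ht, rfl⟩
    rw [f1]
    exact (hX₁ t ⟨ht.1, ht.2.trans h22⟩).trans ((le_max_left _ _).trans hX)
  · rintro _ ⟨t, ht, rfl⟩
    rw [f2]
    have : (c t).2 ≤ (c τ).2 := hmax ht
    linarith
  · exact (hcc j).continuousOn.joinedIn_image.mono (image_mono
      (uIcc_subset_Icc ⟨le_rfl, h01.trans h12⟩ hτ))
  · rintro _ ⟨t, ht, rfl⟩
    rw [f1]
    exact (hX₁ t ⟨h01.trans ht.1, ht.2⟩).trans ((le_max_left _ _).trans hX)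
  · rintro _ ⟨t, ht, rfl⟩
    rw [f2]
    have : (c ρ).2 ≤ (c t).2 := hmin ht
    linarith
  · exact (hcc i).continuousOn.joinedIn_image.mono (image_mono
      (uIcc_subset_Icc hρ ⟨le_rfl, h12.le.trans h22⟩))

end TorusMetric

/-- A linear isometric involution of the plane which preserves the lattice `ℤ²`. -/
structure LatticeInvolution where
  toFun : (ℝ × ℝ) →L[ℝ] (ℝ × ℝ)
  apply_apply : ∀ x, toFun (toFun x) = x
  norm2_apply : ∀ x, norm2 (toFun x) = norm2 x
  apply_lat : ∀ k, ∃ k', toFun (lat k) = lat k'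

namespace LatticeInvolution

/-- The reflection `(x, y) ↦ (x, -y)`. -/
def conj : LatticeInvolution where
  toFun := (ContinuousLinearMap.fst ℝ ℝ ℝ).prod (-ContinuousLinearMap.snd ℝ ℝ ℝ)
  apply_apply x := by simp
  norm2_apply x := by simp [norm2]
  apply_lat k := ⟨(k.1, -k.2), by simp [lat]⟩

/-- The reflection `(x, y) ↦ (y, x)`. -/
def swap : LatticeInvolution where
  toFun := (ContinuousLinearMap.snd ℝ ℝ ℝ).prod (ContinuousLinearMap.fst ℝ ℝ ℝ)
  apply_apply x := by simp
  norm2_apply x := by simp [norm2, add_comm]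
  apply_lat k := ⟨(k.2, k.1), by simp [lat]⟩

variable (L : LatticeInvolution) (M : TorusMetric)

lemma apply_ne_zero {v : ℝ × ℝ} (hv : v ≠ 0) : L.toFun v ≠ 0 := fun h =>
  hv (by rw [← L.apply_apply v, h, map_zero])

lemma comp_comp (c : ℝ → ℝ × ℝ) : L.toFun ∘ L.toFun ∘ c = c := funext fun t => L.apply_apply (c t)

/-- The pullback of a metric under a lattice involution. -/
def pull : TorusMetric where
  g x v w := M.g (L.toFun x) (L.toFun v) (L.toFun w)
  smooth := M.smooth.comp
    (f := fun p : (ℝ × ℝ) × (ℝ × ℝ) × (ℝ × ℝ) =>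
      (L.toFun p.1, L.toFun p.2.1, L.toFun p.2.2)) (by fun_prop)
  symm x v w := M.symm _ _ _
  linear x w := ((M.linear (L.toFun x) (L.toFun w)).mk' _ ∘ₗ L.toFun.toLinearMap).isLinear
  posdef x v hv := M.posdef _ _ (L.apply_ne_zero hv)
  periodic k x v w := by
    obtain ⟨k', hk'⟩ := L.apply_lat k
    rw [map_add, hk', M.periodic]

lemma deriv_comp {c : ℝ → ℝ × ℝ} (hc : ContDiff ℝ 1 c) (t : ℝ) :
    deriv (L.toFun ∘ c) t = L.toFun (deriv c t) :=
  (L.toFun.hasFDerivAt.comp_hasDerivAt t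
    ((hc.differentiable one_ne_zero).differentiableAt.hasDerivAt)).deriv

lemma length_pull {c : ℝ → ℝ × ℝ} (hc : ContDiff ℝ 1 c) (a b : ℝ) :
    (L.pull M).length c a b = M.length (L.toFun ∘ c) a b := by
  simp only [TorusMetric.length, L.deriv_comp hc]
  rfl

lemma dist_pull (x y : ℝ × ℝ) : (L.pull M).dist x y = M.dist (L.toFun x) (L.toFun y) := by
  unfold TorusMetric.dist
  congr 1
  ext r
  constructor
  · rintro ⟨c, hc, rfl, rfl, rfl⟩
    exact ⟨L.toFun ∘ c, L.toFun.contDiff.comp hc, rfl, rfl, L.length_pull M hc 0 1⟩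
  · rintro ⟨c, hc, h0, h1, rfl⟩
    have hc' : ContDiff ℝ 1 (L.toFun ∘ c) := L.toFun.contDiff.comp hc
    refine ⟨L.toFun ∘ c, hc', ?_, ?_, ?_⟩
    · simp [h0, L.apply_apply]
    · simp [h1, L.apply_apply]
    · rw [L.length_pull M hc', L.comp_comp]

variable {L M}

lemma isGeodesic_comp {c : ℝ → ℝ × ℝ} (hc : (L.pull M).IsGeodesic c) :
    M.IsGeodesic (L.toFun ∘ c) := by
  obtain ⟨h1, h2, h3⟩ := hc
  have hc1 : ContDiff ℝ 1 c := h1.of_le (by simp)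
  refine ⟨L.toFun.contDiff.comp h1, fun t => ?_, fun t => ?_⟩
  · rw [L.deriv_comp hc1]
    exact h2 t
  · obtain ⟨ε, hε, H⟩ := h3 t
    refine ⟨ε, hε, fun s₁ s₂ a b d => ?_⟩
    rw [← L.length_pull M hc1, ← H s₁ s₂ a b d, L.dist_pull]
    rfl

lemma pull_pull : L.pull (L.pull M) = M := by
  cases M
  simp only [pull, L.apply_apply]

lemma isGeodesic_pull {c : ℝ → ℝ × ℝ} (hc : M.IsGeodesic c) :
    (L.pull M).IsGeodesic (L.toFun ∘ c) :=
  isGeodesic_comp (M := L.pull M) (by rwa [pull_pull])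

lemma phaseDist_apply (p q v w : ℝ × ℝ) :
    phaseDist (L.toFun p, L.toFun v) (L.toFun q, L.toFun w) = phaseDist (p, v) (q, w) := by
  have key : ∀ k k', L.toFun (lat k) = lat k' →
      norm2 (L.toFun p - (L.toFun q + lat k')) + norm2 (L.toFun v - L.toFun w)
        = norm2 (p - (q + lat k)) + norm2 (v - w) := by
    intro k k' h
    rw [← h, ← map_add, ← map_sub, ← map_sub, L.norm2_apply, L.norm2_apply]
  unfold phaseDist
  congr 1
  ext r
  constructor
  · rintro ⟨k, rfl⟩
    obtain ⟨k', hk'⟩ := L.apply_lat k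
    exact ⟨k', key k' k (by rw [← hk', L.apply_apply])⟩
  · rintro ⟨k, rfl⟩
    obtain ⟨k', hk'⟩ := L.apply_lat k
    exact ⟨k', (key k k' hk').symm⟩

open Classical in
lemma isSeparated_image {ε T : ℝ} {F : Finset (ℝ → ℝ × ℝ)} (h : IsSeparated (L.pull M) ε T F) :
    IsSeparated M ε T (F.image (L.toFun ∘ ·)) := by
  constructor
  · intro c hc
    obtain ⟨c, hF, rfl⟩ := Finset.mem_image.1 hc
    exact isGeodesic_comp (h.1 c hF)
  · intro c₁ h₁ c₂ h₂ hne
    obtain ⟨c₁, hF₁, rfl⟩ := Finset.mem_image.1 h₁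
    obtain ⟨c₂, hF₂, rfl⟩ := Finset.mem_image.1 h₂
    obtain ⟨t, ht, hd⟩ := h.2 c₁ hF₁ c₂ hF₂ fun e => hne (by rw [e])
    refine ⟨t, ht, ?_⟩
    rw [L.deriv_comp ((h.1 c₁ hF₁).1.of_le (by simp)), L.deriv_comp ((h.1 c₂ hF₂).1.of_le (by simp))]
    exact hd.trans_eq (phaseDist_apply _ _ _ _).symm

lemma sepCount_pull_le (ε T : ℝ) : sepCount (L.pull M) ε T ≤ sepCount M ε T := by
  classical
  refine iSup₂_le fun F hF => ?_
  have hinj : Function.Injective fun c : ℝ → ℝ × ℝ => L.toFun ∘ c := fun c c' h => by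
    rw [← L.comp_comp c, ← L.comp_comp c']
    exact congrArg (L.toFun ∘ ·) h
  rw [← Finset.card_image_of_injective F hinj]
  exact le_iSup₂ (f := fun (F : Finset (ℝ → ℝ × ℝ)) (_ : IsSeparated M ε T F) => (F.card : ℝ≥0∞))
    _ (isSeparated_image hF)

lemma sepCount_pull (ε T : ℝ) : sepCount (L.pull M) ε T = sepCount M ε T :=
  (sepCount_pull_le ε T).antisymm <| by
    conv_lhs => rw [← pull_pull (L := L) (M := M)]
    exact sepCount_pull_le ε T

lemma topEnt_pull : topEnt (L.pull M) = topEnt M := by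
  simp only [topEnt, sepCount_pull]

end LatticeInvolution

/-- A continuous function that is unbounded on a half-line is unbounded on every smaller one. -/
lemma exists_ge_of_unbounded {f : ℝ → ℝ} (hf : Continuous f) (h : ∀ H, ∃ t ≥ 0, H ≤ f t) (T H : ℝ) :
    ∃ t ≥ T, H ≤ f t := by
  obtain ⟨C, hC⟩ := (isCompact_Icc (a := (0 : ℝ)) (b := T)).bddAbove_image hf.continuousOn
  obtain ⟨t, ht, h'⟩ := h (max H (C + 1))
  refine ⟨t, ?_, (le_max_left _ _).trans h'⟩
  by_contra! hlt
  have h1 := hC ⟨t, ⟨ht, hlt.le⟩, rfl⟩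
  have h2 := (le_max_right _ _).trans h'
  linarith

/-- A geodesic that returns infinitely often, and whose ordinate is unbounded, forces entropy. -/
lemma topEnt_pos_of_unbounded_abs_snd {M : TorusMetric} {c : ℝ → ℝ × ℝ} (hc : M.IsGeodesic c) {R : ℝ}
    (hlow : ∀ T, ∃ t ≥ T, |(c t).2| ≤ R) (h : ∀ H, ∃ t ≥ 0, H ≤ |(c t).2|) : 0 < topEnt M := by
  have hcont : Continuous fun t => (c t).2 := continuous_snd.comp hc.1.continuous
  by_cases hup : ∀ H, ∃ t ≥ 0, H ≤ (c t).2
  · exact TorusMetric.topEnt_pos_of_frequently hc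
      (fun T => (hlow T).imp fun t ht => ⟨ht.1, (abs_le.1 ht.2).2⟩)
      (exists_ge_of_unbounded hcont hup)
  · push Not at hup
    obtain ⟨H₀, hH₀⟩ := hup
    rw [← LatticeInvolution.topEnt_pull (L := .conj)]
    have e : ∀ t, ((LatticeInvolution.conj.toFun ∘ c) t).2 = -(c t).2 := fun t => rfl
    refine TorusMetric.topEnt_pos_of_frequently (LatticeInvolution.isGeodesic_pull hc) (R := R)
      (fun T => (hlow T).imp fun t ht => ⟨ht.1, ?_⟩) ?_
    · rw [e]
      linarith [(abs_le.1 ht.2).1]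
    · simp only [e]
      refine exists_ge_of_unbounded hcont.neg fun H => ?_
      obtain ⟨t, ht, h'⟩ := h (max H (H₀ + 1))
      refine ⟨t, ht, ?_⟩
      rcases le_abs.1 h' with h1 | h1
      · linarith [hH₀ t ht, (le_max_right H (H₀ + 1)).trans h1]
      · exact (le_max_left _ _).trans h1

/-- If there exists an oscillating geodesic ray on the universal covering `ℝ²` (realized as
the forward ray `c|_{[0,∞)}` of a complete geodesic which is neither bounded nor escaping),
then the geodesic flow of `g` has positive topological entropy. -/
theorem stmt11 (M : TorusMetric) (c : ℝ → ℝ × ℝ) (hc : M.IsGeodesic c)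
    (hnb : ¬ Bornology.IsBounded (c '' Set.Ici 0)) (hne : ¬ EscapesForward c) :
    0 < topEnt M := by
  obtain ⟨R, hR⟩ : ∃ R, ∀ T, ∃ t ≥ T, norm2 (c t) ≤ R := by
    rw [EscapesForward, tendsto_atTop_atTop] at hne
    push Not at hne
    exact hne.imp fun R h T => (h T).imp fun t ht => ⟨ht.1, ht.2.le⟩
  by_cases h2 : ∀ H, ∃ t ≥ 0, H ≤ |(c t).2|
  · exact topEnt_pos_of_unbounded_abs_snd hc
      (fun T => (hR T).imp fun t ht => ⟨ht.1, (abs_snd_le_norm2 _).trans ht.2⟩) h2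
  by_cases h1 : ∀ H, ∃ t ≥ 0, H ≤ |(c t).1|
  · rw [← LatticeInvolution.topEnt_pull (L := .swap)]
    exact topEnt_pos_of_unbounded_abs_snd (LatticeInvolution.isGeodesic_pull hc)
      (fun T => (hR T).imp fun t ht => ⟨ht.1, (abs_fst_le_norm2 _).trans ht.2⟩) h1
  push Not at h1 h2
  obtain ⟨H₁, h1⟩ := h1
  obtain ⟨H₂, h2⟩ := h2
  refine absurd (isBounded_iff_forall_norm_le.2 ⟨max H₁ H₂, ?_⟩) hnb
  rintro _ ⟨t, ht, rfl⟩
  exact max_le_max (h1 t ht).le (h2 t ht).le
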